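/- Let h be a smooth solution of the Hele-Shaw equation on [0,T], and let Φ : ℝ → [0,∞) be a C³ convex function whose derivative Φ' is also convex. Then for every 0 ≤ T' ≤ T, ∫_{𝕋ⁿ} Φ'(h(T',x))·(G(h(T',·))h(T',·))(x) dx + ∫₀^{T'} ∫_{𝕋ⁿ} Φ''(h)·a·((∂_t h)² + |∇_x h|²) dx dt ≤ ∫_{𝕋ⁿ} Φ'(h(0,x))·(G(h(0,·))h(0,·))(x) dx; in particular the map t ↦ ∫_{𝕋ⁿ} Φ'(h(t,x))·(G(h(t,·))h(t,·))(x) dx is non-increasing on [0,T]. -/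

import Mathlib

open MeasureTheory
open scoped Classical

noncomputable section

/-- ℤⁿ-periodicity for functions on ℝⁿ (model for functions on the torus 𝕋ⁿ = ℝⁿ/ℤⁿ). -/
def ZPeriodic (n : ℕ) (f : (Fin n → ℝ) → ℝ) : Prop :=
  ∀ (x : Fin n → ℝ) (k : Fin n → ℤ), f (x + fun i => (k i : ℝ)) = f x

/-- ℤⁿ-periodicity in the horizontal variable for functions on ℝⁿ × ℝ. -/
def ZPeriodicE (n : ℕ) (φ : (Fin n → ℝ) × ℝ → ℝ) : Prop :=
  ∀ (x : Fin n → ℝ) (y : ℝ) (k : Fin n → ℤ), φ (x + fun i => (k i : ℝ), y) = φ (x, y)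

/-- Fundamental cell of the torus 𝕋ⁿ. -/
def cell (n : ℕ) : Set (Fin n → ℝ) := Set.univ.pi fun _ => Set.Ico (0:ℝ) 1

/-- i-th partial derivative of a function on ℝⁿ. -/
def pdX (n : ℕ) (f : (Fin n → ℝ) → ℝ) (i : Fin n) (x : Fin n → ℝ) : ℝ :=
  fderiv ℝ f x (Pi.single i 1)

/-- Directional derivative of a function on ℝⁿ × ℝ. -/
def pdE (n : ℕ) (φ : (Fin n → ℝ) × ℝ → ℝ) (v : (Fin n → ℝ) × ℝ)
    (p : (Fin n → ℝ) × ℝ) : ℝ := fderiv ℝ φ p v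

def eX (n : ℕ) (i : Fin n) : (Fin n → ℝ) × ℝ := (Pi.single i 1, 0)
def eY (n : ℕ) : (Fin n → ℝ) × ℝ := (0, 1)

/-- Laplacian Δ_{x,y} on ℝⁿ × ℝ. -/
def lapE (n : ℕ) (φ : (Fin n → ℝ) × ℝ → ℝ) (p : (Fin n → ℝ) × ℝ) : ℝ :=
  (∑ i, pdE n (pdE n φ (eX n i)) (eX n i) p) + pdE n (pdE n φ (eY n)) (eY n) p

/-- |∇_{x,y}φ|². -/
def gradSqE (n : ℕ) (φ : (Fin n → ℝ) × ℝ → ℝ) (p : (Fin n → ℝ) × ℝ) : ℝ :=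
  (∑ i, (pdE n φ (eX n i) p)^2) + (pdE n φ (eY n) p)^2

/-- One periodic cell of the fluid domain Ω(h) = {y < h(x)}. -/
def fluidCell (n : ℕ) (h : (Fin n → ℝ) → ℝ) : Set ((Fin n → ℝ) × ℝ) :=
  {p | p.1 ∈ cell n ∧ p.2 < h p.1}

/-- φ is the harmonic extension of ψ to Ω(h) = {y < h(x)}: it is harmonic in Ω(h),
has boundary value ψ, is periodic in x, and has square-integrable gradient. -/
structure IsHarmonicExt (n : ℕ) (h ψ : (Fin n → ℝ) → ℝ)
    (φ : (Fin n → ℝ) × ℝ → ℝ) : Prop where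
  smooth : ContDiff ℝ (⊤ : ℕ∞) φ
  periodic : ZPeriodicE n φ
  harmonic : ∀ p : (Fin n → ℝ) × ℝ, p.2 < h p.1 → lapE n φ p = 0
  boundary : ∀ x, φ (x, h x) = ψ x
  gradL2 : IntegrableOn (gradSqE n φ) (fluidCell n h)

/-- The Dirichlet-to-Neumann operator:
(G(h)ψ)(x) = ∂_yφ(x,h(x)) − ∇h(x)·∇_xφ(x,h(x)), where φ is the harmonic extension of ψ. -/
def DtN (n : ℕ) (h ψ : (Fin n → ℝ) → ℝ) : (Fin n → ℝ) → ℝ :=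
  if H : ∃ φ, IsHarmonicExt n h ψ φ then
    fun x => pdE n H.choose (eY n) (x, h x)
      - ∑ i, pdX n h i x * pdE n H.choose (eX n i) (x, h x)
  else 0

/-- (B(h)ψ)(x) = ∂_yφ(x,h(x)). -/
def Bop (n : ℕ) (h ψ : (Fin n → ℝ) → ℝ) : (Fin n → ℝ) → ℝ :=
  if H : ∃ φ, IsHarmonicExt n h ψ φ then
    fun x => pdE n H.choose (eY n) (x, h x)
  else 0

/-- (V(h)ψ)(x) = ∇_xφ(x,h(x)). -/
def Vop (n : ℕ) (h ψ : (Fin n → ℝ) → ℝ) : (Fin n → ℝ) → Fin n → ℝ :=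
  if H : ∃ φ, IsHarmonicExt n h ψ φ then
    fun x i => pdE n H.choose (eX n i) (x, h x)
  else 0

/-- Divergence of a vector field on the torus. -/
def divX (n : ℕ) (W : (Fin n → ℝ) → Fin n → ℝ) (x : Fin n → ℝ) : ℝ :=
  ∑ i, pdX n (fun z => W z i) i x

/-- h is a smooth solution of the Hele-Shaw equation ∂ₜh + G(h)h = 0 on [0,T]. -/
structure IsHeleShawSol (n : ℕ) (T : ℝ) (h : ℝ → (Fin n → ℝ) → ℝ) : Prop where
  smooth : ContDiff ℝ (⊤ : ℕ∞) (Function.uncurry h)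
  periodic : ∀ t : ℝ, ZPeriodic n (h t)
  extension : ∀ t ∈ Set.Icc 0 T, ∃ φ, IsHarmonicExt n (h t) (h t) φ
  equation : ∀ t ∈ Set.Icc 0 T, ∀ x, deriv (fun s => h s x) t + DtN n (h t) (h t) x = 0

/-- B(t,x) = (B(h(t,·))h(t,·))(x). -/
def HSB (n : ℕ) (h : ℝ → (Fin n → ℝ) → ℝ) (t : ℝ) (x : Fin n → ℝ) : ℝ :=
  Bop n (h t) (h t) x

/-- V(t,x) = (V(h(t,·))h(t,·))(x). -/
def HSV (n : ℕ) (h : ℝ → (Fin n → ℝ) → ℝ) (t : ℝ) (x : Fin n → ℝ) : Fin n → ℝ :=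
  Vop n (h t) (h t) x

/-- The Rayleigh–Taylor coefficient a = 1 − B. -/
def HSa (n : ℕ) (h : ℝ → (Fin n → ℝ) → ℝ) (t : ℝ) (x : Fin n → ℝ) : ℝ :=
  1 - HSB n h t x

/-- γ = (1+|∇h|²)⁻¹ ( G(h)(B²+|V|²) − 2B G(h)B − 2V·G(h)V ). -/
def HSgamma (n : ℕ) (h : ℝ → (Fin n → ℝ) → ℝ) (t : ℝ) (x : Fin n → ℝ) : ℝ :=
  (1 + ∑ i, (pdX n (h t) i x)^2)⁻¹ *
    ( DtN n (h t) (fun z => (HSB n h t z)^2 + ∑ i, (HSV n h t z i)^2) x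
      - 2 * HSB n h t x * DtN n (h t) (fun z => HSB n h t z) x
      - 2 * ∑ i, HSV n h t x i * DtN n (h t) (fun z => HSV n h t z i) x )

/-- L(h)f = −V·∇f − ½(div V)f + √a G(h)(√a f). -/
def Lop (n : ℕ) (h : ℝ → (Fin n → ℝ) → ℝ) (t : ℝ) (f : (Fin n → ℝ) → ℝ)
    (x : Fin n → ℝ) : ℝ :=
  - (∑ i, HSV n h t x i * pdX n f i x)
  - (1/2) * divX n (HSV n h t) x * f x
  + Real.sqrt (HSa n h t x) * DtN n (h t) (fun z => Real.sqrt (HSa n h t z) * f z) x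



/-! ## Calculus of the directional derivatives -/
section calc1
open scoped ContDiff

lemma hs_pdE_contDiff {n : ℕ} {φ : (Fin n → ℝ) × ℝ → ℝ} (hφ : ContDiff ℝ ∞ φ)
    (v : (Fin n → ℝ) × ℝ) : ContDiff ℝ ∞ (pdE n φ v) := by
  unfold pdE
  exact (hφ.fderiv_right (m := ∞) (by simp)).clm_apply contDiff_const

lemma hs_pdE_contDiff_one {n : ℕ} {φ : (Fin n → ℝ) × ℝ → ℝ} (hφ : ContDiff ℝ 2 φ)
    (v : (Fin n → ℝ) × ℝ) : ContDiff ℝ 1 (pdE n φ v) := by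
  unfold pdE
  exact (hφ.fderiv_right (m := 1) (by norm_num)).clm_apply contDiff_const

lemma hs_pdE_continuous {n : ℕ} {φ : (Fin n → ℝ) × ℝ → ℝ} (hφ : ContDiff ℝ 1 φ)
    (v : (Fin n → ℝ) × ℝ) : Continuous (pdE n φ v) := by
  unfold pdE
  exact (hφ.continuous_fderiv (by simp)).clm_apply continuous_const

lemma hs_pdX_contDiff {n : ℕ} {f : (Fin n → ℝ) → ℝ} (hf : ContDiff ℝ ∞ f)
    (i : Fin n) : ContDiff ℝ ∞ (pdX n f i) := by
  unfold pdX
  exact (hf.fderiv_right (m := ∞) (by simp)).clm_apply contDiff_const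

lemma hs_pdX_continuous {n : ℕ} {f : (Fin n → ℝ) → ℝ} (hf : ContDiff ℝ 1 f)
    (i : Fin n) : Continuous (pdX n f i) := by
  unfold pdX
  exact (hf.continuous_fderiv (by simp)).clm_apply continuous_const

lemma hs_pdE_add {n : ℕ} {f g : (Fin n → ℝ) × ℝ → ℝ} (hf : Differentiable ℝ f)
    (hg : Differentiable ℝ g) (v p) :
    pdE n (fun q => f q + g q) v p = pdE n f v p + pdE n g v p := by
  unfold pdE
  rw [fderiv_fun_add (hf p) (hg p)]; rfl

lemma hs_pdE_sub {n : ℕ} {f g : (Fin n → ℝ) × ℝ → ℝ} (hf : Differentiable ℝ f)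
    (hg : Differentiable ℝ g) (v p) :
    pdE n (fun q => f q - g q) v p = pdE n f v p - pdE n g v p := by
  unfold pdE
  rw [fderiv_fun_sub (hf p) (hg p)]; rfl

lemma hs_pdE_mul {n : ℕ} {f g : (Fin n → ℝ) × ℝ → ℝ} (hf : Differentiable ℝ f)
    (hg : Differentiable ℝ g) (v p) :
    pdE n (fun q => f q * g q) v p = f p * pdE n g v p + pdE n f v p * g p := by
  unfold pdE
  rw [fderiv_fun_mul (hf p) (hg p)]
  simp [mul_comm]

lemma hs_pdE_const_mul {n : ℕ} {f : (Fin n → ℝ) × ℝ → ℝ} (hf : Differentiable ℝ f)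
    (c : ℝ) (v p) :
    pdE n (fun q => c * f q) v p = c * pdE n f v p := by
  unfold pdE
  rw [fderiv_const_mul (hf p)]; rfl

lemma hs_pdE_const {n : ℕ} (c : ℝ) (v p) :
    pdE n (fun _ => c) v p = 0 := by
  unfold pdE
  simp

lemma hs_pdE_comp {n : ℕ} {G : ℝ → ℝ} {f : (Fin n → ℝ) × ℝ → ℝ} (hG : Differentiable ℝ G)
    (hf : Differentiable ℝ f) (v p) :
    pdE n (fun q => G (f q)) v p = deriv G (f p) * pdE n f v p := by
  unfold pdE
  have := ((hG (f p)).hasDerivAt.comp_hasFDerivAt p (hf p).hasFDerivAt).fderiv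
  have h2 : (fun q => G (f q)) = G ∘ f := rfl
  rw [h2, this]; simp

lemma hs_periodicE_pd {n : ℕ} {φ : (Fin n → ℝ) × ℝ → ℝ} (h : ZPeriodicE n φ) (v) :
    ZPeriodicE n (pdE n φ v) := by
  intro x y k
  unfold pdE
  have h1 : (fun q : (Fin n → ℝ) × ℝ => φ (q + ((fun i => (k i : ℝ)), 0))) = φ := by
    funext q
    obtain ⟨a, b⟩ := q
    simpa using h a b k
  have h2 := fderiv_comp_add_right (𝕜 := ℝ) (f := φ) (x := (x, y)) ((fun i => (k i : ℝ)), (0:ℝ))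
  rw [h1] at h2
  rw [h2]; simp

lemma hs_periodic_pdX {n : ℕ} {f : (Fin n → ℝ) → ℝ} (h : ZPeriodic n f) (i) :
    ZPeriodic n (pdX n f i) := by
  intro x k
  unfold pdX
  have h1 : (fun q : (Fin n → ℝ) => f (q + (fun i => (k i : ℝ)))) = f := by
    funext q
    exact h q k
  have h2 := fderiv_comp_add_right (𝕜 := ℝ) (f := f) (x := x) (fun i => (k i : ℝ))
  rw [h1] at h2
  rw [h2]

/-- vertical shift -/
lemma hs_pdE_shift {n : ℕ} (φ : (Fin n → ℝ) × ℝ → ℝ) (d : ℝ) (v p) :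
    pdE n (fun q => φ (q.1, q.2 + d)) v p = pdE n φ v (p.1, p.2 + d) := by
  unfold pdE
  have h1 : (fun q : (Fin n → ℝ) × ℝ => φ (q.1, q.2 + d)) = fun q => φ (q + (0, d)) := by
    funext q
    congr 1; ext <;> simp
  rw [h1, fderiv_comp_add_right]
  congr 2; ext <;> simp

/-- derivative along the graph -/
lemma hs_hasFDeriv_graph {n : ℕ} {φ : (Fin n → ℝ) × ℝ → ℝ} {h : (Fin n → ℝ) → ℝ}
    (hφ : Differentiable ℝ φ) (hh : Differentiable ℝ h) (z : ℝ) (i : Fin n) (x : Fin n → ℝ) :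
    pdX n (fun x => φ (x, z + h x)) i x =
      pdE n φ (eX n i) (x, z + h x) + pdX n h i x * pdE n φ (eY n) (x, z + h x) := by
  unfold pdX pdE
  have h1 : HasFDerivAt (fun x => (x, z + h x))
      ((ContinuousLinearMap.id ℝ (Fin n → ℝ)).prod (fderiv ℝ h x)) x :=
    (hasFDerivAt_id x).prodMk ((hh x).hasFDerivAt.const_add z)
  have h2 := ((hφ (x, z + h x)).hasFDerivAt.comp x h1).fderiv
  have h3 : (fun x => φ (x, z + h x)) = φ ∘ (fun x => (x, z + h x)) := rfl
  rw [h3, h2]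
  have h4 : ((Pi.single i (1:ℝ) : Fin n → ℝ), fderiv ℝ h x (Pi.single i 1)) =
      eX n i + fderiv ℝ h x (Pi.single i 1) • eY n := by
    unfold eX eY; ext <;> simp
  simp only [ContinuousLinearMap.comp_apply, ContinuousLinearMap.prod_apply,
    ContinuousLinearMap.id_apply]
  rw [h4, map_add, map_smul]; simp

/-- vertical derivative -/
lemma hs_hasDerivAt_vert {n : ℕ} {φ : (Fin n → ℝ) × ℝ → ℝ}
    (hφ : Differentiable ℝ φ) (x : Fin n → ℝ) (y : ℝ) :
    HasDerivAt (fun y => φ (x, y)) (pdE n φ (eY n) (x, y)) y := by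
  have h1 : HasDerivAt (fun y : ℝ => (x, y)) ((0 : Fin n → ℝ), (1:ℝ)) y :=
    (hasDerivAt_const y x).prodMk (hasDerivAt_id y)
  exact (hφ (x, y)).hasFDerivAt.comp_hasDerivAt y h1

end calc1

/-! ## Periodicity and compactness -/

lemma hs_exists_cell {n : ℕ} (x : Fin n → ℝ) :
    ∃ k : Fin n → ℤ, (x + fun i => (k i : ℝ)) ∈ cell n := by
  refine ⟨fun i => -⌊x i⌋, ?_⟩
  intro i _
  simp only [Pi.add_apply, Int.cast_neg, Set.mem_Ico]
  have h1 := Int.floor_le (x i)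
  have h2 := Int.lt_floor_add_one (x i)
  constructor <;> linarith

lemma hs_cell_subset {n : ℕ} : cell n ⊆ Set.Icc (0 : Fin n → ℝ) 1 := by
  intro x hx
  constructor
  · intro i; exact (hx i trivial).1
  · intro i; exact (hx i trivial).2.le

lemma hs_cell_meas {n : ℕ} : MeasurableSet (cell n) :=
  MeasurableSet.univ_pi fun _ => measurableSet_Ico

lemma hs_cell_ae {n : ℕ} : cell n =ᵐ[volume] Set.Icc (0 : Fin n → ℝ) 1 := by
  unfold cell
  exact Measure.univ_pi_Ico_ae_eq_Icc (μ := fun _ => volume) (f := fun _ => (0:ℝ)) (g := fun _ => 1)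

lemma hs_cell_vol {n : ℕ} : volume (cell n) = 1 := by
  unfold cell
  rw [Real.volume_pi_Ico]; simp

instance hs_cell_prob {n : ℕ} : IsProbabilityMeasure ((volume : Measure (Fin n → ℝ)).restrict (cell n)) :=
  ⟨by simp [hs_cell_vol]⟩

lemma hs_integrableOn_cell {n : ℕ} {f : (Fin n → ℝ) → ℝ} (hf : Continuous f) :
    IntegrableOn f (cell n) :=
  (hf.continuousOn.integrableOn_compact isCompact_Icc).mono_set hs_cell_subset

lemma hs_tube {n : ℕ} {X : Type*} [TopologicalSpace X] (f : (Fin n → ℝ) → X → ℝ)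
    (hf : Continuous fun p : X × (Fin n → ℝ) => f p.2 p.1) (hp : ∀ z, ZPeriodic n (fun x => f x z))
    (z0 : X) (c : ℝ) (h : ∀ x, f x z0 < c) : ∀ᶠ z in nhds z0, ∀ x, f x z < c := by
  have := (isCompact_Icc (a := (0 : Fin n → ℝ)) (b := 1)).eventually_forall_of_forall_eventually
    (x₀ := z0) (P := fun z x => f x z < c) (by
      intro y _
      exact hf.continuousAt.eventually_lt continuousAt_const (h y))
  filter_upwards [this] with z hz x
  obtain ⟨k, hk⟩ := hs_exists_cell x
  have := hz _ (hs_cell_subset hk)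
  have h2 := hp z x k
  simp only at h2
  linarith

lemma hs_bdd {n : ℕ} {f : (Fin n → ℝ) → ℝ} (hf : Continuous f) (hp : ZPeriodic n f) :
    ∃ C, 0 ≤ C ∧ ∀ x, |f x| ≤ C := by
  obtain ⟨C, hC⟩ := (isCompact_Icc (a := (0 : Fin n → ℝ)) (b := 1)).exists_bound_of_continuousOn
    hf.continuousOn
  refine ⟨max C 0, le_max_right _ _, fun x => ?_⟩
  obtain ⟨k, hk⟩ := hs_exists_cell x
  rw [← hp x k]
  exact (hC _ (hs_cell_subset hk)).trans (le_max_left _ _)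

/-- bounds of a periodic continuous function in horizontal strips around a graph -/
lemma hs_bdd_strip {n : ℕ} {f : (Fin n → ℝ) × ℝ → ℝ} (hf : Continuous f) (hp : ZPeriodicE n f)
    (a b : ℝ) : ∃ C, 0 ≤ C ∧ ∀ x y, a ≤ y → y ≤ b → |f (x, y)| ≤ C := by
  obtain ⟨C, hC⟩ := ((isCompact_Icc (a := (0 : Fin n → ℝ)) (b := 1)).prod
    (isCompact_Icc (a := a) (b := b))).exists_bound_of_continuousOn hf.continuousOn
  refine ⟨max C 0, le_max_right _ _, fun x y h1 h2 => ?_⟩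
  obtain ⟨k, hk⟩ := hs_exists_cell x
  rw [← hp x y k]
  exact (hC _ ⟨hs_cell_subset hk, h1, h2⟩).trans (le_max_left _ _)

/-- first order comparison, uniform in `x` -/
lemma hs_first_order {n : ℕ} (k k' : (Fin n → ℝ) → ℝ → ℝ)
    (hk : ∀ x s, HasDerivAt (k x) (k' x s) s)
    (hc : Continuous fun p : ℝ × (Fin n → ℝ) => k' p.2 p.1)
    (hp : ∀ z, ZPeriodic n (fun x => k' x z)) (h0 : ∀ x, k x 0 = 0) (β : ℝ)
    (hβ : ∀ x, k' x 0 < β) : ∃ δ0 > 0, ∀ δ, 0 ≤ δ → δ < δ0 → ∀ x, k x δ ≤ β * δ := by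
  have h1 := hs_tube k' hc hp 0 β hβ
  obtain ⟨δ0, h0', h2⟩ := Metric.eventually_nhds_iff.1 h1
  refine ⟨δ0, h0', fun δ hδ hδ' x => ?_⟩
  have := (convex_Icc (0:ℝ) δ).image_sub_le_mul_sub_of_deriv_le (f := k x) (C := β)
    (fun s _ => (hk x s).continuousAt.continuousWithinAt)
    (fun s _ => (hk x s).differentiableAt.differentiableWithinAt)
    (fun s hs => by
      rw [interior_Icc] at hs
      rw [(hk x s).deriv]
      refine (h2 ?_ x).le
      rw [Real.dist_eq, sub_zero, abs_of_pos hs.1]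
      linarith [hs.2]) 0 (by simp [hδ]) δ (by simp [hδ]) hδ
  rw [h0] at this
  linarith

/-! ## The divergence theorem on the torus -/

lemma hs_div_torus {n : ℕ} (hn : 1 ≤ n) (F : Fin n → (Fin n → ℝ) → ℝ)
    (hF : ∀ i, ContDiff ℝ 1 (F i)) (hp : ∀ i, ZPeriodic n (F i)) :
    ∫ x in cell n, ∑ i, pdX n (F i) i x = 0 := by
  obtain ⟨m, rfl⟩ : ∃ m, n = m + 1 := ⟨n - 1, by omega⟩
  rw [setIntegral_congr_set hs_cell_ae]
  have := integral_divergence_of_hasFDerivAt_off_countable' (E := ℝ) (n := m) (0 : Fin (m+1) → ℝ) 1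
    (fun i => by simp) F (fun i x => fderiv ℝ (F i) x) ∅ Set.countable_empty
    (fun i => (hF i).continuous.continuousOn)
    (fun x _ i => ((hF i).differentiable (by simp) x).hasFDerivAt)
    (Continuous.continuousOn (continuous_finsetSum _ fun i _ =>
      ((hF i).continuous_fderiv (by simp)).clm_apply continuous_const) |>.integrableOn_compact
      isCompact_Icc)
  refine this.trans ?_
  refine Finset.sum_eq_zero fun i _ => ?_
  rw [sub_eq_zero]
  congr 1
  funext x
  have h1 := hp i (Fin.insertNth i 0 x) (Pi.single i 1)
  rw [show ((0 : Fin (m+1) → ℝ) i) = 0 from rfl, ← h1]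
  congr 1
  funext j
  refine Fin.succAboveCases i ?_ (fun j => ?_) j
  · simp
  · simp


/-! ## Integration over the fluid domain -/

lemma hs_fluid_meas {n : ℕ} {h : (Fin n → ℝ) → ℝ} (hh : Continuous h) :
    MeasurableSet (fluidCell n h) := by
  have h1 : MeasurableSet {p : (Fin n → ℝ) × ℝ | p.1 ∈ cell n} := measurable_fst hs_cell_meas
  have h2 : MeasurableSet {p : (Fin n → ℝ) × ℝ | p.2 < h p.1} :=
    (isOpen_lt continuous_snd (hh.comp continuous_fst)).measurableSet
  exact h1.inter h2

lemma hs_fluid_indicator {n : ℕ} (h : (Fin n → ℝ) → ℝ) (f : (Fin n → ℝ) × ℝ → ℝ)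
    (x : Fin n → ℝ) (y : ℝ) :
    (fluidCell n h).indicator f (x, y) =
      (cell n).indicator (fun x => (Set.Iio (h x)).indicator (fun y => f (x, y)) y) x := by
  unfold fluidCell
  by_cases h1 : x ∈ cell n <;> by_cases h2 : y < h x <;> simp [Set.indicator, h1, h2]

lemma hs_fluid_integral {n : ℕ} {h : (Fin n → ℝ) → ℝ} (hh : Continuous h)
    {f : (Fin n → ℝ) × ℝ → ℝ} (hf : IntegrableOn f (fluidCell n h)) :
    ∫ p in fluidCell n h, f p = ∫ x in cell n, ∫ y in Set.Iio (h x), f (x, y) := by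
  rw [← integral_indicator (hs_fluid_meas hh)]
  have h1 := (integrable_indicator_iff (hs_fluid_meas hh)).2 hf
  rw [Measure.volume_eq_prod] at h1 ⊢
  rw [integral_prod _ h1, ← integral_indicator hs_cell_meas]
  congr 1
  funext x
  simp only [hs_fluid_indicator]
  by_cases hx : x ∈ cell n
  · simp only [Set.indicator_of_mem hx]
    rw [integral_indicator measurableSet_Iio]
  · simp [Set.indicator_of_notMem hx]

lemma hs_fluid_slice {n : ℕ} {h : (Fin n → ℝ) → ℝ} (hh : Continuous h)
    {f : (Fin n → ℝ) × ℝ → ℝ} (hf : IntegrableOn f (fluidCell n h)) :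
    (∀ᵐ x ∂(volume.restrict (cell n)), IntegrableOn (fun y => f (x, y)) (Set.Iio (h x))) ∧
    IntegrableOn (fun x => ∫ y in Set.Iio (h x), f (x, y)) (cell n) := by
  have h1 := (integrable_indicator_iff (hs_fluid_meas hh)).2 hf
  rw [Measure.volume_eq_prod] at h1
  constructor
  · rw [ae_restrict_iff' hs_cell_meas]
    filter_upwards [h1.prod_right_ae] with x hx hxc
    rw [← integrable_indicator_iff measurableSet_Iio]
    refine hx.congr (Filter.Eventually.of_forall fun y => ?_)
    simp only [hs_fluid_indicator, Set.indicator_of_mem hxc]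
  · rw [← integrable_indicator_iff hs_cell_meas]
    refine h1.integral_prod_left.congr (Filter.Eventually.of_forall fun x => ?_)
    simp only [hs_fluid_indicator]
    by_cases hx : x ∈ cell n
    · simp only [Set.indicator_of_mem hx]
      rw [integral_indicator measurableSet_Iio]
    · simp [Set.indicator_of_notMem hx]

lemma hs_bdd_above_cell {n : ℕ} {h : (Fin n → ℝ) → ℝ} (hh : Continuous h) :
    ∃ C, 0 ≤ C ∧ ∀ x ∈ cell n, |h x| ≤ C := by
  obtain ⟨C, hC⟩ := (isCompact_Icc (a := (0 : Fin n → ℝ)) (b := 1)).exists_bound_of_continuousOn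
    hh.continuousOn
  exact ⟨max C 0, le_max_right _ _, fun x hx =>
    (hC _ (hs_cell_subset hx)).trans (le_max_left _ _)⟩

lemma hs_integrable_slab {n : ℕ} {f : (Fin n → ℝ) × ℝ → ℝ} (hf : Continuous f) (a b : ℝ) :
    IntegrableOn f (cell n ×ˢ Set.Icc a b) :=
  (hf.continuousOn.integrableOn_compact (isCompact_Icc.prod isCompact_Icc)).mono_set
    (Set.prod_mono hs_cell_subset subset_rfl)

/-- functions integrable on one fluid cell are integrable on the others -/
lemma hs_fluid_integrable_change {n : ℕ} {h h' : (Fin n → ℝ) → ℝ} (hh : Continuous h)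
    (hh' : Continuous h') {f : (Fin n → ℝ) × ℝ → ℝ} (hf : Continuous f)
    (hi : IntegrableOn f (fluidCell n h)) : IntegrableOn f (fluidCell n h') := by
  obtain ⟨C, hC0, hC⟩ := hs_bdd_above_cell hh
  obtain ⟨C', hC0', hC'⟩ := hs_bdd_above_cell hh'
  refine (hi.union (hs_integrable_slab hf (-C) C')).mono_set ?_
  rintro ⟨x, y⟩ ⟨h1, h2⟩
  simp only at h1 h2
  by_cases h3 : y < h x
  · left; exact ⟨h1, h3⟩
  · right
    refine ⟨h1, ?_, ?_⟩
    · have := (abs_le.1 (hC x h1)).1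
      simp only; linarith
    · have := (abs_le.1 (hC' x h1)).2
      simp only; linarith

lemma hs_fluid_integrable_deep {n : ℕ} {h : (Fin n → ℝ) → ℝ} (hh : Continuous h)
    {f : (Fin n → ℝ) × ℝ → ℝ} (hf : Continuous f) (M : ℝ)
    (hM : ∀ p : (Fin n → ℝ) × ℝ, p.1 ∈ cell n → p.2 ≤ M → f p = 0) :
    IntegrableOn f (fluidCell n h) := by
  refine hs_fluid_integrable_change (h := fun _ => M) continuous_const hh hf ?_
  refine (integrableOn_zero (s := fluidCell n fun _ => M)).congr_fun ?_
    (hs_fluid_meas continuous_const)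
  rintro p ⟨h1, h2⟩
  exact (hM p h1 (le_of_lt h2)).symm

def hsDiv (n : ℕ) (Fx : Fin n → (Fin n → ℝ) × ℝ → ℝ) (Fy : (Fin n → ℝ) × ℝ → ℝ)
    (p : (Fin n → ℝ) × ℝ) : ℝ := (∑ i, pdE n (Fx i) (eX n i) p) + pdE n Fy (eY n) p

def hsFlux (n : ℕ) (h : (Fin n → ℝ) → ℝ) (Fx : Fin n → (Fin n → ℝ) × ℝ → ℝ)
    (Fy : (Fin n → ℝ) × ℝ → ℝ) (x : Fin n → ℝ) : ℝ :=
  Fy (x, h x) - ∑ i, pdX n h i x * Fx i (x, h x)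

lemma hs_div_continuous {n : ℕ} {Fx : Fin n → (Fin n → ℝ) × ℝ → ℝ} {Fy : (Fin n → ℝ) × ℝ → ℝ}
    (hFx : ∀ i, ContDiff ℝ 1 (Fx i)) (hFy : ContDiff ℝ 1 Fy) : Continuous (hsDiv n Fx Fy) := by
  unfold hsDiv
  exact (continuous_finsetSum _ fun i _ => hs_pdE_continuous (hFx i) _).add
    (hs_pdE_continuous hFy _)

lemma hs_flux_continuous {n : ℕ} {h : (Fin n → ℝ) → ℝ} {Fx : Fin n → (Fin n → ℝ) × ℝ → ℝ}
    {Fy : (Fin n → ℝ) × ℝ → ℝ} (hh : ContDiff ℝ 1 h)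
    (hFx : ∀ i, Continuous (Fx i)) (hFy : Continuous Fy) : Continuous (hsFlux n h Fx Fy) := by
  unfold hsFlux
  have h0 : Continuous fun x => (x, h x) := continuous_id.prodMk hh.continuous
  exact (hFy.comp h0).sub (continuous_finsetSum _ fun i _ =>
    (hs_pdX_continuous hh i).mul ((hFx i).comp h0))

lemma hs_pd_zero_deep {n : ℕ} {f : (Fin n → ℝ) × ℝ → ℝ} {M : ℝ}
    (hM : ∀ p : (Fin n → ℝ) × ℝ, p.2 ≤ M → f p = 0) (v) (p : (Fin n → ℝ) × ℝ) (hp : p.2 < M) :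
    pdE n f v p = 0 := by
  unfold pdE
  have : f =ᶠ[nhds p] fun _ => 0 := by
    filter_upwards [(isOpen_lt continuous_snd continuous_const).mem_nhds hp] with q hq
    exact hM q (le_of_lt hq)
  rw [this.fderiv_eq]; simp

/-- Divergence theorem below the graph of `h`, for fields vanishing at depth. -/
lemma hs_div_compact {n : ℕ} (hn : 1 ≤ n) {h : (Fin n → ℝ) → ℝ} (hh : ContDiff ℝ 1 h)
    (hper : ZPeriodic n h)
    {Fx : Fin n → (Fin n → ℝ) × ℝ → ℝ} {Fy : (Fin n → ℝ) × ℝ → ℝ}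
    (hFx : ∀ i, ContDiff ℝ 1 (Fx i)) (hFy : ContDiff ℝ 1 Fy)
    (pFx : ∀ i, ZPeriodicE n (Fx i)) (M : ℝ)
    (mFx : ∀ i, ∀ p : (Fin n → ℝ) × ℝ, p.2 ≤ M → Fx i p = 0)
    (mFy : ∀ p : (Fin n → ℝ) × ℝ, p.2 ≤ M → Fy p = 0) :
    ∫ p in fluidCell n h, hsDiv n Fx Fy p = ∫ x in cell n, hsFlux n h Fx Fy x := by
  have hdc := hs_div_continuous hFx hFy
  have hdi : IntegrableOn (hsDiv n Fx Fy) (fluidCell n h) := by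
    refine hs_fluid_integrable_deep hh.continuous hdc (M-1) fun p _ hp => ?_
    unfold hsDiv
    rw [hs_pd_zero_deep mFy _ _ (by linarith), Finset.sum_eq_zero, add_zero]
    intro i _
    exact hs_pd_zero_deep (mFx i) _ _ (by linarith)
  rw [hs_fluid_integral hh.continuous hdi]
  -- flattened horizontal part
  set A : (Fin n → ℝ) → ℝ → ℝ := fun x z => ∑ i, pdX n (fun x => Fx i (x, z + h x)) i x with hA
  have hA' : ∀ x z, A x z = ∑ i, (pdE n (Fx i) (eX n i) (x, z + h x)
      + pdX n h i x * pdE n (Fx i) (eY n) (x, z + h x)) := by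
    intro x z
    refine Finset.sum_congr rfl fun i _ => ?_
    exact hs_hasFDeriv_graph ((hFx i).differentiable (by simp)) (hh.differentiable (by simp)) z i x
  have hfl : Continuous fun p : (Fin n → ℝ) × ℝ => (p.1, p.2 + h p.1) :=
    continuous_fst.prodMk (continuous_snd.add (hh.continuous.comp continuous_fst))
  have hAc : Continuous (Function.uncurry A) := by
    have : Function.uncurry A = fun p => ∑ i, (pdE n (Fx i) (eX n i) (p.1, p.2 + h p.1)
      + pdX n h i p.1 * pdE n (Fx i) (eY n) (p.1, p.2 + h p.1)) := by
      funext ⟨x, z⟩; exact hA' x z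
    rw [this]
    exact continuous_finsetSum _ fun i _ => ((hs_pdE_continuous (hFx i) _).comp hfl).add
      (((hs_pdX_continuous hh i).comp continuous_fst).mul
        ((hs_pdE_continuous (hFx i) _).comp hfl))
  obtain ⟨C, hC0, hC⟩ := hs_bdd_above_cell hh.continuous
  have hAi : IntegrableOn (Function.uncurry A) (cell n ×ˢ Set.Iio (0:ℝ)) := by
    have h1 : fluidCell n (fun _ => (0:ℝ)) = cell n ×ˢ Set.Iio (0:ℝ) := by
      ext p; simp [fluidCell]
    rw [← h1]
    refine hs_fluid_integrable_deep continuous_const hAc (M - 1 - C) fun p hp hp2 => ?_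
    obtain ⟨x, z⟩ := p
    simp only at hp hp2
    have := (abs_le.1 (hC x hp)).2
    change A x z = 0
    rw [hA']
    refine Finset.sum_eq_zero fun i _ => ?_
    rw [hs_pd_zero_deep (mFx i) _ _ (by simp only; linarith),
      hs_pd_zero_deep (mFx i) _ _ (by simp only; linarith)]
    simp
  have hAi' : Integrable (Function.uncurry A)
      ((volume.restrict (cell n)).prod (volume.restrict (Set.Iio (0:ℝ)))) := by
    rw [Measure.prod_restrict]; exact hAi
  have hA0 : ∫ x in cell n, ∫ z in Set.Iio (0:ℝ), A x z = 0 := by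
    rw [integral_integral_swap hAi']
    refine integral_eq_zero_of_ae (Filter.Eventually.of_forall fun z => ?_)
    refine hs_div_torus hn (fun i x => Fx i (x, z + h x)) (fun i => ?_) (fun i x k => ?_)
    · exact (hFx i).comp (contDiff_id.prodMk (contDiff_const.add hh))
    · change Fx i (_, z + h _) = _
      rw [hper x k]; exact pFx i x _ k
  -- the vertical part
  have hin : ∀ x ∈ cell n, ∫ y in Set.Iio (h x), hsDiv n Fx Fy (x, y) =
      (∫ z in Set.Iio (0:ℝ), A x z) + hsFlux n h Fx Fy x := by
    intro x hx
    have hxC := (abs_le.1 (hC x hx)).2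
    have e1 : ∫ y in Set.Iio (h x), hsDiv n Fx Fy (x, y) =
        ∫ z in Set.Iio (0:ℝ), hsDiv n Fx Fy (x, z + h x) := by
      rw [← integral_indicator measurableSet_Iio, ← integral_indicator measurableSet_Iio,
        ← integral_add_right_eq_self _ (h x)]
      congr 1
      funext z
      by_cases hz : z < 0
      · simp [Set.indicator, hz]
      · simp [Set.indicator, hz]
    set q : ℝ → ℝ := fun z => Fy (x, z + h x) - ∑ i, pdX n h i x * Fx i (x, z + h x) with hq
    set q' : ℝ → ℝ := fun z => pdE n Fy (eY n) (x, z + h x)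
      - ∑ i, pdX n h i x * pdE n (Fx i) (eY n) (x, z + h x) with hq'
    have hv : ∀ {f : (Fin n → ℝ) × ℝ → ℝ}, ContDiff ℝ 1 f → ∀ z,
        HasDerivAt (fun z => f (x, z + h x)) (pdE n f (eY n) (x, z + h x)) z := by
      intro f hf z
      exact (hs_hasDerivAt_vert (hf.differentiable (by simp)) x (z + h x)).comp_add_const z (h x)
    have hqd : ∀ z, HasDerivAt q (q' z) z := by
      intro z
      refine (hv hFy z).sub (HasDerivAt.fun_sum fun i _ => ?_)
      exact (hv (hFx i) z).const_mul _
    have hline : Continuous fun z : ℝ => (x, z + h x) :=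
      continuous_const.prodMk (continuous_id.add continuous_const)
    have hq'c : Continuous q' := by
      refine ((hs_pdE_continuous hFy _).comp hline).sub (continuous_finsetSum _ fun i _ => ?_)
      exact continuous_const.mul ((hs_pdE_continuous (hFx i) _).comp hline)
    have hInt0 : ∀ f : ℝ → ℝ, Continuous f → (∀ z, z ≤ M - 1 - C → f z = 0) →
        IntegrableOn f (Set.Iio 0) := by
      intro f hf hf0
      have := (hf.integrableOn_Icc (μ := volume) (a := M - 1 - C) (b := 0)).union
        ((integrableOn_zero (s := Set.Iic (M - 1 - C)) (μ := volume) (ε' := ℝ)).congr_fun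
          (fun z hz => (hf0 z hz).symm) measurableSet_Iic)
      refine this.mono_set fun z hz => ?_
      by_cases h3 : z ≤ M - 1 - C
      · right; exact h3
      · left; exact ⟨by linarith, le_of_lt hz⟩
    have hq'0 : ∀ z, z ≤ M - 1 - C → q' z = 0 := by
      intro z hz
      simp only [hq']
      rw [hs_pd_zero_deep mFy _ _ (by simp only; linarith), Finset.sum_eq_zero, sub_zero]
      intro i _
      rw [hs_pd_zero_deep (mFx i) _ _ (by simp only; linarith), mul_zero]
    have hq0 : ∀ z, z ≤ M - 1 - C → q z = 0 := by
      intro z hz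
      simp only [hq]
      rw [mFy _ (by simp only; linarith), Finset.sum_eq_zero, sub_zero]
      intro i _
      rw [mFx i _ (by simp only; linarith), mul_zero]
    have hAx0 : ∀ z, z ≤ M - 1 - C → A x z = 0 := by
      intro z hz
      rw [hA']
      refine Finset.sum_eq_zero fun i _ => ?_
      rw [hs_pd_zero_deep (mFx i) _ _ (by simp only; linarith),
        hs_pd_zero_deep (mFx i) _ _ (by simp only; linarith)]
      simp
    have hFTC : ∫ z in Set.Iio (0:ℝ), q' z = q 0 := by
      rw [← integral_Iic_eq_integral_Iio]
      have := integral_Iic_of_hasDerivAt_of_tendsto' (f := q) (f' := q') (a := 0) (m := 0)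
        (fun z _ => hqd z)
        ((integrableOn_Iic_iff_integrableOn_Iio (by simp)).2 (hInt0 q' hq'c hq'0))
        (tendsto_const_nhds.congr' (by
          filter_upwards [Filter.eventually_le_atBot (M - 1 - C)] with z hz
          exact (hq0 z hz).symm))
      simpa using this
    have hflux : q 0 = hsFlux n h Fx Fy x := by simp [hq, hsFlux]
    have hAxi : IntegrableOn (fun z => A x z) (Set.Iio 0) :=
      hInt0 _ (hAc.comp (Continuous.prodMk_right x)) hAx0
    rw [e1, ← hflux, ← hFTC, ← integral_add hAxi (hInt0 q' hq'c hq'0)]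
    congr 1
    funext z
    simp only [hsDiv, hq']
    rw [hA', Finset.sum_add_distrib]; ring
  rw [setIntegral_congr_fun hs_cell_meas hin, integral_add _ _, hA0, zero_add]
  · exact hAi'.integral_prod_left
  · exact hs_integrableOn_cell (hs_flux_continuous hh (fun i => (hFx i).continuous) hFy.continuous)


/-! ## Cutoffs at infinite depth -/

lemma hs_smoothTransition_deriv : ∃ C, 0 ≤ C ∧ (∀ s, |deriv Real.smoothTransition s| ≤ C) ∧
    (∀ s, s < 0 → deriv Real.smoothTransition s = 0) ∧
    (∀ s, 1 < s → deriv Real.smoothTransition s = 0) := by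
  have h1 : ∀ s, s < 0 → deriv Real.smoothTransition s = 0 := by
    intro s hs
    have : Real.smoothTransition =ᶠ[nhds s] fun _ => 0 := by
      filter_upwards [Iio_mem_nhds hs] with q hq
      exact Real.smoothTransition.zero_of_nonpos (le_of_lt hq)
    rw [this.deriv_eq]; simp
  have h2 : ∀ s, 1 < s → deriv Real.smoothTransition s = 0 := by
    intro s hs
    have : Real.smoothTransition =ᶠ[nhds s] fun _ => 1 := by
      filter_upwards [Ioi_mem_nhds hs] with q hq
      exact Real.smoothTransition.one_of_one_le (le_of_lt hq)
    rw [this.deriv_eq]; simp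
  have hc : Continuous (deriv Real.smoothTransition) :=
    (Real.smoothTransition.contDiff (n := 1)).continuous_deriv (by simp)
  obtain ⟨C, hC⟩ := (isCompact_Icc (a := (0:ℝ)) (b := 1)).exists_bound_of_continuousOn
    hc.continuousOn
  refine ⟨max C 0, le_max_right _ _, fun s => ?_, h1, h2⟩
  by_cases h3 : s < 0
  · rw [h1 s h3]; simp
  by_cases h4 : 1 < s
  · rw [h2 s h4]; simp
  exact (hC s ⟨by linarith, by linarith⟩).trans (le_max_left _ _)

def hsChi (N : ℕ) (y : ℝ) : ℝ := Real.smoothTransition (2 + y / ((N : ℝ) + 1) ^ 2)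

lemma hs_chi_nonneg (N : ℕ) (y : ℝ) : 0 ≤ hsChi N y := Real.smoothTransition.nonneg _
lemma hs_chi_le_one (N : ℕ) (y : ℝ) : hsChi N y ≤ 1 := Real.smoothTransition.le_one _

lemma hs_chi_one (N : ℕ) (y : ℝ) (hy : -((N : ℝ) + 1) ^ 2 ≤ y) : hsChi N y = 1 := by
  apply Real.smoothTransition.one_of_one_le
  have : (-1 : ℝ) ≤ y / ((N : ℝ) + 1) ^ 2 := by
    rw [le_div_iff₀ (by positivity)]; linarith
  linarith

lemma hs_chi_zero (N : ℕ) (y : ℝ) (hy : y ≤ -(2 * ((N : ℝ) + 1) ^ 2)) : hsChi N y = 0 := by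
  apply Real.smoothTransition.zero_of_nonpos
  have : y / ((N : ℝ) + 1) ^ 2 ≤ -2 := by
    rw [div_le_iff₀ (by positivity)]; linarith
  linarith

lemma hs_chi_contDiff (N : ℕ) : ContDiff ℝ 1 (hsChi N) :=
  (Real.smoothTransition.contDiff (n := 1)).comp
    (contDiff_const.add (contDiff_id.div_const _))

lemma hs_chi_deriv (N : ℕ) (y : ℝ) : deriv (hsChi N) y =
    deriv Real.smoothTransition (2 + y / ((N : ℝ) + 1) ^ 2) / ((N : ℝ) + 1) ^ 2 := by
  have h1 : HasDerivAt (fun y : ℝ => 2 + y / ((N : ℝ) + 1) ^ 2) (1 / ((N : ℝ) + 1) ^ 2) y :=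
    ((hasDerivAt_id y).div_const _).const_add 2
  have h2 := (((Real.smoothTransition.contDiff (n := 1)).differentiable (by simp)
    (2 + y / ((N : ℝ) + 1) ^ 2)).hasDerivAt.comp y h1).deriv
  rw [show hsChi N = Real.smoothTransition ∘ (fun y : ℝ => 2 + y / ((N : ℝ) + 1) ^ 2) from rfl, h2]
  ring

lemma hs_chi_eventually (y : ℝ) : ∀ᶠ N : ℕ in Filter.atTop, ∀ z, y ≤ z → hsChi N z = 1 := by
  obtain ⟨N0, hN0⟩ := exists_nat_ge (-y)
  filter_upwards [Filter.eventually_ge_atTop N0] with N hN z hz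
  apply hs_chi_one
  have : (N0 : ℝ) ≤ N := by exact_mod_cast hN
  nlinarith [(Nat.cast_nonneg N : (0:ℝ) ≤ N)]

lemma hs_vert_contDiff {n : ℕ} {χ : ℝ → ℝ} (hχ : ContDiff ℝ 1 χ) :
    ContDiff ℝ 1 (fun p : (Fin n → ℝ) × ℝ => χ p.2) := hχ.comp contDiff_snd

lemma hs_pdE_vert {n : ℕ} {χ : ℝ → ℝ} (hχ : ContDiff ℝ 1 χ) (v p) :
    pdE n (fun p => χ p.2) v p = deriv χ p.2 * v.2 := by
  rw [hs_pdE_comp (hχ.differentiable (by simp)) differentiable_snd]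
  unfold pdE
  congr 1
  simp [fderiv_snd]

/-- Divergence theorem below a graph with an `L²` condition on the vertical component. -/
lemma hs_div_tendsto {n : ℕ} (hn : 1 ≤ n) {h : (Fin n → ℝ) → ℝ} (hh : ContDiff ℝ 1 h)
    (hper : ZPeriodic n h)
    {Fx : Fin n → (Fin n → ℝ) × ℝ → ℝ} {Fy : (Fin n → ℝ) × ℝ → ℝ}
    (hFx : ∀ i, ContDiff ℝ 1 (Fx i)) (hFy : ContDiff ℝ 1 Fy)
    (pFx : ∀ i, ZPeriodicE n (Fx i))
    (hL2 : IntegrableOn (fun p => (Fy p) ^ 2) (fluidCell n h)) :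
    Filter.Tendsto (fun N : ℕ => ∫ p in fluidCell n h, hsChi N p.2 * hsDiv n Fx Fy p)
      Filter.atTop (nhds (∫ x in cell n, hsFlux n h Fx Fy x)) := by
  obtain ⟨C, hC0, hCb, hCl, hCr⟩ := hs_smoothTransition_deriv
  obtain ⟨D, hD0, hD⟩ := hs_bdd_above_cell hh.continuous
  have hχc : ∀ N, Continuous fun p : (Fin n → ℝ) × ℝ => deriv (hsChi N) p.2 := fun N =>
    ((hs_chi_contDiff N).continuous_deriv (by simp)).comp continuous_snd
  have hχ0 : ∀ (N : ℕ) (y : ℝ), y < -(2 * ((N : ℝ) + 1) ^ 2) → deriv (hsChi N) y = 0 := by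
    intro N y hy
    rw [hs_chi_deriv, hCl, zero_div]
    have : y / ((N : ℝ) + 1) ^ 2 < -2 := by
      rw [div_lt_iff₀ (by positivity)]; linarith
    linarith
  have hχ1 : ∀ (N : ℕ) (y : ℝ), -((N : ℝ) + 1) ^ 2 < y → deriv (hsChi N) y = 0 := by
    intro N y hy
    rw [hs_chi_deriv, hCr, zero_div]
    have : -1 < y / ((N : ℝ) + 1) ^ 2 := by
      rw [lt_div_iff₀ (by positivity)]; linarith
    linarith
  have hχb : ∀ (N : ℕ) (y : ℝ), |deriv (hsChi N) y| ≤ C / ((N : ℝ) + 1) ^ 2 := by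
    intro N y
    rw [hs_chi_deriv, abs_div, abs_of_pos (by positivity : (0:ℝ) < ((N : ℝ) + 1) ^ 2)]
    gcongr; exact hCb _
  have i1 : ∀ N, IntegrableOn (fun p => deriv (hsChi N) p.2 * Fy p) (fluidCell n h) := fun N =>
    hs_fluid_integrable_deep hh.continuous ((hχc N).mul hFy.continuous)
      (-(2 * ((N : ℝ) + 1) ^ 2) - 1) (fun p _ hp => by rw [hχ0 N _ (by linarith), zero_mul])
  have i2 : ∀ N, IntegrableOn (fun p => hsChi N p.2 * hsDiv n Fx Fy p) (fluidCell n h) := fun N =>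
    hs_fluid_integrable_deep hh.continuous
      (((hs_chi_contDiff N).continuous.comp continuous_snd).mul (hs_div_continuous hFx hFy))
      (-(2 * ((N : ℝ) + 1) ^ 2)) (fun p _ hp => by rw [hs_chi_zero N _ hp, zero_mul])
  -- remainder tends to zero
  have hrem : Filter.Tendsto (fun N : ℕ => ∫ p in fluidCell n h, deriv (hsChi N) p.2 * Fy p)
      Filter.atTop (nhds 0) := by
    set K := C / 2 * (1 + ∫ p in fluidCell n h, (Fy p) ^ 2) with hK
    have hlim : Filter.Tendsto (fun N : ℕ => K * (1 / ((N : ℝ) + 1))) Filter.atTop (nhds 0) := by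
      simpa using tendsto_one_div_add_atTop_nhds_zero_nat.const_mul K
    refine squeeze_zero_norm (fun N => ?_) hlim
    set R : ℝ := ((N : ℝ) + 1) with hR
    have hRpos : 0 < R := by positivity
    set sl : Set ((Fin n → ℝ) × ℝ) := cell n ×ˢ Set.Icc (-(2 * R ^ 2)) (-R ^ 2) with hsl
    have hslm : MeasurableSet sl := hs_cell_meas.prod measurableSet_Icc
    have hslv : (volume sl).toReal = R ^ 2 := by
      rw [hsl, Measure.volume_eq_prod, Measure.prod_prod, hs_cell_vol, one_mul, Real.volume_Icc,
        ENNReal.toReal_ofReal (by nlinarith)]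
      ring
    have hslf : volume sl ≠ ⊤ := by
      rw [hsl, Measure.volume_eq_prod, Measure.prod_prod, hs_cell_vol, one_mul, Real.volume_Icc]
      exact ENNReal.ofReal_ne_top
    have hind : Integrable (sl.indicator fun _ => (1:ℝ)) :=
      (integrable_indicator_iff hslm).2 (integrableOn_const (hs := hslf))
    have hb : ∀ p ∈ fluidCell n h, ‖deriv (hsChi N) p.2 * Fy p‖ ≤
        C / (2 * R ^ 3) * sl.indicator (fun _ => (1:ℝ)) p + C / (2 * R) * (Fy p) ^ 2 := by
      intro p hp
      by_cases hps : p ∈ sl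
      · rw [Set.indicator_of_mem hps, norm_mul, Real.norm_eq_abs, Real.norm_eq_abs]
        have h1 := hχb N p.2
        have h2 : |Fy p| ≤ 1 / (2 * R) + R / 2 * (Fy p) ^ 2 := by
          have h3 : 0 ≤ (R * |Fy p| - 1) ^ 2 := sq_nonneg _
          have h4 : |Fy p| ^ 2 = (Fy p) ^ 2 := sq_abs _
          have h5 : 1 / (2 * R) + R / 2 * (Fy p) ^ 2 - |Fy p| = (R * |Fy p| - 1) ^ 2 / (2 * R) := by
            rw [← h4]; field_simp; ring
          have h6 : 0 ≤ (R * |Fy p| - 1) ^ 2 / (2 * R) := by positivity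
          linarith
        calc _ ≤ C / R ^ 2 * (1 / (2 * R) + R / 2 * (Fy p) ^ 2) := by gcongr
          _ = _ := by field_simp
      · have : deriv (hsChi N) p.2 = 0 := by
          by_contra hne
          apply hps
          refine ⟨hp.1, ?_, ?_⟩
          · by_contra h3; exact hne (hχ0 N _ (not_le.1 h3))
          · by_contra h3; exact hne (hχ1 N _ (not_le.1 h3))
        rw [this, Set.indicator_of_notMem hps]
        simp only [zero_mul, norm_zero, mul_zero, zero_add]
        positivity
    have := norm_integral_le_of_norm_le (μ := volume.restrict (fluidCell n h))
      ((hind.restrict.const_mul (C / (2 * R ^ 3))).add (hL2.integrable.const_mul (C / (2 * R))))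
      ((ae_restrict_iff' (hs_fluid_meas hh.continuous)).2 (Filter.Eventually.of_forall hb))
    refine this.trans ?_
    simp only [Pi.add_apply]
    rw [integral_add (hind.restrict.const_mul (C / (2 * R ^ 3)))
      (hL2.integrable.const_mul (C / (2 * R))), integral_const_mul, integral_const_mul]
    have h7 : ∫ p in fluidCell n h, sl.indicator (fun _ => (1:ℝ)) p ≤ R ^ 2 := by
      calc _ ≤ ∫ p, sl.indicator (fun _ => (1:ℝ)) p :=
            setIntegral_le_integral hind (Filter.Eventually.of_forall fun p =>
              Set.indicator_nonneg (fun _ _ => zero_le_one) p)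
        _ = R ^ 2 := by
            rw [integral_indicator hslm]; simp [Measure.real, hslv]
    calc _ ≤ C / (2 * R ^ 3) * R ^ 2 + C / (2 * R) * ∫ p in fluidCell n h, (Fy p) ^ 2 := by
          gcongr
      _ = K * (1 / R) := by rw [hK]; field_simp
  have hmain : ∀ᶠ N : ℕ in Filter.atTop, (∫ x in cell n, hsFlux n h Fx Fy x) -
      (∫ p in fluidCell n h, deriv (hsChi N) p.2 * Fy p) =
      ∫ p in fluidCell n h, hsChi N p.2 * hsDiv n Fx Fy p := by
    filter_upwards [hs_chi_eventually (-D)] with N hN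
    have hχd := hs_vert_contDiff (n := n) (hs_chi_contDiff N)
    have key := hs_div_compact hn hh hper (Fx := fun i p => hsChi N p.2 * Fx i p)
      (Fy := fun p => hsChi N p.2 * Fy p) (fun i => hχd.mul (hFx i)) (hχd.mul hFy)
      (fun i x y k => by simp only; rw [pFx i x y k]) (-(2 * ((N : ℝ) + 1) ^ 2))
      (fun i p hp => by rw [hs_chi_zero N _ hp, zero_mul])
      (fun p hp => by rw [hs_chi_zero N _ hp, zero_mul])
    have e1 : ∫ x in cell n, hsFlux n h (fun i p => hsChi N p.2 * Fx i p)
        (fun p => hsChi N p.2 * Fy p) x = ∫ x in cell n, hsFlux n h Fx Fy x := by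
      refine setIntegral_congr_fun hs_cell_meas fun x hx => ?_
      have := hN (h x) (abs_le.1 (hD x hx)).1
      simp only [hsFlux, this, one_mul]
    have e2 : ∀ p, hsDiv n (fun i p => hsChi N p.2 * Fx i p) (fun p => hsChi N p.2 * Fy p) p =
        hsChi N p.2 * hsDiv n Fx Fy p + deriv (hsChi N) p.2 * Fy p := by
      intro p
      unfold hsDiv
      have hdχ := hχd.differentiable (by simp)
      rw [hs_pdE_mul hdχ (hFy.differentiable (by simp)), hs_pdE_vert (hs_chi_contDiff N)]
      have : ∀ i, pdE n (fun p => hsChi N p.2 * Fx i p) (eX n i) p =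
          hsChi N p.2 * pdE n (Fx i) (eX n i) p := by
        intro i
        rw [hs_pdE_mul hdχ ((hFx i).differentiable (by simp)), hs_pdE_vert (hs_chi_contDiff N)]
        simp [eX]
      simp only [this, ← Finset.mul_sum]
      simp only [eY]; ring
    rw [e1] at key
    simp only [e2] at key
    rw [integral_add (i2 N) (i1 N)] at key
    rw [← key]; ring
  have := (tendsto_const_nhds (x := ∫ x in cell n, hsFlux n h Fx Fy x)).sub hrem
  rw [sub_zero] at this
  exact this.congr' hmain

lemma hs_chi_tendsto_integral {n : ℕ} {s : Set ((Fin n → ℝ) × ℝ)} {f : (Fin n → ℝ) × ℝ → ℝ}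
    (hf : IntegrableOn f s) :
    Filter.Tendsto (fun N : ℕ => ∫ p in s, hsChi N p.2 * f p) Filter.atTop
      (nhds (∫ p in s, f p)) := by
  refine tendsto_integral_of_dominated_convergence (fun p => ‖f p‖) (fun N => ?_) hf.norm
    (fun N => ?_) ?_
  · exact (((hs_chi_contDiff N).continuous.comp continuous_snd).aestronglyMeasurable).mul
      hf.aestronglyMeasurable
  · refine Filter.Eventually.of_forall fun p => ?_
    rw [norm_mul, Real.norm_eq_abs, abs_of_nonneg (hs_chi_nonneg _ _)]
    exact mul_le_of_le_one_left (norm_nonneg _) (hs_chi_le_one _ _)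
  · refine Filter.Eventually.of_forall fun p => ?_
    refine tendsto_const_nhds.congr' ?_
    filter_upwards [hs_chi_eventually p.2] with N hN
    rw [hN _ le_rfl, one_mul]

/-- Divergence theorem, integrable divergence. -/
lemma hs_div_integrable {n : ℕ} (hn : 1 ≤ n) {h : (Fin n → ℝ) → ℝ} (hh : ContDiff ℝ 1 h)
    (hper : ZPeriodic n h)
    {Fx : Fin n → (Fin n → ℝ) × ℝ → ℝ} {Fy : (Fin n → ℝ) × ℝ → ℝ}
    (hFx : ∀ i, ContDiff ℝ 1 (Fx i)) (hFy : ContDiff ℝ 1 Fy)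
    (pFx : ∀ i, ZPeriodicE n (Fx i))
    (hL2 : IntegrableOn (fun p => (Fy p) ^ 2) (fluidCell n h))
    (hd : IntegrableOn (hsDiv n Fx Fy) (fluidCell n h)) :
    ∫ p in fluidCell n h, hsDiv n Fx Fy p = ∫ x in cell n, hsFlux n h Fx Fy x :=
  tendsto_nhds_unique (hs_chi_tendsto_integral hd) (hs_div_tendsto hn hh hper hFx hFy pFx hL2)


/-! ## Green identities and the maximum principle -/

def hsDot (n : ℕ) (f g : (Fin n → ℝ) × ℝ → ℝ) (p : (Fin n → ℝ) × ℝ) : ℝ :=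
  (∑ i, pdE n f (eX n i) p * pdE n g (eX n i) p) + pdE n f (eY n) p * pdE n g (eY n) p

def hsN (n : ℕ) (h : (Fin n → ℝ) → ℝ) (w : (Fin n → ℝ) × ℝ → ℝ) (x : Fin n → ℝ) : ℝ :=
  pdE n w (eY n) (x, h x) - ∑ i, pdX n h i x * pdE n w (eX n i) (x, h x)

lemma hs_lap_continuous {n : ℕ} {w : (Fin n → ℝ) × ℝ → ℝ} (hw : ContDiff ℝ 2 w) :
    Continuous (lapE n w) := by
  unfold lapE
  exact (continuous_finsetSum _ fun i _ => hs_pdE_continuous (hs_pdE_contDiff_one hw _) _).add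
    (hs_pdE_continuous (hs_pdE_contDiff_one hw _) _)

lemma hs_grad_continuous {n : ℕ} {w : (Fin n → ℝ) × ℝ → ℝ} (hw : ContDiff ℝ 1 w) :
    Continuous (gradSqE n w) := by
  unfold gradSqE
  exact (continuous_finsetSum _ fun i _ => (hs_pdE_continuous hw _).pow 2).add
    ((hs_pdE_continuous hw _).pow 2)

lemma hs_dot_continuous {n : ℕ} {f g : (Fin n → ℝ) × ℝ → ℝ} (hf : ContDiff ℝ 1 f)
    (hg : ContDiff ℝ 1 g) : Continuous (hsDot n f g) := by
  unfold hsDot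
  exact (continuous_finsetSum _ fun i _ => (hs_pdE_continuous hf _).mul
    (hs_pdE_continuous hg _)).add ((hs_pdE_continuous hf _).mul (hs_pdE_continuous hg _))

lemma hs_N_continuous {n : ℕ} {h : (Fin n → ℝ) → ℝ} {w : (Fin n → ℝ) × ℝ → ℝ}
    (hh : ContDiff ℝ 1 h) (hw : ContDiff ℝ 1 w) : Continuous (hsN n h w) :=
  hs_flux_continuous (Fx := fun i => pdE n w (eX n i)) hh (fun _ => hs_pdE_continuous hw _)
    (hs_pdE_continuous hw _)

lemma hs_grad_nonneg {n : ℕ} (w : (Fin n → ℝ) × ℝ → ℝ) (p) : 0 ≤ gradSqE n w p := by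
  unfold gradSqE; positivity

lemma hs_grad_y_le {n : ℕ} (w : (Fin n → ℝ) × ℝ → ℝ) (p) :
    (pdE n w (eY n) p) ^ 2 ≤ gradSqE n w p := by
  unfold gradSqE
  have : 0 ≤ ∑ i, (pdE n w (eX n i) p) ^ 2 := by positivity
  linarith

lemma hs_dot_le {n : ℕ} (f g : (Fin n → ℝ) × ℝ → ℝ) (p) :
    |hsDot n f g p| ≤ gradSqE n f p + gradSqE n g p := by
  have key : ∀ a b : ℝ, |a * b| ≤ a ^ 2 + b ^ 2 := by
    intro a b
    rw [abs_le]; constructor <;> nlinarith [sq_nonneg (a + b), sq_nonneg (a - b)]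
  unfold hsDot gradSqE
  calc _ ≤ |∑ i, pdE n f (eX n i) p * pdE n g (eX n i) p| + |pdE n f (eY n) p * pdE n g (eY n) p| :=
        abs_add_le _ _
    _ ≤ (∑ i, ((pdE n f (eX n i) p) ^ 2 + (pdE n g (eX n i) p) ^ 2)) +
        ((pdE n f (eY n) p) ^ 2 + (pdE n g (eY n) p) ^ 2) := by
        gcongr
        · exact (Finset.abs_sum_le_sum_abs _ _).trans (Finset.sum_le_sum fun i _ => key _ _)
        · exact key _ _
    _ = _ := by rw [Finset.sum_add_distrib]; ring

lemma hs_dot_self {n : ℕ} (f : (Fin n → ℝ) × ℝ → ℝ) (p) : hsDot n f f p = gradSqE n f p := by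
  simp only [hsDot, gradSqE, pow_two]

lemma hs_dot_comp {n : ℕ} {G : ℝ → ℝ} {f g : (Fin n → ℝ) × ℝ → ℝ} (hG : Differentiable ℝ G)
    (hf : Differentiable ℝ f) (p) :
    hsDot n (fun q => G (f q)) g p = deriv G (f p) * hsDot n f g p := by
  simp only [hsDot, hs_pdE_comp hG hf, mul_add, Finset.mul_sum, mul_assoc]

lemma hs_dot_mul {n : ℕ} {f k g : (Fin n → ℝ) × ℝ → ℝ} (hf : Differentiable ℝ f)
    (hk : Differentiable ℝ k) (p) :
    hsDot n (fun q => f q * k q) g p = f p * hsDot n k g p + k p * hsDot n f g p := by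
  simp only [hsDot, hs_pdE_mul hf hk, mul_add, Finset.mul_sum, add_mul, Finset.sum_add_distrib]
  have : ∀ i, pdE n f (eX n i) p * k p * pdE n g (eX n i) p =
    k p * (pdE n f (eX n i) p * pdE n g (eX n i) p) := fun i => by ring
  simp only [this, mul_assoc]; ring

lemma hs_bdd_mul {n : ℕ} {h : (Fin n → ℝ) → ℝ} (hh : Continuous h) {f g : (Fin n → ℝ) × ℝ → ℝ}
    (hf : Continuous f) (C : ℝ) (hC : ∀ p ∈ fluidCell n h, |f p| ≤ C)
    (hg : IntegrableOn g (fluidCell n h)) : IntegrableOn (fun p => f p * g p) (fluidCell n h) :=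
  Integrable.bdd_mul (c := C) hg hf.aestronglyMeasurable
    ((ae_restrict_iff' (hs_fluid_meas hh)).2 (Filter.Eventually.of_forall hC))

lemma hs_integrable_le {n : ℕ} {h : (Fin n → ℝ) → ℝ} (hh : Continuous h)
    {f g : (Fin n → ℝ) × ℝ → ℝ} (hf : Continuous f) (hg : IntegrableOn g (fluidCell n h))
    (hfg : ∀ p ∈ fluidCell n h, |f p| ≤ g p) : IntegrableOn f (fluidCell n h) :=
  Integrable.mono' hg hf.aestronglyMeasurable
    ((ae_restrict_iff' (hs_fluid_meas hh)).2 (Filter.Eventually.of_forall hfg))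

lemma hs_dot_integrable {n : ℕ} {h : (Fin n → ℝ) → ℝ} (hh : Continuous h)
    {f g : (Fin n → ℝ) × ℝ → ℝ} (hf : ContDiff ℝ 1 f) (hg : ContDiff ℝ 1 g)
    (hfi : IntegrableOn (gradSqE n f) (fluidCell n h))
    (hgi : IntegrableOn (gradSqE n g) (fluidCell n h)) :
    IntegrableOn (hsDot n f g) (fluidCell n h) :=
  hs_integrable_le hh (hs_dot_continuous hf hg) (hfi.add hgi) fun p _ => hs_dot_le f g p

lemma hs_green_tendsto {n : ℕ} (hn : 1 ≤ n) {h : (Fin n → ℝ) → ℝ} (hh : ContDiff ℝ 1 h)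
    (hper : ZPeriodic n h) {α w : (Fin n → ℝ) × ℝ → ℝ} (hα : ContDiff ℝ 1 α)
    (hw : ContDiff ℝ 2 w) (pα : ZPeriodicE n α) (pw : ZPeriodicE n w)
    (hL2 : IntegrableOn (fun p => (α p) ^ 2 * gradSqE n w p) (fluidCell n h)) :
    Filter.Tendsto (fun N : ℕ => ∫ p in fluidCell n h, hsChi N p.2 *
        (α p * lapE n w p + hsDot n α w p))
      Filter.atTop (nhds (∫ x in cell n, α (x, h x) * hsN n h w x)) := by
  have key := hs_div_tendsto hn hh hper (Fx := fun i p => α p * pdE n w (eX n i) p)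
    (Fy := fun p => α p * pdE n w (eY n) p) (fun i => hα.mul (hs_pdE_contDiff_one hw _))
    (hα.mul (hs_pdE_contDiff_one hw _))
    (fun i x y k => by
      have := hs_periodicE_pd pw (eX n i) x y k
      simp only [this, pα x y k])
    (hs_integrable_le hh.continuous ((hα.continuous.mul
      (hs_pdE_continuous (hw.of_le (by norm_num)) _)).pow 2) hL2 (fun p _ => by
        rw [abs_of_nonneg (sq_nonneg _), mul_pow]
        exact mul_le_mul_of_nonneg_left (hs_grad_y_le _ _) (sq_nonneg _)))
  have e1 : ∀ p, hsDiv n (fun i p => α p * pdE n w (eX n i) p)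
      (fun p => α p * pdE n w (eY n) p) p = α p * lapE n w p + hsDot n α w p := by
    intro p
    have hd : Differentiable ℝ α := hα.differentiable (by simp)
    have hd2 : ∀ v, Differentiable ℝ (pdE n w v) := fun v =>
      (hs_pdE_contDiff_one hw v).differentiable (by simp)
    simp only [hsDiv, hs_pdE_mul hd (hd2 _), lapE, hsDot, Finset.sum_add_distrib, mul_add,
      Finset.mul_sum]
    ring
  have e2 : ∀ x, hsFlux n h (fun i p => α p * pdE n w (eX n i) p)
      (fun p => α p * pdE n w (eY n) p) x = α (x, h x) * hsN n h w x := by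
    intro x
    simp only [hsFlux, hsN, mul_sub, Finset.mul_sum]
    congr 1
    exact Finset.sum_congr rfl fun i _ => by ring
  simpa only [e1, e2] using key

lemma hs_green {n : ℕ} (hn : 1 ≤ n) {h : (Fin n → ℝ) → ℝ} (hh : ContDiff ℝ 1 h)
    (hper : ZPeriodic n h) {α w : (Fin n → ℝ) × ℝ → ℝ} (hα : ContDiff ℝ 1 α)
    (hw : ContDiff ℝ 2 w) (pα : ZPeriodicE n α) (pw : ZPeriodicE n w)
    (hL2 : IntegrableOn (fun p => (α p) ^ 2 * gradSqE n w p) (fluidCell n h))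
    (hi : IntegrableOn (fun p => α p * lapE n w p + hsDot n α w p) (fluidCell n h)) :
    ∫ p in fluidCell n h, (α p * lapE n w p + hsDot n α w p) =
      ∫ x in cell n, α (x, h x) * hsN n h w x :=
  tendsto_nhds_unique (hs_chi_tendsto_integral hi) (hs_green_tendsto hn hh hper hα hw pα pw hL2)

lemma hs_chi_mul_integrable {n : ℕ} {h : (Fin n → ℝ) → ℝ} (hh : Continuous h)
    {f : (Fin n → ℝ) × ℝ → ℝ} (hf : Continuous f) (N : ℕ) :
    IntegrableOn (fun p => hsChi N p.2 * f p) (fluidCell n h) :=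
  hs_fluid_integrable_deep hh (((hs_chi_contDiff N).continuous.comp continuous_snd).mul hf)
    (-(2 * ((N : ℝ) + 1) ^ 2)) (fun p _ hp => by rw [hs_chi_zero N _ hp, zero_mul])

/-- extension from the open cell by continuity and periodicity -/
lemma hs_dense_cell {n : ℕ} {f : (Fin n → ℝ) → ℝ} (hf : Continuous f) (pf : ZPeriodic n f)
    (h : ∀ x ∈ Set.univ.pi (fun _ : Fin n => Set.Ioo (0:ℝ) 1), f x ≤ 0) (x) : f x ≤ 0 := by
  obtain ⟨k, hk⟩ := hs_exists_cell x
  rw [← pf x k]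
  have h1 : closure (Set.univ.pi (fun _ : Fin n => Set.Ioo (0:ℝ) 1)) ⊆ {x | f x ≤ 0} :=
    closure_minimal h (isClosed_le hf continuous_const)
  apply h1
  rw [closure_pi_set]
  intro i _
  rw [closure_Ioo (by norm_num)]
  exact ⟨(hk i trivial).1, (hk i trivial).2.le⟩

/-- Maximum principle below a graph. -/
lemma hs_max {n : ℕ} (hn : 1 ≤ n) {h : (Fin n → ℝ) → ℝ} (hh : ContDiff ℝ 1 h)
    (hper : ZPeriodic n h) {w : (Fin n → ℝ) × ℝ → ℝ} (hw : ContDiff ℝ 2 w)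
    (pw : ZPeriodicE n w) (hlap : ∀ p : (Fin n → ℝ) × ℝ, p.2 < h p.1 → 0 ≤ lapE n w p)
    (hbd : ∀ x, w (x, h x) ≤ 0)
    (hInt0 : IntegrableOn (fun p => if 0 < w p then gradSqE n w p else 0) (fluidCell n h)) :
    ∀ p : (Fin n → ℝ) × ℝ, p.2 ≤ h p.1 → w p ≤ 0 := by
  set η := Real.smoothTransition with hη
  have hη1 : ContDiff ℝ 1 η := Real.smoothTransition.contDiff (n := 1)
  have hηd : Differentiable ℝ η := hη1.differentiable (by simp)
  have hη'c : Continuous (deriv η) := hη1.continuous_deriv (by simp)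
  have hw1 : ContDiff ℝ 1 w := hw.of_le (by norm_num)
  have hwd : Differentiable ℝ w := hw1.differentiable (by simp)
  obtain ⟨C, hC0, hCb, hCl, -⟩ := hs_smoothTransition_deriv
  have hη'0 : ∀ s, 0 ≤ deriv η s := fun s => Real.smoothTransition.monotone.deriv_nonneg
  have hη'z : ∀ s, s ≤ 0 → deriv η s = 0 := by
    intro s hs
    have h1 : Set.Iic (0:ℝ) ⊆ {s | deriv η s = 0} := by
      rw [← closure_Iio]
      exact closure_minimal (fun s hs => hCl s hs) (isClosed_eq hη'c continuous_const)
    exact h1 hs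
  have hα : ContDiff ℝ 1 (fun p => η (w p)) := hη1.comp hw1
  have hgc := hs_grad_continuous hw1
  have hL2 : IntegrableOn (fun p => (η (w p)) ^ 2 * gradSqE n w p) (fluidCell n h) := by
    refine hs_integrable_le hh.continuous ((hα.continuous.pow 2).mul hgc) hInt0 fun p _ => ?_
    have hg := hs_grad_nonneg w p
    split_ifs with hp
    · rw [abs_of_nonneg (by positivity)]
      have h1 := Real.smoothTransition.nonneg (w p)
      have h2 := Real.smoothTransition.le_one (w p)
      exact mul_le_of_le_one_left hg (by rw [hη]; nlinarith)
    · rw [hη, Real.smoothTransition.zero_of_nonpos (not_lt.1 hp)]; simp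
  have hI : IntegrableOn (fun p => deriv η (w p) * gradSqE n w p) (fluidCell n h) := by
    refine hs_integrable_le hh.continuous ((hη'c.comp hw.continuous).mul hgc)
      (hInt0.const_mul C) fun p _ => ?_
    have hg := hs_grad_nonneg w p
    split_ifs with hp
    · rw [abs_mul, abs_of_nonneg hg]
      exact mul_le_mul_of_nonneg_right (hCb _) hg
    · rw [hη'z _ (not_lt.1 hp)]; simp
  have ht := hs_green_tendsto hn hh hper hα hw (fun x y k => by rw [pw x y k]) pw hL2
  have hz : ∫ x in cell n, η (w (x, h x)) * hsN n h w x = 0 := by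
    have : ∀ x, η (w (x, h x)) * hsN n h w x = 0 := fun x => by
      rw [hη, Real.smoothTransition.zero_of_nonpos (hbd x), zero_mul]
    simp only [this, integral_zero]
  rw [hz] at ht
  have hle : ∫ p in fluidCell n h, deriv η (w p) * gradSqE n w p ≤ 0 := by
    refine le_of_tendsto_of_tendsto' (hs_chi_tendsto_integral hI) ht fun N => ?_
    refine setIntegral_mono_on (hs_chi_mul_integrable hh.continuous
      ((hη'c.comp hw.continuous).mul hgc) N) (hs_chi_mul_integrable hh.continuous
      ((hα.continuous.mul (hs_lap_continuous hw)).add (hs_dot_continuous hα hw1)) N)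
      (hs_fluid_meas hh.continuous) fun p hp => ?_
    apply mul_le_mul_of_nonneg_left _ (hs_chi_nonneg _ _)
    rw [hs_dot_comp hηd hwd, hs_dot_self]
    have := mul_nonneg (Real.smoothTransition.nonneg (w p)) (hlap p hp.2)
    simp only [hη] at this ⊢
    linarith
  have hae : (fun p => deriv η (w p) * gradSqE n w p) =ᵐ[volume.restrict (fluidCell n h)] 0 := by
    have hnn : 0 ≤ᵐ[volume.restrict (fluidCell n h)]
        fun p => deriv η (w p) * gradSqE n w p :=
      Filter.Eventually.of_forall fun p => mul_nonneg (hη'0 _) (hs_grad_nonneg _ _)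
    exact (integral_eq_zero_iff_of_nonneg_ae hnn hI).1
      (le_antisymm hle (integral_nonneg_of_ae hnn))
  set O : Set (Fin n → ℝ) := Set.univ.pi (fun _ : Fin n => Set.Ioo (0:ℝ) 1) with hO
  have hOo : IsOpen O := isOpen_set_pi Set.finite_univ fun _ _ => isOpen_Ioo
  set U : Set ((Fin n → ℝ) × ℝ) := {p | p.1 ∈ O ∧ p.2 < h p.1} with hU
  have hUo : IsOpen U := (hOo.preimage continuous_fst).inter
    (isOpen_lt continuous_snd (hh.continuous.comp continuous_fst))
  have hUs : U ⊆ fluidCell n h := by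
    rintro p ⟨h1, h2⟩
    exact ⟨fun i hi => ⟨(h1 i hi).1.le, (h1 i hi).2⟩, h2⟩
  have hEq := Measure.eqOn_open_of_ae_eq (ae_restrict_of_ae_restrict_of_subset hUs hae) hUo
    ((hη'c.comp hw.continuous).mul hgc).continuousOn continuousOn_const
  have hOle : ∀ s, 0 ≤ s → ∀ x ∈ O, w (x, h x - s) ≤ 0 := by
    intro s hs x hx
    have hder : ∀ y, HasDerivAt (fun y => η (w (x, y)))
        (deriv η (w (x, y)) * pdE n w (eY n) (x, y)) y := fun y =>
      (hηd _).hasDerivAt.comp y (hs_hasDerivAt_vert hwd x y)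
    have hconst := constant_of_has_deriv_right_zero (f := fun y => η (w (x, y)))
      (a := h x - s) (b := h x) (fun y _ => (hder y).continuousAt.continuousWithinAt)
      (fun y hy => by
        have h1 : deriv η (w (x, y)) * gradSqE n w (x, y) = 0 := hEq (x := (x, y)) ⟨hx, hy.2⟩
        have h2 : deriv η (w (x, y)) * pdE n w (eY n) (x, y) = 0 := by
          rcases mul_eq_zero.1 h1 with h3 | h3
          · rw [h3, zero_mul]
          · have := hs_grad_y_le w (x, y)
            rw [h3] at this
            have : pdE n w (eY n) (x, y) = 0 := by
              have := le_antisymm this (sq_nonneg _); simpa using this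
            rw [this, mul_zero]
        rw [← h2]; exact (hder y).hasDerivWithinAt)
    have h3 := hconst (h x) ⟨by linarith, le_rfl⟩
    simp only [hη] at h3
    rw [Real.smoothTransition.zero_of_nonpos (hbd x)] at h3
    exact Real.smoothTransition.zero_iff_nonpos.1 h3.symm
  rintro ⟨x, y⟩ hp
  simp only at hp
  have := hs_dense_cell (f := fun z => w (z, h z - (h x - y)))
    (hw.continuous.comp (continuous_id.prodMk (hh.continuous.sub continuous_const)))
    (fun z k => by simp only [hper z k]; exact pw z _ k)
    (hOle (h x - y) (by linarith)) x
  simpa using this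


/-! ## Linear combinations, bounds for harmonic extensions -/

lemma hs_pdE_lin {n : ℕ} {f g : (Fin n → ℝ) × ℝ → ℝ} (hf : Differentiable ℝ f)
    (hg : Differentiable ℝ g) (a b : ℝ) (v) :
    pdE n (fun q => a * f q + b * g q) v = fun p => a * pdE n f v p + b * pdE n g v p := by
  funext p
  rw [hs_pdE_add (hf.const_mul a) (hg.const_mul b), hs_pdE_const_mul hf, hs_pdE_const_mul hg]

lemma hs_lap_lin {n : ℕ} {f g : (Fin n → ℝ) × ℝ → ℝ} (hf : ContDiff ℝ 2 f)
    (hg : ContDiff ℝ 2 g) (a b : ℝ) (p) :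
    lapE n (fun q => a * f q + b * g q) p = a * lapE n f p + b * lapE n g p := by
  have d : ∀ {f : (Fin n → ℝ) × ℝ → ℝ}, ContDiff ℝ 2 f → Differentiable ℝ f := fun h =>
    h.differentiable (by simp)
  have d' : ∀ {f : (Fin n → ℝ) × ℝ → ℝ} (v), ContDiff ℝ 2 f → Differentiable ℝ (pdE n f v) :=
    fun v h => (hs_pdE_contDiff_one h v).differentiable (by simp)
  simp only [lapE, hs_pdE_lin (d hf) (d hg), hs_pdE_lin (d' _ hf) (d' _ hg), mul_add,
    Finset.mul_sum, Finset.sum_add_distrib]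
  ring

lemma hs_grad_lin {n : ℕ} {f g : (Fin n → ℝ) × ℝ → ℝ} (hf : Differentiable ℝ f)
    (hg : Differentiable ℝ g) (a b : ℝ) (p) :
    gradSqE n (fun q => a * f q + b * g q) p =
      a ^ 2 * gradSqE n f p + 2 * a * b * hsDot n f g p + b ^ 2 * gradSqE n g p := by
  simp only [gradSqE, hsDot, hs_pdE_lin hf hg, mul_add, Finset.mul_sum]
  have : ∀ i, (a * pdE n f (eX n i) p + b * pdE n g (eX n i) p) ^ 2 =
    a ^ 2 * (pdE n f (eX n i) p) ^ 2 + 2 * a * b * (pdE n f (eX n i) p * pdE n g (eX n i) p)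
     + b ^ 2 * (pdE n g (eX n i) p) ^ 2 := fun i => by ring
  simp only [this, Finset.sum_add_distrib]
  ring

lemma hs_dot_lin {n : ℕ} {f g k : (Fin n → ℝ) × ℝ → ℝ} (hf : Differentiable ℝ f)
    (hg : Differentiable ℝ g) (a b : ℝ) (p) :
    hsDot n (fun q => a * f q + b * g q) k p = a * hsDot n f k p + b * hsDot n g k p := by
  simp only [hsDot, hs_pdE_lin hf hg, mul_add, Finset.mul_sum, add_mul, Finset.sum_add_distrib,
    mul_assoc]
  ring

lemma hs_dot_comm {n : ℕ} (f g : (Fin n → ℝ) × ℝ → ℝ) (p) : hsDot n f g p = hsDot n g f p := by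
  simp only [hsDot, mul_comm]

lemma hs_pdE_const' {n : ℕ} (c : ℝ) (v) : pdE n (fun _ => c) v = fun _ => 0 := by
  funext p; exact hs_pdE_const c v p

lemma hs_lap_const {n : ℕ} (c : ℝ) (p) : lapE n (fun _ => c) p = 0 := by
  simp [lapE, hs_pdE_const']

lemma hs_grad_const {n : ℕ} (c : ℝ) (p) : gradSqE n (fun _ => c) p = 0 := by
  simp [gradSqE, hs_pdE_const']

lemma hs_dot_const {n : ℕ} (f : (Fin n → ℝ) × ℝ → ℝ) (c : ℝ) (p) :
    hsDot n f (fun _ => c) p = 0 := by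
  simp [hsDot, hs_pdE_const']

lemma hs_pdE_snd {n : ℕ} (v) : pdE n (fun p => p.2) v = fun _ => v.2 := by
  funext p
  unfold pdE
  simp [fderiv_snd]

lemma hs_lap_snd {n : ℕ} (p) : lapE n (fun p => p.2) p = 0 := by
  simp [lapE, hs_pdE_snd, hs_pdE_const']

lemma hs_max' {n : ℕ} (hn : 1 ≤ n) {h : (Fin n → ℝ) → ℝ} (hh : ContDiff ℝ 1 h)
    (hper : ZPeriodic n h) {w : (Fin n → ℝ) × ℝ → ℝ} (hw : ContDiff ℝ 2 w)
    (pw : ZPeriodicE n w) (hlap : ∀ p : (Fin n → ℝ) × ℝ, p.2 < h p.1 → 0 ≤ lapE n w p)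
    (hbd : ∀ x, w (x, h x) ≤ 0)
    (hInt0 : IntegrableOn (gradSqE n w) (fluidCell n h)) :
    ∀ p : (Fin n → ℝ) × ℝ, p.2 ≤ h p.1 → w p ≤ 0 := by
  refine hs_max hn hh hper hw pw hlap hbd ?_
  have hm : MeasurableSet {p | 0 < w p} :=
    (isOpen_lt continuous_const hw.continuous).measurableSet
  exact Integrable.indicator hInt0 hm

lemma hs_two {n : ℕ} {f : (Fin n → ℝ) × ℝ → ℝ} (hf : ContDiff ℝ (⊤ : ℕ∞) f) : ContDiff ℝ 2 f :=
  hf.of_le (WithTop.coe_le_coe.2 (le_top : (2 : ℕ∞) ≤ ⊤))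

lemma hs_ext_le {n : ℕ} (hn : 1 ≤ n) {h ψ : (Fin n → ℝ) → ℝ} (hh : ContDiff ℝ 1 h)
    (hper : ZPeriodic n h) {φ : (Fin n → ℝ) × ℝ → ℝ} (hφ : IsHarmonicExt n h ψ φ) (s : ℝ) (M : ℝ)
    (hM : ∀ x, s * ψ x ≤ M) : ∀ p : (Fin n → ℝ) × ℝ, p.2 ≤ h p.1 → s * φ p ≤ M := by
  intro p hp
  have h2 := hs_two hφ.smooth
  have hd : Differentiable ℝ φ := h2.differentiable (by simp)
  have := hs_max' hn hh hper (w := fun q => s * φ q + (-1) * M)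
    ((contDiff_const.mul h2).add contDiff_const) (fun x y k => by simp only [hφ.periodic x y k])
    (fun p hp => by
      rw [hs_lap_lin h2 contDiff_const, hφ.harmonic p hp, hs_lap_const]; simp)
    (fun x => by rw [hφ.boundary]; linarith [hM x])
    (by
      have : gradSqE n (fun q => s * φ q + (-1) * M) = fun p => s ^ 2 * gradSqE n φ p := by
        funext p
        rw [hs_grad_lin hd (differentiable_const M), hs_dot_const, hs_grad_const]; simp
      rw [this]; exact hφ.gradL2.const_mul _) p hp
  linarith

lemma hs_ext_bound {n : ℕ} (hn : 1 ≤ n) {h ψ : (Fin n → ℝ) → ℝ} (hh : ContDiff ℝ 1 h)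
    (hper : ZPeriodic n h) {φ : (Fin n → ℝ) × ℝ → ℝ} (hφ : IsHarmonicExt n h ψ φ) (M : ℝ)
    (hM : ∀ x, |ψ x| ≤ M) : ∀ p : (Fin n → ℝ) × ℝ, p.2 ≤ h p.1 → |φ p| ≤ M := by
  intro p hp
  have h1 := hs_ext_le hn hh hper hφ 1 M (fun x => by linarith [(abs_le.1 (hM x)).2]) p hp
  have h2 := hs_ext_le hn hh hper hφ (-1) M (fun x => by linarith [(abs_le.1 (hM x)).1]) p hp
  rw [abs_le]; constructor <;> linarith

lemma hs_ext_ge_y {n : ℕ} (hn : 1 ≤ n) {h : (Fin n → ℝ) → ℝ} (hh : ContDiff ℝ 1 h)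
    (hper : ZPeriodic n h) {φ : (Fin n → ℝ) × ℝ → ℝ} (hφ : IsHarmonicExt n h h φ) :
    ∀ p : (Fin n → ℝ) × ℝ, p.2 ≤ h p.1 → p.2 ≤ φ p := by
  intro p hp
  obtain ⟨M, hM0, hM⟩ := hs_bdd hh.continuous hper
  have hb := hs_ext_bound hn hh hper hφ M hM
  have h2 := hs_two hφ.smooth
  have hd : Differentiable ℝ φ := h2.differentiable (by simp)
  have hw : ContDiff ℝ 2 (fun q : (Fin n → ℝ) × ℝ => 1 * q.2 + (-1) * φ q) :=
    (contDiff_const.mul contDiff_snd).add (contDiff_const.mul h2)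
  have := hs_max hn hh hper hw (fun x y k => by simp only [hφ.periodic x y k])
    (fun p hp => by
      rw [hs_lap_lin contDiff_snd h2, hφ.harmonic p hp, hs_lap_snd]; simp)
    (fun x => by rw [hφ.boundary]; simp)
    (by
      have hgc := hs_grad_continuous (n := n) (hw.of_le (by norm_num : (1 : WithTop ℕ∞) ≤ 2))
      have hm : MeasurableSet {q : (Fin n → ℝ) × ℝ | 0 < 1 * q.2 + (-1) * φ q} :=
        (isOpen_lt continuous_const hw.continuous).measurableSet
      have h3 : IntegrableOn (gradSqE n (fun q : (Fin n → ℝ) × ℝ => 1 * q.2 + (-1) * φ q))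
          ({q : (Fin n → ℝ) × ℝ | 0 < 1 * q.2 + (-1) * φ q} ∩ fluidCell n h) := by
        refine (hs_integrable_slab hgc (-M) M).mono_set ?_
        rintro q ⟨h4, h5, h6⟩
        simp only [Set.mem_ofPred_eq] at h4
        refine ⟨h5, ?_, ?_⟩
        · have := (abs_le.1 (hb q h6.le)).1; linarith
        · have := (abs_le.1 (hM q.1)).2; linarith
      have h4 := (integrable_indicator_iff hm (μ := volume.restrict (fluidCell n h))
        (f := gradSqE n (fun q : (Fin n → ℝ) × ℝ => 1 * q.2 + (-1) * φ q))).2 (by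
          unfold IntegrableOn at h3 ⊢
          rw [Measure.restrict_restrict hm]; exact h3)
      exact h4) p hp
  linarith

lemma hs_B_le_one {n : ℕ} (hn : 1 ≤ n) {h : (Fin n → ℝ) → ℝ} (hh : ContDiff ℝ 1 h)
    (hper : ZPeriodic n h) {φ : (Fin n → ℝ) × ℝ → ℝ} (hφ : IsHarmonicExt n h h φ) (x) :
    pdE n φ (eY n) (x, h x) ≤ 1 := by
  have h1 := hs_hasDerivAt_vert ((hs_two hφ.smooth).differentiable (by simp)) x (h x)
  have h2 := hasDerivWithinAt_iff_tendsto_slope.1 (h1.hasDerivWithinAt (s := Set.Iio (h x)))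
  have h3 : Set.Iio (h x) \ {h x} = Set.Iio (h x) := by ext; simp +contextual
  rw [h3] at h2
  refine le_of_tendsto h2 ?_
  filter_upwards [self_mem_nhdsWithin] with y hy
  rw [slope_def_field, hφ.boundary]
  have hy' : y < h x := hy
  have := hs_ext_ge_y hn hh hper hφ (x, y) hy'.le
  rw [div_le_iff_of_neg (by linarith)]
  simp only at this
  linarith

lemma hs_shift {n : ℕ} {h ψ : (Fin n → ℝ) → ℝ} {φ : (Fin n → ℝ) × ℝ → ℝ}
    (hφ : IsHarmonicExt n h ψ φ) (d : ℝ) :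
    IsHarmonicExt n (fun x => h x - d) ψ (fun q => φ (q.1, q.2 + d)) := by
  have hp : ∀ v, pdE n (fun q => φ (q.1, q.2 + d)) v = fun p => pdE n φ v (p.1, p.2 + d) :=
    fun v => funext fun p => hs_pdE_shift φ d v p
  refine ⟨hφ.smooth.comp (contDiff_fst.prodMk (contDiff_snd.add contDiff_const)),
    fun x y k => hφ.periodic x _ k, fun p hpp => ?_, fun x => ?_, ?_⟩
  · have : lapE n (fun q => φ (q.1, q.2 + d)) p = lapE n φ (p.1, p.2 + d) := by
      simp only [lapE, hp]
      simp only [hs_pdE_shift]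
    rw [this]
    exact hφ.harmonic _ (by simp only; linarith)
  · simp only [sub_add_cancel]; exact hφ.boundary x
  · have h1 : gradSqE n (fun q => φ (q.1, q.2 + d)) =
        gradSqE n φ ∘ (fun p => p + ((0 : Fin n → ℝ), d)) := by
      funext p
      have e : p + ((0 : Fin n → ℝ), d) = (p.1, p.2 + d) := by ext <;> simp
      simp only [gradSqE, hp, Function.comp, e]
    have h2 : fluidCell n (fun x => h x - d) =
        (fun p => p + ((0 : Fin n → ℝ), d)) ⁻¹' fluidCell n h := by
      ext p
      simp only [fluidCell, Set.mem_ofPred_eq, Set.mem_preimage, Prod.fst_add, Prod.snd_add,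
        add_zero, lt_sub_iff_add_lt]
    rw [h1, h2, Measure.volume_eq_prod]
    have h5 := hφ.gradL2
    rw [Measure.volume_eq_prod] at h5
    exact ((measurePreserving_add_right (volume.prod volume) ((0 : Fin n → ℝ), d)).integrableOn_comp_preimage
      (Homeomorph.addRight ((0 : Fin n → ℝ), d)).measurableEmbedding).2 h5

lemma hs_N_shift {n : ℕ} (h : (Fin n → ℝ) → ℝ) (φ : (Fin n → ℝ) × ℝ → ℝ) (d : ℝ) (x) :
    hsN n (fun x => h x - d) (fun q => φ (q.1, q.2 + d)) x = hsN n h φ x := by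
  have : ∀ i, pdX n (fun x => h x - d) i x = pdX n h i x := fun i => by
    unfold pdX; rw [fderiv_sub_const]
  simp only [hsN, hs_pdE_shift, this, sub_add_cancel]


/-! ## The comparison (step) inequality -/

lemma hs_green_harm {n : ℕ} (hn : 1 ≤ n) {h : (Fin n → ℝ) → ℝ} (hh : ContDiff ℝ 1 h)
    (hper : ZPeriodic n h) {α w : (Fin n → ℝ) × ℝ → ℝ} (hα : ContDiff ℝ 1 α)
    (hw : ContDiff ℝ 2 w) (pα : ZPeriodicE n α) (pw : ZPeriodicE n w)
    (hharm : ∀ p : (Fin n → ℝ) × ℝ, p.2 < h p.1 → lapE n w p = 0)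
    (C : ℝ) (hC : ∀ p ∈ fluidCell n h, |α p| ≤ C)
    (hwi : IntegrableOn (gradSqE n w) (fluidCell n h))
    (hi : IntegrableOn (hsDot n α w) (fluidCell n h)) :
    ∫ p in fluidCell n h, hsDot n α w p = ∫ x in cell n, α (x, h x) * hsN n h w x := by
  have hm := hs_fluid_meas hh.continuous
  have hL2 : IntegrableOn (fun p => (α p) ^ 2 * gradSqE n w p) (fluidCell n h) :=
    hs_bdd_mul hh.continuous (hα.continuous.pow 2) (C ^ 2) (fun p hp => by
      rw [abs_pow]; exact pow_le_pow_left₀ (abs_nonneg _) (hC p hp) 2) hwi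
  have he : Set.EqOn (fun p => α p * lapE n w p + hsDot n α w p) (hsDot n α w)
      (fluidCell n h) := fun p hp => by simp only [hharm p hp.2, mul_zero, zero_add]
  rw [← hs_green hn hh hper hα hw pα pw hL2 (hi.congr_fun he.symm hm)]
  exact setIntegral_congr_fun hm he.symm

lemma hs_bdd_real {P : ℝ → ℝ} (hP : Continuous P) (M : ℝ) :
    ∃ C, 0 ≤ C ∧ ∀ s, |s| ≤ M → |P s| ≤ C := by
  obtain ⟨C, hC⟩ := (isCompact_Icc (a := -M) (b := M)).exists_bound_of_continuousOn
    hP.continuousOn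
  exact ⟨max C 0, le_max_right _ _, fun s hs =>
    (hC s ⟨(abs_le.1 hs).1, (abs_le.1 hs).2⟩).trans (le_max_left _ _)⟩

/-- energy identity -/
lemma hs_energy {n : ℕ} (hn : 1 ≤ n) {h b : (Fin n → ℝ) → ℝ} (hh : ContDiff ℝ 1 h)
    (hper : ZPeriodic n h) {φ : (Fin n → ℝ) × ℝ → ℝ} (hφ : IsHarmonicExt n h b φ)
    {P : ℝ → ℝ} (hP : ContDiff ℝ 2 P)
    {ψ : (Fin n → ℝ) × ℝ → ℝ} (hψ : ContDiff ℝ 2 ψ) (pψ : ZPeriodicE n ψ) (M : ℝ)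
    (hM : ∀ p : (Fin n → ℝ) × ℝ, p.2 ≤ h p.1 → |ψ p| ≤ M)
    (hψi : IntegrableOn (gradSqE n ψ) (fluidCell n h)) :
    IntegrableOn (fun p => deriv P (ψ p) * hsDot n ψ φ p) (fluidCell n h) ∧
    ∫ p in fluidCell n h, deriv P (ψ p) * hsDot n ψ φ p =
      ∫ x in cell n, P (ψ (x, h x)) * hsN n h φ x := by
  obtain ⟨C, hC0, hC⟩ := hs_bdd_real hP.continuous M
  have hP1 : Continuous (deriv P) := hP.continuous_deriv (by norm_num)
  obtain ⟨C', hC0', hC'⟩ := hs_bdd_real hP1 M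
  have hψ1 : ContDiff ℝ 1 ψ := hψ.of_le (by norm_num)
  have hφ2 := hs_two hφ.smooth
  have hφ1 : ContDiff ℝ 1 φ := hφ2.of_le (by norm_num)
  have hi : IntegrableOn (fun p => deriv P (ψ p) * hsDot n ψ φ p) (fluidCell n h) :=
    hs_bdd_mul hh.continuous (hP1.comp hψ.continuous) C' (fun p hp => hC' _ (hM p hp.2.le))
      (hs_dot_integrable hh.continuous hψ1 hφ1 hψi hφ.gradL2)
  refine ⟨hi, ?_⟩
  have e : hsDot n (fun q => P (ψ q)) φ = fun p => deriv P (ψ p) * hsDot n ψ φ p :=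
    funext fun p => hs_dot_comp (hP.differentiable (by norm_num)) (hψ1.differentiable (by simp)) p
  have := hs_green_harm hn hh hper (α := fun q => P (ψ q))
    ((hP.of_le (by norm_num)).comp hψ1) hφ2 (fun x y k => by simp only [pψ x y k]) hφ.periodic
    hφ.harmonic C (fun p hp => hC _ (hM p hp.2.le)) hφ.gradL2 (by rw [e]; exact hi)
  rw [e] at this
  exact this

lemma hs_step {n : ℕ} (hn : 1 ≤ n) {h b : (Fin n → ℝ) → ℝ} (hh : ContDiff ℝ 1 h)
    (hper : ZPeriodic n h) (hb : Continuous b)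
    {φ : (Fin n → ℝ) × ℝ → ℝ} (hφ : IsHarmonicExt n h b φ)
    {P : ℝ → ℝ} (hP : ContDiff ℝ 2 P) (hP1 : ∀ s, 0 ≤ deriv P s)
    (hP2 : ∀ s, 0 ≤ deriv (deriv P) s)
    {ψ : (Fin n → ℝ) × ℝ → ℝ} (hψ : ContDiff ℝ 2 ψ) (pψ : ZPeriodicE n ψ) (M : ℝ)
    (hM : ∀ p : (Fin n → ℝ) × ℝ, p.2 ≤ h p.1 → |ψ p| ≤ M) (hbM : ∀ x, |b x| ≤ M)
    (hψi : IntegrableOn (gradSqE n ψ) (fluidCell n h))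
    (hlap : ∀ p : (Fin n → ℝ) × ℝ, p.2 < h p.1 → 0 ≤ lapE n ψ p)
    (κ : ℝ) (hκ1 : ∀ x, b x - κ ≤ ψ (x, h x)) (hκ2 : ∀ x, ψ (x, h x) ≤ b x)
    (c1 c2 c3 : ℝ) (hc1 : ∀ x, |hsN n h φ x| ≤ c1) (hc2 : ∀ s, |s| ≤ M → |deriv P s| ≤ c2)
    (hc3 : ∀ x, |hsN n h ψ x| ≤ c3) :
    ∫ x in cell n, P (b x) * hsN n h φ x ≤
      (∫ p in fluidCell n h, deriv P (ψ p) * gradSqE n ψ p) + κ * c2 * (c1 + c3) := by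
  have hκ0 : 0 ≤ κ := by have := hκ1 0; have := hκ2 0; linarith
  have hc20 : 0 ≤ c2 := (abs_nonneg _).trans (hc2 (b 0) (hbM 0))
  have hP1c : Continuous (deriv P) := hP.continuous_deriv (by norm_num)
  have hP1d : ContDiff ℝ 1 (deriv P) := by
    have := (contDiff_succ_iff_deriv (n := 1) (f := P)).1 (by simpa [one_add_one_eq_two] using hP)
    exact this.2.2
  have hPd : Differentiable ℝ P := hP.differentiable (by norm_num)
  have hψ1 : ContDiff ℝ 1 ψ := hψ.of_le (by norm_num)
  have hψd : Differentiable ℝ ψ := hψ1.differentiable (by simp)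
  have hφ2 := hs_two hφ.smooth
  have hφ1 : ContDiff ℝ 1 φ := hφ2.of_le (by norm_num)
  have hφd : Differentiable ℝ φ := hφ1.differentiable (by simp)
  have hm := hs_fluid_meas hh.continuous
  obtain ⟨i1, e1⟩ := hs_energy hn hh hper hφ hP hψ pψ M hM hψi
  have hφM := hs_ext_bound hn hh hper hφ M hbM
  have i0 : IntegrableOn (fun p => deriv P (ψ p) * gradSqE n ψ p) (fluidCell n h) :=
    hs_bdd_mul hh.continuous (hP1c.comp hψ.continuous) c2 (fun p hp => hc2 _ (hM p hp.2.le)) hψi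
  -- v = φ - ψ
  set v : (Fin n → ℝ) × ℝ → ℝ := fun q => 1 * φ q + (-1) * ψ q with hv
  have hv2 : ContDiff ℝ 2 v := (contDiff_const.mul hφ2).add (contDiff_const.mul hψ)
  have hv1 : ContDiff ℝ 1 v := hv2.of_le (by norm_num)
  have hvd : Differentiable ℝ v := hv1.differentiable (by simp)
  have pv : ZPeriodicE n v := fun x y k => by simp only [hv, pψ x y k, hφ.periodic x y k]
  have hv0 : ∀ p : (Fin n → ℝ) × ℝ, p.2 ≤ h p.1 → 0 ≤ v p := by
    intro p hp
    have := hs_max' hn hh hper (w := fun q => 1 * ψ q + (-1) * φ q)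
      ((contDiff_const.mul hψ).add (contDiff_const.mul hφ2))
      (fun x y k => by simp only [pψ x y k, hφ.periodic x y k])
      (fun p hp => by
        rw [hs_lap_lin hψ hφ2, hφ.harmonic p hp]; have := hlap p hp; linarith)
      (fun x => by rw [hφ.boundary]; linarith [hκ2 x])
      (by
        have : gradSqE n (fun q => 1 * ψ q + (-1) * φ q) = fun p =>
            1 ^ 2 * gradSqE n ψ p + 2 * 1 * (-1) * hsDot n ψ φ p + (-1) ^ 2 * gradSqE n φ p :=
          funext fun p => hs_grad_lin hψd hφd _ _ p
        rw [this]
        exact ((hψi.const_mul _).add ((hs_dot_integrable hh.continuous hψ1 hφ1 hψi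
          hφ.gradL2).const_mul _)).add (hφ.gradL2.const_mul _)) p hp
    simp only [hv]; linarith
  set α : (Fin n → ℝ) × ℝ → ℝ := fun q => v q * deriv P (ψ q) with hα
  have hα1 : ContDiff ℝ 1 α := hv1.mul (hP1d.comp hψ1)
  have hαb : ∀ p ∈ fluidCell n h, |α p| ≤ 2 * M * c2 := by
    intro p hp
    have a1 := hM p hp.2.le
    have a2 := hφM p hp.2.le
    have a3 : |v p| ≤ 2 * M := by
      rw [abs_le] at a1 a2 ⊢; simp only [hv]; constructor <;> linarith
    rw [hα, abs_mul]
    exact mul_le_mul a3 (hc2 _ a1) (abs_nonneg _) ((abs_nonneg _).trans a3)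
  have hL2 : IntegrableOn (fun p => (α p) ^ 2 * gradSqE n ψ p) (fluidCell n h) :=
    hs_bdd_mul hh.continuous (hα1.continuous.pow 2) ((2 * M * c2) ^ 2) (fun p hp => by
      rw [abs_pow]; exact pow_le_pow_left₀ (abs_nonneg _) (hαb p hp) 2) hψi
  have ht := hs_green_tendsto hn hh hper hα1 hψ
    (fun x y k => by simp only [hα, pψ x y k, pv x y k]) pψ hL2
  have hdv : ∀ p, hsDot n v ψ p = hsDot n ψ φ p - gradSqE n ψ p := fun p => by
    rw [hv, hs_dot_lin hφd hψd, hs_dot_self, hs_dot_comm]; ring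
  have i2 : IntegrableOn (fun p => deriv P (ψ p) * hsDot n v ψ p) (fluidCell n h) := by
    simp only [hdv, mul_sub]; exact i1.sub i0
  have hle : ∫ p in fluidCell n h, deriv P (ψ p) * hsDot n v ψ p ≤
      ∫ x in cell n, α (x, h x) * hsN n h ψ x := by
    refine le_of_tendsto_of_tendsto' (hs_chi_tendsto_integral i2) ht fun N => ?_
    refine setIntegral_mono_on (hs_chi_mul_integrable hh.continuous
      ((hP1c.comp hψ.continuous).mul (hs_dot_continuous hv1 hψ1)) N)
      (hs_chi_mul_integrable hh.continuous
      ((hα1.continuous.mul (hs_lap_continuous hψ)).add (hs_dot_continuous hα1 hψ1)) N)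
      hm fun p hp => ?_
    apply mul_le_mul_of_nonneg_left _ (hs_chi_nonneg _ _)
    have hPψd : Differentiable ℝ (fun q => deriv P (ψ q)) :=
      (hP1d.comp hψ1).differentiable (by simp)
    rw [hα, hs_dot_mul hvd hPψd, hs_dot_comp (hP1d.differentiable (by simp)) hψd, hs_dot_self]
    have q1 := mul_nonneg (mul_nonneg (hv0 p hp.2.le) (hP1 (ψ p))) (hlap p hp.2)
    have q2 := mul_nonneg (hv0 p hp.2.le) (mul_nonneg (hP2 (ψ p)) (hs_grad_nonneg ψ p))
    linarith
  have hxc : Continuous fun x : Fin n → ℝ => (x, h x) := continuous_id.prodMk hh.continuous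
  have hψM : ∀ x, |ψ (x, h x)| ≤ M := fun x => hM (x, h x) le_rfl
  have hle2 : ∫ x in cell n, α (x, h x) * hsN n h ψ x ≤ κ * c2 * c3 := by
    have : ∫ x in cell n, α (x, h x) * hsN n h ψ x ≤ ∫ x in cell n, κ * c2 * c3 := by
      refine setIntegral_mono_on (hs_integrableOn_cell ((hα1.continuous.comp hxc).mul
        (hs_N_continuous hh hψ1))) (hs_integrableOn_cell continuous_const) hs_cell_meas
        fun x _ => ?_
      refine (le_abs_self _).trans ?_
      rw [abs_mul]
      refine mul_le_mul ?_ (hc3 x) (abs_nonneg _) (by positivity)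
      rw [hα, abs_mul]
      refine mul_le_mul ?_ (hc2 _ (hψM x)) (abs_nonneg _) hκ0
      simp only [hv]
      rw [hφ.boundary, abs_le]
      constructor <;> linarith [hκ1 x, hκ2 x]
    simpa using this
  have hle3 : ∫ x in cell n, P (b x) * hsN n h φ x ≤
      (∫ x in cell n, P (ψ (x, h x)) * hsN n h φ x) + κ * c2 * c1 := by
    have : ∫ x in cell n, P (b x) * hsN n h φ x ≤
        ∫ x in cell n, (P (ψ (x, h x)) * hsN n h φ x + κ * c2 * c1) := by
      refine setIntegral_mono_on (hs_integrableOn_cell ((hP.continuous.comp hb).mul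
        (hs_N_continuous hh hφ1))) (hs_integrableOn_cell
        (((hP.continuous.comp (hψ.continuous.comp hxc)).mul
        (hs_N_continuous hh hφ1)).add continuous_const)) hs_cell_meas
        fun x _ => ?_
      have l1 : |P (b x) - P (ψ (x, h x))| ≤ c2 * |b x - ψ (x, h x)| := by
        have := (convex_Icc (-M) M).norm_image_sub_le_of_norm_deriv_le (f := P) (C := c2)
          (fun s _ => hPd s) (fun s hs => hc2 s (abs_le.2 hs)) (abs_le.1 (hψM x))
          (abs_le.1 (hbM x))
        simpa using this
      have l2 : |b x - ψ (x, h x)| ≤ κ := by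
        rw [abs_le]; constructor <;> linarith [hκ1 x, hκ2 x]
      have l3 : (P (b x) - P (ψ (x, h x))) * hsN n h φ x ≤ κ * c2 * c1 := by
        refine (le_abs_self _).trans ?_
        rw [abs_mul]
        refine mul_le_mul (l1.trans ?_) (hc1 x) (abs_nonneg _) (by positivity)
        rw [mul_comm]; exact mul_le_mul_of_nonneg_right l2 hc20
      linarith
    have i9 : IntegrableOn (fun x => P (ψ (x, h x)) * hsN n h φ x) (cell n) := hs_integrableOn_cell
        ((hP.continuous.comp (hψ.continuous.comp hxc)).mul (hs_N_continuous hh hφ1))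
    rw [integral_add i9
        (hs_integrableOn_cell continuous_const)] at this
    simpa using this
  have e2 : ∫ p in fluidCell n h, deriv P (ψ p) * hsDot n ψ φ p =
      (∫ p in fluidCell n h, deriv P (ψ p) * gradSqE n ψ p) +
      ∫ p in fluidCell n h, deriv P (ψ p) * hsDot n v ψ p := by
    rw [← integral_add i0 i2]
    refine setIntegral_congr_fun hm fun p _ => ?_
    simp only [hdv]; ring
  have : κ * c2 * (c1 + c3) = κ * c2 * c1 + κ * c2 * c3 := by ring
  linarith


/-! ## The corrector -/

lemma hs_pdE_fst_x {n : ℕ} {f : (Fin n → ℝ) → ℝ} (hf : Differentiable ℝ f) (i p) :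
    pdE n (fun q => f q.1) (eX n i) p = pdX n f i p.1 := by
  unfold pdE pdX
  have := ((hf p.1).hasFDerivAt.comp p (hasFDerivAt_fst (p := p) (𝕜 := ℝ))).fderiv
  have e : (fun q : (Fin n → ℝ) × ℝ => f q.1) = f ∘ Prod.fst := rfl
  rw [e, this]; simp [eX]

lemma hs_pdE_fst_y {n : ℕ} {f : (Fin n → ℝ) → ℝ} (hf : Differentiable ℝ f) (p) :
    pdE n (fun q => f q.1) (eY n) p = 0 := by
  unfold pdE
  have := ((hf p.1).hasFDerivAt.comp p (hasFDerivAt_fst (p := p) (𝕜 := ℝ))).fderiv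
  have e : (fun q : (Fin n → ℝ) × ℝ => f q.1) = f ∘ Prod.fst := rfl
  rw [e, this]; simp [eY]

lemma hs_exp_integrable {n : ℕ} {h : (Fin n → ℝ) → ℝ} (hh : Continuous h) (a : ℝ) (ha : 0 < a) :
    IntegrableOn (fun p : (Fin n → ℝ) × ℝ => Real.exp (a * (p.2 - h p.1))) (fluidCell n h) := by
  obtain ⟨M, hM0, hM⟩ := hs_bdd_above_cell hh
  have h1 : IntegrableOn (fun p : (Fin n → ℝ) × ℝ => Real.exp (a * M) * Real.exp (a * p.2))
      (cell n ×ˢ Set.Iic M) := by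
    unfold IntegrableOn
    rw [Measure.volume_eq_prod, ← Measure.prod_restrict]
    exact Integrable.mul_prod (f := fun _ => Real.exp (a * M)) (integrable_const _)
      (integrableOn_exp_mul_Iic ha M)
  have h2 := h1.mono_set (s := fluidCell n h) (fun p hp =>
    ⟨hp.1, by have := (abs_le.1 (hM p.1 hp.1)).2; have := hp.2; simp only [Set.mem_Iic]; linarith⟩)
  refine hs_integrable_le hh (by fun_prop) h2 fun p hp => ?_
  rw [abs_of_pos (Real.exp_pos _), ← Real.exp_add]
  apply Real.exp_le_exp.2
  have := (abs_le.1 (hM p.1 hp.1)).1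
  nlinarith

lemma hs_exists_g {n : ℕ} {m h : (Fin n → ℝ) → ℝ} (hm : ContDiff ℝ (⊤ : ℕ∞) m)
    (hh : ContDiff ℝ (⊤ : ℕ∞) h) (pm : ZPeriodic n m) (ph : ZPeriodic n h)
    (hm0 : ∀ x, 0 ≤ m x) (ε : ℝ) (hε : 0 < ε) :
    ∃ g : (Fin n → ℝ) × ℝ → ℝ, ContDiff ℝ (⊤ : ℕ∞) g ∧ ZPeriodicE n g ∧ (∀ p, 0 ≤ lapE n g p) ∧
      (∀ x, 1 ≤ lapE n g (x, h x)) ∧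
      (∃ C, ∀ p : (Fin n → ℝ) × ℝ, p.2 ≤ h p.1 + 1 → |g p| ≤ C) ∧ (∀ p, -(2 * ε) ≤ g p) ∧
      (∀ x, g (x, h x) = m x - ε) ∧ IntegrableOn (gradSqE n g) (fluidCell n h) := by
  have tone : (1 : WithTop ℕ∞) ≤ ((⊤ : ℕ∞) : WithTop ℕ∞) :=
    WithTop.coe_le_coe.2 (le_top : (1 : ℕ∞) ≤ ⊤)
  have dd : ∀ {f : (Fin n → ℝ) → ℝ}, ContDiff ℝ (⊤ : ℕ∞) f → Differentiable ℝ f := fun h =>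
    (h.of_le tone).differentiable (by simp)
  have hmi := fun i => hs_pdX_contDiff hm i
  have hhi := fun i => hs_pdX_contDiff hh i
  have hmii := fun i => hs_pdX_continuous ((hmi i).of_le tone) i
  have hhii := fun i => hs_pdX_continuous ((hhi i).of_le tone) i
  obtain ⟨c1, hc10, hc1⟩ := hs_bdd (f := fun x => ∑ i, pdX n (pdX n m i) i x)
    (continuous_finsetSum _ fun i _ => hmii i)
    (fun x k => Finset.sum_congr rfl fun i _ => hs_periodic_pdX (hs_periodic_pdX pm i) i x k)
  obtain ⟨c2, hc20, hc2⟩ := hs_bdd (f := fun x => (∑ i, 2 * (pdX n m i x * pdX n h i x)) +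
      (m x + ε) * ∑ i, pdX n (pdX n h i) i x)
    ((continuous_finsetSum _ fun i _ => continuous_const.mul
      ((hmi i).continuous.mul (hhi i).continuous)).add
      ((hm.continuous.add continuous_const).mul (continuous_finsetSum _ fun i _ => hhii i)))
    (fun x k => by
      simp only [pm x k, hs_periodic_pdX pm _ x k, hs_periodic_pdX ph _ x k,
        hs_periodic_pdX (hs_periodic_pdX ph _) _ x k])
  set c := max c1 c2 with hc
  have hcc0 : 0 ≤ c := hc10.trans (le_max_left _ _)
  set K := (2 * c + 1) / ε + 1 with hK
  have hK1 : 1 ≤ K := by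
    have : 0 ≤ (2 * c + 1) / ε := by positivity
    linarith
  have hKε : 2 * c + 1 ≤ K * ε := by
    rw [hK, add_mul, div_mul_cancel₀ _ hε.ne']; linarith
  set E : (Fin n → ℝ) × ℝ → ℝ := fun p => Real.exp (K * (p.2 - h p.1)) with hE
  set A : (Fin n → ℝ) × ℝ → ℝ := fun p => m p.1 + ε with hA
  have hu : ContDiff ℝ (⊤ : ℕ∞) (fun p : (Fin n → ℝ) × ℝ => K * (p.2 - h p.1)) :=
    contDiff_const.mul (contDiff_snd.sub (hh.comp contDiff_fst))
  have hEs : ContDiff ℝ (⊤ : ℕ∞) E := hu.exp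
  have hAs : ContDiff ℝ (⊤ : ℕ∞) A := (hm.comp contDiff_fst).add contDiff_const
  have de : ∀ {f : (Fin n → ℝ) × ℝ → ℝ}, ContDiff ℝ (⊤ : ℕ∞) f → Differentiable ℝ f := fun h =>
    (h.of_le tone).differentiable (by simp)
  have dh1 : Differentiable ℝ (fun p : (Fin n → ℝ) × ℝ => h p.1) := de (hh.comp contDiff_fst)
  have dm1 : Differentiable ℝ (fun p : (Fin n → ℝ) × ℝ => m p.1) := de (hm.comp contDiff_fst)
  have Ev : ∀ v p, pdE n E v p = E p * (K * (v.2 - pdE n (fun q => h q.1) v p)) := by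
    intro v p
    have d0 : Differentiable ℝ (fun p : (Fin n → ℝ) × ℝ => p.2 - h p.1) :=
      differentiable_snd.sub dh1
    rw [hE, hs_pdE_comp Real.differentiable_exp (de hu), Real.deriv_exp,
      hs_pdE_const_mul d0, hs_pdE_sub differentiable_snd dh1, hs_pdE_snd]
  have Ex : ∀ i p, pdE n E (eX n i) p = -(K * pdX n h i p.1) * E p := by
    intro i p; rw [Ev, hs_pdE_fst_x (dd hh)]; simp only [eX]; ring
  have Ey : ∀ p, pdE n E (eY n) p = K * E p := by
    intro p; rw [Ev, hs_pdE_fst_y (dd hh)]; simp only [eY]; ring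
  have Ax : ∀ i p, pdE n A (eX n i) p = pdX n m i p.1 := by
    intro i p
    rw [hA, hs_pdE_add dm1 (differentiable_const _), hs_pdE_const, hs_pdE_fst_x (dd hm), add_zero]
  have Ay : ∀ p, pdE n A (eY n) p = 0 := by
    intro p
    rw [hA, hs_pdE_add dm1 (differentiable_const _), hs_pdE_const, hs_pdE_fst_y (dd hm), add_zero]
  set g : (Fin n → ℝ) × ℝ → ℝ := fun p => A p * E p - 2 * ε with hg
  have hgs : ContDiff ℝ (⊤ : ℕ∞) g := (hAs.mul hEs).sub contDiff_const
  have gv : ∀ v, pdE n g v = fun p => A p * pdE n E v p + pdE n A v p * E p := by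
    intro v; funext p
    have d3 : Differentiable ℝ (fun p => A p * E p) := (de hAs).mul (de hEs)
    rw [hg, hs_pdE_sub d3 (differentiable_const _), hs_pdE_const, sub_zero,
      hs_pdE_mul (de hAs) (de hEs)]
  have gx : ∀ i, pdE n g (eX n i) = fun p => (pdX n m i p.1 - K * (A p * pdX n h i p.1)) * E p := by
    intro i; rw [gv]; funext p; rw [Ex, Ax]; ring
  have gy : pdE n g (eY n) = fun p => K * (A p * E p) := by
    rw [gv]; funext p; rw [Ey, Ay]; ring
  have dmi : ∀ i, Differentiable ℝ (fun p : (Fin n → ℝ) × ℝ => pdX n m i p.1) := fun i =>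
    de ((hmi i).comp contDiff_fst)
  have dhi : ∀ i, Differentiable ℝ (fun p : (Fin n → ℝ) × ℝ => pdX n h i p.1) := fun i =>
    de ((hhi i).comp contDiff_fst)
  have gxx : ∀ i p, pdE n (pdE n g (eX n i)) (eX n i) p = E p * (pdX n (pdX n m i) i p.1 -
      K * (2 * (pdX n m i p.1 * pdX n h i p.1) + (m p.1 + ε) * pdX n (pdX n h i) i p.1)
      + K ^ 2 * (m p.1 + ε) * (pdX n h i p.1) ^ 2) := by
    intro i p
    have d1 : Differentiable ℝ (fun p => A p * pdX n h i p.1) := (de hAs).mul (dhi i)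
    have d2 : Differentiable ℝ (fun p => pdX n m i p.1 - K * (A p * pdX n h i p.1)) :=
      (dmi i).sub (d1.const_mul K)
    rw [gx, hs_pdE_mul d2 (de hEs), hs_pdE_sub (dmi i) (d1.const_mul K),
      hs_pdE_const_mul d1, hs_pdE_mul (de hAs) (dhi i), Ex, Ax, hs_pdE_fst_x (dd (hmi i)),
      hs_pdE_fst_x (dd (hhi i))]
    simp only [hA]; ring
  have gyy : ∀ p, pdE n (pdE n g (eY n)) (eY n) p = E p * (K ^ 2 * (m p.1 + ε)) := by
    intro p
    have d3 : Differentiable ℝ (fun p => A p * E p) := (de hAs).mul (de hEs)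
    rw [gy, hs_pdE_const_mul d3, hs_pdE_mul (de hAs) (de hEs), Ey, Ay]
    simp only [hA]; ring
  have hlap : ∀ p, E p ≤ lapE n g p := by
    intro p
    have e1 : lapE n g p = E p * ((∑ i, pdX n (pdX n m i) i p.1) -
        K * ((∑ i, 2 * (pdX n m i p.1 * pdX n h i p.1)) +
        (m p.1 + ε) * ∑ i, pdX n (pdX n h i) i p.1) +
        K ^ 2 * (m p.1 + ε) * ((∑ i, (pdX n h i p.1) ^ 2) + 1)) := by
      unfold lapE
      simp only [gxx, gyy, ← Finset.mul_sum, Finset.sum_add_distrib, Finset.sum_sub_distrib]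
      ring
    rw [e1]
    have q1 := (abs_le.1 (hc1 p.1)).1
    have q2 := (abs_le.1 (hc2 p.1)).2
    have q3 : c1 ≤ c := le_max_left _ _
    have q4 : c2 ≤ c := le_max_right _ _
    have q5 : 0 ≤ ∑ i, (pdX n h i p.1) ^ 2 := by positivity
    have q6 : K ^ 2 * ε ≤ K ^ 2 * (m p.1 + ε) * ((∑ i, (pdX n h i p.1) ^ 2) + 1) := by
      have := hm0 p.1
      calc K ^ 2 * ε ≤ K ^ 2 * (m p.1 + ε) := by gcongr; linarith
        _ ≤ _ := le_mul_of_one_le_right (by positivity) (by linarith)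
    have q7 : K * ((∑ i, 2 * (pdX n m i p.1 * pdX n h i p.1)) +
        (m p.1 + ε) * ∑ i, pdX n (pdX n h i) i p.1) ≤ K * c := by
      gcongr; linarith
    have q8 : K * (2 * c + 1) ≤ K * (K * ε) := by gcongr
    have q9 : c ≤ K * c := le_mul_of_one_le_left hcc0 hK1
    refine le_mul_of_one_le_right (Real.exp_pos _).le ?_
    nlinarith
  obtain ⟨mM, hmM0, hmM⟩ := hs_bdd hm.continuous pm
  have hA0 : ∀ p, 0 < A p := fun p => by have := hm0 p.1; simp only [hA]; linarith
  refine ⟨g, hgs, ?_, fun p => (Real.exp_pos _).le.trans (hlap p), ?_, ⟨(mM + ε) * Real.exp K + 2 * ε,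
    ?_⟩, ?_, ?_, ?_⟩
  · intro x y k
    simp only [hg, hA, hE, pm x k, ph x k]
  · intro x
    refine le_trans (le_of_eq ?_) (hlap (x, h x))
    simp [hE]
  · intro p hp
    have a1 : A p * E p ≤ (mM + ε) * Real.exp K := by
      refine mul_le_mul ?_ ?_ (Real.exp_pos _).le (by positivity)
      · have := (abs_le.1 (hmM p.1)).2; simp only [hA]; linarith
      · apply Real.exp_le_exp.2; nlinarith
    have a2 : 0 ≤ A p * E p := mul_nonneg (hA0 p).le (Real.exp_pos _).le
    rw [abs_le]; simp only [hg]; constructor <;> linarith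
  · intro p
    have a2 : 0 ≤ A p * E p := mul_nonneg (hA0 p).le (Real.exp_pos _).le
    simp only [hg]; linarith
  · intro x
    simp only [hg, hA, hE]; simp; ring
  · obtain ⟨S, hS0, hS⟩ := hs_bdd (f := fun x => (∑ i, (pdX n m i x - K * ((m x + ε) *
        pdX n h i x)) ^ 2) + K ^ 2 * (m x + ε) ^ 2)
      ((continuous_finsetSum _ fun i _ => (((hmi i).continuous.sub (continuous_const.mul
        ((hm.continuous.add continuous_const).mul (hhi i).continuous))).pow 2)).add
        (continuous_const.mul ((hm.continuous.add continuous_const).pow 2)))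
      (fun x k => by
        simp only [pm x k, hs_periodic_pdX pm _ x k, hs_periodic_pdX ph _ x k])
    refine hs_integrable_le hh.continuous (hs_grad_continuous (hgs.of_le tone))
      ((hs_exp_integrable hh.continuous (2 * K) (by linarith)).const_mul S) fun p _ => ?_
    rw [abs_of_nonneg (hs_grad_nonneg _ _)]
    have e2 : gradSqE n g p = ((∑ i, (pdX n m i p.1 - K * ((m p.1 + ε) *
        pdX n h i p.1)) ^ 2) + K ^ 2 * (m p.1 + ε) ^ 2) * Real.exp (2 * K * (p.2 - h p.1)) := by
      have e3 : Real.exp (2 * K * (p.2 - h p.1)) = E p ^ 2 := by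
        simp only [hE]; rw [← Real.exp_nat_mul]; congr 1; push_cast; ring
      simp only [gradSqE, gx, gy, e3, hA, mul_pow, ← Finset.sum_mul]; ring
    rw [e2]
    exact mul_le_mul_of_nonneg_right ((le_abs_self _).trans (hS p.1)) (Real.exp_pos _).le


/-! ## Domain variation -/

lemma hs_strip_eq {n : ℕ} {h h' : (Fin n → ℝ) → ℝ} (hh : Continuous h) (hh' : Continuous h')
    {f : (Fin n → ℝ) × ℝ → ℝ} (hf : Continuous f) (hi : IntegrableOn f (fluidCell n h)) :
    IntegrableOn (fun x => ∫ y in (h x)..(h' x), f (x, y)) (cell n) ∧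
    ∫ p in fluidCell n h', f p =
      (∫ p in fluidCell n h, f p) + ∫ x in cell n, ∫ y in (h x)..(h' x), f (x, y) := by
  have hi' := hs_fluid_integrable_change hh hh' hf hi
  obtain ⟨s1, s2⟩ := hs_fluid_slice hh hi
  obtain ⟨s1', s2'⟩ := hs_fluid_slice hh' hi'
  have key : ∀ᵐ x ∂(volume.restrict (cell n)),
      (∫ y in Set.Iio (h' x), f (x, y)) - (∫ y in Set.Iio (h x), f (x, y)) =
        ∫ y in (h x)..(h' x), f (x, y) := by
    filter_upwards [s1, s1'] with x h1 h2
    rw [← integral_Iic_eq_integral_Iio, ← integral_Iic_eq_integral_Iio]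
    exact intervalIntegral.integral_Iic_sub_Iic ((integrableOn_Iic_iff_integrableOn_Iio (by simp)).2 h1)
      ((integrableOn_Iic_iff_integrableOn_Iio (by simp)).2 h2)
  refine ⟨(s2'.sub s2).congr key, ?_⟩
  rw [hs_fluid_integral hh hi, hs_fluid_integral hh' hi', ← integral_congr_ae key,
    integral_sub s2' s2]
  ring

lemma hs_strip_deriv {n : ℕ} {h0 : (Fin n → ℝ) → ℝ} (hh : Continuous h0) (ph : ZPeriodic n h0)
    (f : ℝ → (Fin n → ℝ) × ℝ → ℝ)
    (hf : Continuous fun q : ℝ × ((Fin n → ℝ) × ℝ) => f q.1 q.2)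
    (pf : ∀ δ, ZPeriodicE n (f δ)) (hi : ∀ δ, IntegrableOn (f δ) (fluidCell n h0))
    (H H' : ℝ → (Fin n → ℝ) → ℝ) (hH : ∀ x s, HasDerivAt (fun δ => H δ x) (H' s x) s)
    (hHc : ∀ s, Continuous (H s))
    (hH'c : Continuous fun p : ℝ × (Fin n → ℝ) => H' p.1 p.2) (pH' : ∀ s, ZPeriodic n (H' s))
    (hH0 : ∀ x, H 0 x = h0 x) (c : ℝ) (hc : 0 < c) :
    ∀ᶠ δ in nhdsWithin (0:ℝ) (Set.Ioi 0),
      ∫ p in fluidCell n (H δ), f δ p ≤ (∫ p in fluidCell n h0, f δ p) +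
        δ * ((∫ x in cell n, H' 0 x * f 0 (x, h0 x)) + c) := by
  have hF : Continuous (fun x => f 0 (x, h0 x)) := by
    have : Continuous fun x : (Fin n → ℝ) => ((0:ℝ), (x, h0 x)) := by fun_prop
    exact hf.comp this
  have pF : ZPeriodic n (fun x => f 0 (x, h0 x)) := fun x k => by
    simp only [ph x k, pf 0 x _ k]
  have hL : Continuous (H' 0) := hH'c.comp (by fun_prop : Continuous fun x : (Fin n → ℝ) => ((0:ℝ), x))
  obtain ⟨CF, CF0, hCF⟩ := hs_bdd hF pF
  obtain ⟨CL, CL0, hCL⟩ := hs_bdd hL (pH' 0)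
  obtain ⟨η, η0, η1, hη⟩ : ∃ η : ℝ, 0 < η ∧ η ≤ 1 ∧ η * (CF + CL + 1) ≤ c := by
    refine ⟨min 1 (c / (CF + CL + 1)), lt_min one_pos (by positivity), min_le_left _ _, ?_⟩
    calc _ ≤ c / (CF + CL + 1) * (CF + CL + 1) := by gcongr; exact min_le_right _ _
      _ = c := by field_simp
  -- closeness of f
  have t1 := hs_tube (n := n) (X := ℝ × ℝ)
    (fun x z => |f z.1 (x, h0 x + z.2) - f 0 (x, h0 x)|)
    (by
      have e1 : Continuous fun p : (ℝ × ℝ) × (Fin n → ℝ) => (p.1.1, (p.2, h0 p.2 + p.1.2)) := by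
        fun_prop
      exact ((hf.comp e1).sub (hF.comp continuous_snd)).abs)
    (fun z x k => by simp only [ph x k, pf _ x _ k]) (0, 0) η (fun x => by simpa using η0)
  obtain ⟨r, r0, hr⟩ := Metric.eventually_nhds_iff.1 t1
  -- first order
  obtain ⟨d1, d10, hd1⟩ := hs_first_order (n := n) (fun x s => H s x - h0 x - s * H' 0 x)
    (fun x s => H' s x - H' 0 x)
    (fun x s => by
      have := ((hH x s).sub_const (h0 x)).sub ((hasDerivAt_id s).mul_const (H' 0 x))
      rw [one_mul] at this
      exact this)
    ((hH'c).sub (hL.comp continuous_snd))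
    (fun z x k => by simp only [pH' _ x k]) (fun x => by simp [hH0]) η (fun x => by simpa using η0)
  obtain ⟨d2, d20, hd2⟩ := hs_first_order (n := n) (fun x s => -(H s x - h0 x - s * H' 0 x))
    (fun x s => -(H' s x - H' 0 x))
    (fun x s => by
      have := (((hH x s).sub_const (h0 x)).sub ((hasDerivAt_id s).mul_const (H' 0 x))).neg
      rw [one_mul] at this
      exact this)
    (((hH'c).sub (hL.comp continuous_snd)).neg)
    (fun z x k => by simp only [pH' _ x k]) (fun x => by simp [hH0]) η (fun x => by simpa using η0)
  have ev : ∀ᶠ δ in nhdsWithin (0:ℝ) (Set.Ioi 0), δ < min (min d1 d2) (min r (r / (CL + 1))) :=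
    mem_nhdsWithin_of_mem_nhds (Iio_mem_nhds (by positivity))
  filter_upwards [ev, self_mem_nhdsWithin] with δ hδ hδ0
  have hδ0 : 0 < δ := hδ0
  simp only [lt_min_iff] at hδ
  obtain ⟨⟨e1, e2⟩, e3, e4⟩ := hδ
  have e4' : δ * (CL + 1) < r := by rwa [lt_div_iff₀ (by positivity)] at e4
  have hfδ : Continuous (f δ) := hf.comp (by fun_prop : Continuous fun p : (Fin n → ℝ) × ℝ => (δ, p))
  obtain ⟨q1, q2⟩ := hs_strip_eq hh (hHc δ) hfδ (hi δ)
  rw [q2]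
  gcongr
  have pt : ∀ x, ∫ y in (h0 x)..(H δ x), f δ (x, y) ≤ δ * (H' 0 x * f 0 (x, h0 x) + c) := by
    intro x
    have a1 := hd1 δ hδ0.le e1 x
    have a2 := hd2 δ hδ0.le e2 x
    set D := H δ x - h0 x with hD
    have aL := abs_le.1 (hCL x)
    have aF := abs_le.1 (hCF x)
    have hDab : |D| ≤ δ * (CL + 1) := by
      rw [abs_le]; constructor <;> nlinarith
    have b1 := intervalIntegral.norm_integral_le_of_norm_le_const (a := h0 x) (b := H δ x)
      (f := fun y => f δ (x, y) - f 0 (x, h0 x)) (C := η) (by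
        intro y hy
        have hy' : |y - h0 x| ≤ |D| := by
          rcases Set.mem_uIoc.1 hy with h | h
          · rw [abs_of_nonneg (by linarith), abs_of_nonneg (by linarith)]; linarith
          · rw [abs_of_nonpos (by linarith), abs_of_nonpos (by linarith)]; linarith
        have := @hr (δ, y - h0 x) (by
          rw [dist_eq_norm]; simp only [Prod.mk_sub_mk, sub_zero, Prod.norm_def, Real.norm_eq_abs]
          rw [abs_of_pos hδ0]
          exact max_lt e3 (by linarith)) x
        simp only [add_sub_cancel] at this
        exact this.le)
    rw [intervalIntegral.integral_sub (Continuous.intervalIntegrable (by fun_prop) _ _)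
      (by simp), intervalIntegral.integral_const, smul_eq_mul, ← hD] at b1
    have b2 := (abs_le.1 b1).2
    have b3 : D * f 0 (x, h0 x) - δ * (H' 0 x * f 0 (x, h0 x)) ≤ η * δ * CF := by
      have : |(D - δ * H' 0 x) * f 0 (x, h0 x)| ≤ (η * δ) * CF := by
        rw [abs_mul]
        apply mul_le_mul _ (hCF x) (abs_nonneg _) (by positivity)
        rw [abs_le]; constructor <;> linarith
      have := (abs_le.1 this).2
      linarith
    have b4 : η * |D| ≤ η * (δ * (CL + 1)) := by gcongr
    nlinarith
  have i0 : IntegrableOn (fun x => H' 0 x * f 0 (x, h0 x)) (cell n) :=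
    hs_integrableOn_cell (hL.mul hF)
  calc _ ≤ ∫ x in cell n, δ * (H' 0 x * f 0 (x, h0 x) + c) :=
        integral_mono q1 ((i0.add (integrable_const c)).const_mul δ) pt
    _ = _ := by
      rw [integral_const_mul, integral_add i0 (integrable_const c)]
      simp



/-! ## Derivative of the energy in a fixed domain -/

lemma hs_fixed_deriv {n : ℕ} {h : (Fin n → ℝ) → ℝ} (hh : Continuous h)
    {φ g : (Fin n → ℝ) × ℝ → ℝ} (hφ : ContDiff ℝ 1 φ) (hg : ContDiff ℝ 1 g)
    {P : ℝ → ℝ} (hP : ContDiff ℝ 2 P) (M M' : ℝ)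
    (hM : ∀ p ∈ fluidCell n h, |φ p| ≤ M) (hM' : ∀ p ∈ fluidCell n h, |g p| ≤ M')
    (hφi : IntegrableOn (gradSqE n φ) (fluidCell n h))
    (hgi : IntegrableOn (gradSqE n g) (fluidCell n h)) :
    (Continuous fun q : ℝ × ((Fin n → ℝ) × ℝ) => deriv P (1 * φ q.2 + q.1 * g q.2) *
        gradSqE n (fun q' => 1 * φ q' + q.1 * g q') q.2) ∧
    (∀ δ : ℝ, IntegrableOn (fun p => deriv P (1 * φ p + δ * g p) *
      gradSqE n (fun q => 1 * φ q + δ * g q) p) (fluidCell n h)) ∧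
    IntegrableOn (fun p => deriv (deriv P) (φ p) * g p * gradSqE n φ p
        + deriv P (φ p) * (2 * hsDot n φ g p)) (fluidCell n h) ∧
    HasDerivAt (fun δ : ℝ => ∫ p in fluidCell n h, deriv P (1 * φ p + δ * g p) *
      gradSqE n (fun q => 1 * φ q + δ * g q) p)
      (∫ p in fluidCell n h, (deriv (deriv P) (φ p) * g p * gradSqE n φ p
        + deriv P (φ p) * (2 * hsDot n φ g p))) 0 := by
  have hm := hs_fluid_meas hh
  have hP1d : ContDiff ℝ 1 (deriv P) :=
    ((contDiff_succ_iff_deriv (n := 1) (f := P)).1 (by simpa [one_add_one_eq_two] using hP)).2.2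
  have hP1c : Continuous (deriv P) := hP1d.continuous
  have hP2c : Continuous (deriv (deriv P)) := hP1d.continuous_deriv le_rfl
  have dφ : Differentiable ℝ φ := hφ.differentiable (by simp)
  have dg : Differentiable ℝ g := hg.differentiable (by simp)
  have cφ := hs_grad_continuous hφ
  have cg := hs_grad_continuous hg
  have cd := hs_dot_continuous hφ hg
  have c1 := hφ.continuous
  have c2 := hg.continuous
  have cψ : ∀ δ : ℝ, Continuous (fun p => 1 * φ p + δ * g p) := fun δ => by fun_prop
  have hdi := hs_dot_integrable hh hφ hg hφi hgi
  have Gint : ∀ δ : ℝ, IntegrableOn (gradSqE n (fun q => 1 * φ q + δ * g q)) (fluidCell n h) := by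
    intro δ
    have e : gradSqE n (fun q => 1 * φ q + δ * g q) = fun p =>
        1 ^ 2 * gradSqE n φ p + 2 * 1 * δ * hsDot n φ g p + δ ^ 2 * gradSqE n g p :=
      funext fun p => hs_grad_lin dφ dg 1 δ p
    rw [e]
    exact ((hφi.const_mul _).add (hdi.const_mul _)).add (hgi.const_mul _)
  have Fint : ∀ δ : ℝ, IntegrableOn (fun p => deriv P (1 * φ p + δ * g p) *
      gradSqE n (fun q => 1 * φ q + δ * g q) p) (fluidCell n h) := by
    intro δ
    obtain ⟨C, C0, hC⟩ := hs_bdd_real hP1c (M + |δ| * M')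
    refine hs_bdd_mul hh (hP1c.comp (cψ δ)) C (fun p hp => hC _ ?_) (Gint δ)
    calc |1 * φ p + δ * g p| ≤ |1 * φ p| + |δ * g p| := abs_add_le _ _
      _ ≤ M + |δ| * M' := by
        rw [abs_mul δ, one_mul]
        have := hM p hp; have := hM' p hp
        gcongr
  refine ⟨?_, Fint, ?_⟩
  · simp only [hs_grad_lin dφ dg]
    refine (hP1c.comp (by fun_prop)).mul ?_
    have q1 := cφ.comp (continuous_snd (X := ℝ))
    have q2 := cg.comp (continuous_snd (X := ℝ))
    have q3 := cd.comp (continuous_snd (X := ℝ))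
    simp only [Function.comp_def] at q1 q2 q3
    fun_prop
  obtain ⟨C1, C10, hC1⟩ := hs_bdd_real hP1c (M + M')
  obtain ⟨C2, C20, hC2⟩ := hs_bdd_real hP2c (M + M')
  have key := hasDerivAt_integral_of_dominated_loc_of_deriv_le (μ := volume.restrict (fluidCell n h))
    (F := fun (δ : ℝ) p => deriv P (1 * φ p + δ * g p) * gradSqE n (fun q => 1 * φ q + δ * g q) p)
    (F' := fun (δ : ℝ) p => (deriv (deriv P) (1 * φ p + δ * g p) * g p) *
        (1 ^ 2 * gradSqE n φ p + 2 * 1 * δ * hsDot n φ g p + δ ^ 2 * gradSqE n g p)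
        + deriv P (1 * φ p + δ * g p) * (2 * hsDot n φ g p + 2 * δ * gradSqE n g p))
    (x₀ := 0) (s := Metric.ball 0 1)
    (bound := fun p => (C2 * M' * 3 + C1 * 4) * (gradSqE n φ p + gradSqE n g p))
    (Metric.ball_mem_nhds 0 one_pos)
    (Filter.Eventually.of_forall fun δ => (Fint δ).aestronglyMeasurable)
    (Fint 0)
    (Continuous.aestronglyMeasurable (by
      have := cψ 0
      fun_prop))
    ((ae_restrict_iff' hm).2 (Filter.Eventually.of_forall fun p hp δ hδ => ?_))
    ((hφi.add hgi).const_mul _)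
    (Filter.Eventually.of_forall fun p δ hδ => ?_)
  · have hs := key
    simp only [zero_mul, add_zero, one_mul, mul_zero, one_pow, ne_eq, OfNat.ofNat_ne_zero,
      not_false_eq_true, zero_pow] at hs
    refine ⟨hs.1, ?_⟩
    simpa only [one_mul] using hs.2
  · have hδ' : |δ| ≤ 1 := by simpa using (Metric.mem_ball.1 hδ).le
    have hMp := hM p hp
    have hMp' := hM' p hp
    have hM0 : 0 ≤ M' := (abs_nonneg _).trans hMp'
    have ha : |1 * φ p + δ * g p| ≤ M + M' := by
      calc |1 * φ p + δ * g p| ≤ |1 * φ p| + |δ * g p| := abs_add_le _ _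
        _ ≤ M + 1 * M' := by rw [abs_mul δ, one_mul]; gcongr
        _ = M + M' := by ring
    have b1 := hC1 _ ha
    have b2 := hC2 _ ha
    have n1 := hs_grad_nonneg φ p
    have n2 := hs_grad_nonneg g p
    have n3 := hs_dot_le φ g p
    set A := gradSqE n φ p
    set B := gradSqE n g p
    set D := hsDot n φ g p
    have t1 : |1 ^ 2 * A + 2 * 1 * δ * D + δ ^ 2 * B| ≤ 3 * (A + B) := by
      have u1 : |δ * D| ≤ 1 * (A + B) := by rw [abs_mul]; gcongr
      have u2 : δ ^ 2 * B ≤ 1 * B := by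
        gcongr
        rw [← sq_abs]; exact pow_le_one₀ (abs_nonneg _) hδ'
      have u3 : 0 ≤ δ ^ 2 * B := by positivity
      have := abs_le.1 u1
      rw [abs_le]; constructor <;> linarith
    have t2 : |2 * D + 2 * δ * B| ≤ 4 * (A + B) := by
      have u1 : |δ * B| ≤ 1 * B := by rw [abs_mul, abs_of_nonneg n2]; gcongr
      have := abs_le.1 u1
      have := abs_le.1 n3
      rw [abs_le]; constructor <;> linarith
    rw [Real.norm_eq_abs]
    calc _ ≤ |deriv (deriv P) (1 * φ p + δ * g p) * g p *
          (1 ^ 2 * A + 2 * 1 * δ * D + δ ^ 2 * B)| +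
          |deriv P (1 * φ p + δ * g p) * (2 * D + 2 * δ * B)| := abs_add_le _ _
      _ ≤ C2 * M' * (3 * (A + B)) + C1 * (4 * (A + B)) := by
        rw [abs_mul, abs_mul, abs_mul]
        gcongr
      _ = _ := by ring
  · simp only [hs_grad_lin dφ dg]
    have e1 : HasDerivAt (fun δ : ℝ => 1 * φ p + δ * g p) (g p) δ := by
      simpa using ((hasDerivAt_id δ).mul_const (g p)).const_add (1 * φ p)
    have e2 := ((hP1d.differentiable (by simp) (1 * φ p + δ * g p)).hasDerivAt.comp δ e1)
    have e3 : HasDerivAt (fun δ : ℝ => 1 ^ 2 * gradSqE n φ p + 2 * 1 * δ * hsDot n φ g p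
        + δ ^ 2 * gradSqE n g p) (2 * hsDot n φ g p + 2 * δ * gradSqE n g p) δ := by
      have := ((((hasDerivAt_id δ).const_mul (2 * 1)).mul_const (hsDot n φ g p)).const_add
        (1 ^ 2 * gradSqE n φ p)).add (((hasDerivAt_id δ).pow 2).mul_const (gradSqE n g p))
      refine HasDerivAt.congr_deriv (f' := _) this ?_
      norm_num
    exact e2.mul e3

/-- first variation of the energy, both in the function and in the domain -/
lemma hs_R_deriv {n : ℕ} {h0 : (Fin n → ℝ) → ℝ} (hh : Continuous h0) (ph : ZPeriodic n h0)
    {φ g : (Fin n → ℝ) × ℝ → ℝ} (hφ : ContDiff ℝ 1 φ) (hg : ContDiff ℝ 1 g)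
    (pφ : ZPeriodicE n φ) (pg : ZPeriodicE n g)
    {P : ℝ → ℝ} (hP : ContDiff ℝ 2 P) (M M' : ℝ)
    (hM : ∀ p ∈ fluidCell n h0, |φ p| ≤ M) (hM' : ∀ p ∈ fluidCell n h0, |g p| ≤ M')
    (hφi : IntegrableOn (gradSqE n φ) (fluidCell n h0))
    (hgi : IntegrableOn (gradSqE n g) (fluidCell n h0))
    (H H' : ℝ → (Fin n → ℝ) → ℝ) (hH : ∀ x s, HasDerivAt (fun δ => H δ x) (H' s x) s)
    (hHc : ∀ s, Continuous (H s))
    (hH'c : Continuous fun p : ℝ × (Fin n → ℝ) => H' p.1 p.2) (pH' : ∀ s, ZPeriodic n (H' s))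
    (hH0 : ∀ x, H 0 x = h0 x) (c : ℝ) (hc : 0 < c) :
    ∀ᶠ δ in nhdsWithin (0:ℝ) (Set.Ioi 0),
      ∫ p in fluidCell n (H δ), deriv P (1 * φ p + δ * g p) *
        gradSqE n (fun q => 1 * φ q + δ * g q) p ≤
      (∫ p in fluidCell n h0, deriv P (φ p) * gradSqE n φ p) +
        δ * ((∫ p in fluidCell n h0, (deriv (deriv P) (φ p) * g p * gradSqE n φ p
          + deriv P (φ p) * (2 * hsDot n φ g p)))
          + (∫ x in cell n, H' 0 x * (deriv P (φ (x, h0 x)) * gradSqE n φ (x, h0 x))) + c) := by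
  obtain ⟨k1, k2, k3, k4⟩ := hs_fixed_deriv hh hφ hg hP M M' hM hM' hφi hgi
  have dφ : Differentiable ℝ φ := hφ.differentiable (by simp)
  have dg : Differentiable ℝ g := hg.differentiable (by simp)
  have pgr : ∀ f : (Fin n → ℝ) × ℝ → ℝ, ZPeriodicE n f → ZPeriodicE n (gradSqE n f) :=
    fun f hf x y k => by
      simp only [gradSqE, hs_periodicE_pd hf _ x y k]
  have A1 := hs_strip_deriv hh ph (fun δ p => deriv P (1 * φ p + δ * g p) *
        gradSqE n (fun q => 1 * φ q + δ * g q) p) k1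
    (fun δ x y k => by
      have pp : ZPeriodicE n (fun q => 1 * φ q + δ * g q) := fun x y k => by
        simp only [pφ x y k, pg x y k]
      simp only [pφ x y k, pg x y k, pgr _ pp x y k]) k2 H H' hH hHc hH'c pH' hH0 (c / 2) (by positivity)
  have A2 := (k4.hasDerivWithinAt (s := Set.Ioi 0)).limsup_slope_le' (by simp)
    (lt_add_of_pos_right _ (half_pos hc))
  filter_upwards [A1, A2, self_mem_nhdsWithin] with δ h1 h2 hδ
  have hδ : 0 < δ := hδ
  rw [slope_def_field, div_lt_iff₀ (by simpa using hδ)] at h2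
  simp only [zero_mul, add_zero, one_mul, sub_zero] at h1 h2 ⊢
  linarith



/-! ## Time dependence -/

/-- time derivative of the interface -/
def hsT (n : ℕ) (h : ℝ → (Fin n → ℝ) → ℝ) (t : ℝ) (x : Fin n → ℝ) : ℝ :=
  fderiv ℝ (Function.uncurry h) (t, x) (1, 0)

lemma hs_T_deriv {n : ℕ} {h : ℝ → (Fin n → ℝ) → ℝ}
    (hs : ContDiff ℝ (⊤ : ℕ∞) (Function.uncurry h)) (t : ℝ) (x : Fin n → ℝ) :
    HasDerivAt (fun s => h s x) (hsT n h t x) t := by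
  have h1 : HasDerivAt (fun s : ℝ => (s, x)) ((1:ℝ), (0 : Fin n → ℝ)) t :=
    (hasDerivAt_id t).prodMk (hasDerivAt_const t x)
  exact ((hs.differentiable (by simp)) (t, x)).hasFDerivAt.comp_hasDerivAt t h1

lemma hs_T_cont {n : ℕ} {h : ℝ → (Fin n → ℝ) → ℝ}
    (hs : ContDiff ℝ (⊤ : ℕ∞) (Function.uncurry h)) :
    Continuous fun p : ℝ × (Fin n → ℝ) => hsT n h p.1 p.2 :=
  (hs.continuous_fderiv (by simp)).clm_apply continuous_const

lemma hs_T_per {n : ℕ} {h : ℝ → (Fin n → ℝ) → ℝ}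
    (hs : ContDiff ℝ (⊤ : ℕ∞) (Function.uncurry h)) (hp : ∀ t, ZPeriodic n (h t)) (t : ℝ) :
    ZPeriodic n (hsT n h t) := by
  intro x k
  rw [← (hs_T_deriv hs t x).deriv, ← (hs_T_deriv hs t _).deriv]
  congr 1
  funext s
  exact hp s x k

lemma hs_smooth_t {n : ℕ} {h : ℝ → (Fin n → ℝ) → ℝ}
    (hs : ContDiff ℝ (⊤ : ℕ∞) (Function.uncurry h)) (t : ℝ) : ContDiff ℝ (⊤ : ℕ∞) (h t) :=
  hs.comp (contDiff_const.prodMk contDiff_id : ContDiff ℝ (⊤ : ℕ∞) fun x : (Fin n → ℝ) => (t, x))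

lemma hs_pdXt_eq {n : ℕ} {h : ℝ → (Fin n → ℝ) → ℝ}
    (hs : ContDiff ℝ (⊤ : ℕ∞) (Function.uncurry h)) (i : Fin n) (t : ℝ) (x : Fin n → ℝ) :
    pdX n (h t) i x = fderiv ℝ (Function.uncurry h) (t, x) (0, Pi.single i 1) := by
  have h1 : HasFDerivAt (fun x : (Fin n → ℝ) => (t, x))
      ((0 : (Fin n → ℝ) →L[ℝ] ℝ).prod (ContinuousLinearMap.id ℝ (Fin n → ℝ))) x :=
    (hasFDerivAt_const t x).prodMk (hasFDerivAt_id x)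
  have h2 := (((hs.differentiable (by simp)) (t, x)).hasFDerivAt.comp x h1).fderiv
  have h3 : Function.uncurry h ∘ (fun x : (Fin n → ℝ) => (t, x)) = h t := rfl
  rw [h3] at h2
  unfold pdX
  rw [h2]
  simp

lemma hs_pdXt_cont {n : ℕ} {h : ℝ → (Fin n → ℝ) → ℝ}
    (hs : ContDiff ℝ (⊤ : ℕ∞) (Function.uncurry h)) (i : Fin n) :
    Continuous fun p : ℝ × (Fin n → ℝ) => pdX n (h p.1) i p.2 := by
  simp only [hs_pdXt_eq hs]
  exact (hs.continuous_fderiv (by simp)).clm_apply continuous_const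

/-! ## Boundary identities -/

lemma hs_bdry_V {n : ℕ} {h : (Fin n → ℝ) → ℝ} (hh : ContDiff ℝ (⊤ : ℕ∞) h)
    {φ : (Fin n → ℝ) × ℝ → ℝ} (hφ : IsHarmonicExt n h h φ) (i : Fin n) (x : Fin n → ℝ) :
    pdE n φ (eX n i) (x, h x) = (1 - pdE n φ (eY n) (x, h x)) * pdX n h i x := by
  have h1 := hs_hasFDeriv_graph (hφ.smooth.differentiable (by simp))
    (hh.differentiable (by simp)) 0 i x
  have h2 : (fun x => φ (x, 0 + h x)) = h := by
    funext x; rw [zero_add]; exact hφ.boundary x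
  rw [h2, zero_add] at h1
  linarith

lemma hs_bdry_N {n : ℕ} {h : (Fin n → ℝ) → ℝ} (hh : ContDiff ℝ (⊤ : ℕ∞) h)
    {φ : (Fin n → ℝ) × ℝ → ℝ} (hφ : IsHarmonicExt n h h φ) (x : Fin n → ℝ) :
    hsN n h φ x = pdE n φ (eY n) (x, h x) -
      (1 - pdE n φ (eY n) (x, h x)) * ∑ i, (pdX n h i x) ^ 2 := by
  unfold hsN
  rw [Finset.mul_sum]
  congr 1
  refine Finset.sum_congr rfl fun i _ => ?_
  rw [hs_bdry_V hh hφ]; ring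

lemma hs_bdry_m {n : ℕ} {h : (Fin n → ℝ) → ℝ} (hh : ContDiff ℝ (⊤ : ℕ∞) h)
    {φ : (Fin n → ℝ) × ℝ → ℝ} (hφ : IsHarmonicExt n h h φ) (x : Fin n → ℝ) :
    gradSqE n φ (x, h x) = (1 - pdE n φ (eY n) (x, h x)) ^ 2 * (∑ i, (pdX n h i x) ^ 2)
      + (pdE n φ (eY n) (x, h x)) ^ 2 := by
  unfold gradSqE
  rw [Finset.mul_sum]
  congr 1
  refine Finset.sum_congr rfl fun i _ => ?_
  rw [hs_bdry_V hh hφ]; ring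

/-! ## Boundary comparison -/

lemma hs_bdry_step {n : ℕ} {h : ℝ → (Fin n → ℝ) → ℝ}
    (hs : ContDiff ℝ (⊤ : ℕ∞) (Function.uncurry h)) (hp : ∀ t, ZPeriodic n (h t)) (t0 : ℝ)
    {φ g : (Fin n → ℝ) × ℝ → ℝ} (hφ : IsHarmonicExt n (h t0) (h t0) φ)
    (heq : ∀ x, hsT n h t0 x = - hsN n (h t0) φ x)
    (hg : ContDiff ℝ (⊤ : ℕ∞) g) (pg : ZPeriodicE n g) (ε : ℝ) (hε : 0 < ε)
    (hgb : ∀ x, g (x, h t0 x) = gradSqE n φ (x, h t0 x) - ε) :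
    ∃ δ0 > 0, ∀ δ, 0 ≤ δ → δ < δ0 → ∀ x,
      h (t0 + δ) x - 2 * ε * δ ≤ 1 * φ (x, h (t0 + δ) x - δ) + δ * g (x, h (t0 + δ) x - δ) ∧
      1 * φ (x, h (t0 + δ) x - δ) + δ * g (x, h (t0 + δ) x - δ) ≤ h (t0 + δ) x := by
  have dφ : Differentiable ℝ φ := hφ.smooth.differentiable (by simp)
  have dg : Differentiable ℝ g := hg.differentiable (by simp)
  have cφ : Continuous (pdE n φ (eY n)) := hs_pdE_continuous ((hs_two hφ.smooth).of_le (by norm_num)) _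
  have cg : Continuous (pdE n g (eY n)) := hs_pdE_continuous ((hs_two hg).of_le (by norm_num)) _
  have cT : Continuous fun p : ℝ × (Fin n → ℝ) => hsT n h (t0 + p.1) p.2 :=
    (hs_T_cont hs).comp (by fun_prop : Continuous fun p : ℝ × (Fin n → ℝ) => (t0 + p.1, p.2))
  have cH : Continuous fun p : ℝ × (Fin n → ℝ) => (p.2, h (t0 + p.1) p.2 - p.1) := by
    have := hs.continuous.comp (by fun_prop : Continuous fun p : ℝ × (Fin n → ℝ) => (t0 + p.1, p.2))
    simp only [Function.comp_def, Function.uncurry_apply_pair] at this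
    fun_prop
  let k : (Fin n → ℝ) → ℝ → ℝ := fun x δ =>
    1 * φ (x, h (t0 + δ) x - δ) + δ * g (x, h (t0 + δ) x - δ) - h (t0 + δ) x
  let k' : (Fin n → ℝ) → ℝ → ℝ := fun x δ =>
    1 * (pdE n φ (eY n) (x, h (t0 + δ) x - δ) * (hsT n h (t0 + δ) x - 1)) +
    (1 * g (x, h (t0 + δ) x - δ) + δ * (pdE n g (eY n) (x, h (t0 + δ) x - δ) *
      (hsT n h (t0 + δ) x - 1))) - hsT n h (t0 + δ) x
  have hk : ∀ x s, HasDerivAt (k x) (k' x s) s := by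
    intro x s
    have e1 : HasDerivAt (fun δ => h (t0 + δ) x) (hsT n h (t0 + s) x) s :=
      HasDerivAt.comp_const_add t0 s (hs_T_deriv hs (t0 + s) x)
    have e2 : HasDerivAt (fun δ => h (t0 + δ) x - δ) (hsT n h (t0 + s) x - 1) s :=
      e1.sub (hasDerivAt_id s)
    have e3 := HasDerivAt.comp (h := fun δ => h (t0 + δ) x - δ) s
      (hs_hasDerivAt_vert dφ x (h (t0 + s) x - s)) e2
    have e4 := HasDerivAt.comp (h := fun δ => h (t0 + δ) x - δ) s
      (hs_hasDerivAt_vert dg x (h (t0 + s) x - s)) e2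
    exact ((e3.const_mul 1).add ((hasDerivAt_id s).mul e4)).sub e1
  have hkc : Continuous fun p : ℝ × (Fin n → ℝ) => k' p.2 p.1 := by
    have q1 := cφ.comp cH
    have q2 := cg.comp cH
    have q3 := hg.continuous.comp cH
    simp only [Function.comp_def] at q1 q2 q3
    simp only [k']
    fun_prop
  have hkp : ∀ z, ZPeriodic n (fun x => k' x z) := by
    intro z x k
    simp only [k', hp _ x k, hs_T_per hs hp _ x k, hs_periodicE_pd hφ.periodic _ x _ k,
      hs_periodicE_pd pg _ x _ k, pg x _ k]
  have hk0 : ∀ x, k x 0 = 0 := by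
    intro x
    simp only [k, add_zero, sub_zero, hφ.boundary]; ring
  have hk0' : ∀ x, k' x 0 = -ε := by
    intro x
    simp only [k', add_zero, sub_zero, hgb, heq, hs_bdry_N (hs_smooth_t hs t0) hφ,
      hs_bdry_m (hs_smooth_t hs t0) hφ]
    ring
  obtain ⟨d1, d10, h1⟩ := hs_first_order k k' hk hkc hkp hk0 0 (fun x => by rw [hk0']; linarith)
  obtain ⟨d2, d20, h2⟩ := hs_first_order (fun x s => - k x s) (fun x s => - k' x s)
    (fun x s => (hk x s).neg) hkc.neg (fun z x j => by
      have := hkp z x j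
      simp only at this ⊢
      rw [this]) (fun x => by
      simp only [hk0, neg_zero]) (2 * ε) (fun x => by simp only [hk0']; linarith)
  refine ⟨min d1 d2, lt_min d10 d20, fun δ hδ hδ' x => ?_⟩
  have a1 := h1 δ hδ (hδ'.trans_le (min_le_left _ _)) x
  have a2 := h2 δ hδ (hδ'.trans_le (min_le_right _ _)) x
  simp only [k] at a1 a2
  constructor <;> linarith

/-! ## Subharmonicity -/

lemma hs_lap_step {n : ℕ} {h : ℝ → (Fin n → ℝ) → ℝ}
    (hs : ContDiff ℝ (⊤ : ℕ∞) (Function.uncurry h)) (hp : ∀ t, ZPeriodic n (h t)) (t0 : ℝ)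
    {φ g : (Fin n → ℝ) × ℝ → ℝ} (hφ : IsHarmonicExt n (h t0) (h t0) φ)
    (hg : ContDiff ℝ (⊤ : ℕ∞) g) (pg : ZPeriodicE n g) (hg0 : ∀ p, 0 ≤ lapE n g p)
    (hg1 : ∀ x, 1 ≤ lapE n g (x, h t0 x)) :
    ∃ δ0 > 0, ∀ δ, 0 ≤ δ → δ < δ0 → ∀ p : (Fin n → ℝ) × ℝ, p.2 < h (t0 + δ) p.1 - δ →
      0 ≤ lapE n (fun q => 1 * φ q + δ * g q) p := by
  have hh0 := (hs_smooth_t hs t0).continuous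
  have plap : ∀ f : (Fin n → ℝ) × ℝ → ℝ, ZPeriodicE n f → ZPeriodicE n (lapE n f) :=
    fun f hf x y k => by
      simp only [lapE, hs_periodicE_pd (hs_periodicE_pd hf _) _ x y k]
  have slap : ContDiff ℝ (⊤ : ℕ∞) (lapE n φ) := by
    unfold lapE
    exact (ContDiff.sum fun i _ => hs_pdE_contDiff (hs_pdE_contDiff hφ.smooth _) _).add
      (hs_pdE_contDiff (hs_pdE_contDiff hφ.smooth _) _)
  have dlap : Differentiable ℝ (lapE n φ) := slap.differentiable (by simp)
  have z0 : ∀ p : (Fin n → ℝ) × ℝ, p.2 ≤ h t0 p.1 → lapE n φ p = 0 := by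
    rintro ⟨x, y⟩ hy
    have hcl : y ∈ closure (Set.Iio (h t0 x)) := by
      rw [closure_Iio]; exact hy
    have hc : Continuous fun y => lapE n φ (x, y) := slap.continuous.comp (by fun_prop)
    exact (isClosed_singleton (x := (0:ℝ))).preimage hc |>.closure_subset_iff.2
      (fun y hy => hφ.harmonic (x, y) hy) hcl
  have z1 : ∀ x, pdE n (lapE n φ) (eY n) (x, h t0 x) = 0 := by
    intro x
    have e1 := (hs_hasDerivAt_vert dlap x (h t0 x)).hasDerivWithinAt (s := Set.Iic (h t0 x))
    have e2 : HasDerivWithinAt (fun y => lapE n φ (x, y)) 0 (Set.Iic (h t0 x)) (h t0 x) :=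
      (hasDerivWithinAt_const (h t0 x) _ (0:ℝ)).congr (fun y hy => z0 (x, y) hy) (z0 (x, h t0 x) le_rfl)
    exact (uniqueDiffWithinAt_Iic _).eq_deriv _ e1 e2
  obtain ⟨CL, CL0, hCL⟩ := hs_bdd (f := hsT n h t0) ((hs_T_cont hs).comp
    (by fun_prop : Continuous fun x : (Fin n → ℝ) => (t0, x))) (hs_T_per hs hp t0)
  -- displacement of the interface
  obtain ⟨d1, d10, h1⟩ := hs_first_order (n := n) (fun x δ => h (t0 + δ) x - δ - h t0 x)
    (fun x δ => hsT n h (t0 + δ) x - 1)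
    (fun x s => by
      have e1 : HasDerivAt (fun δ => h (t0 + δ) x) (hsT n h (t0 + s) x) s :=
        HasDerivAt.comp_const_add t0 s (hs_T_deriv hs (t0 + s) x)
      exact (e1.sub (hasDerivAt_id s)).sub_const _)
    (((hs_T_cont hs).comp
      (by fun_prop : Continuous fun p : ℝ × (Fin n → ℝ) => (t0 + p.1, p.2))).sub continuous_const)
    (fun z x k => by simp only [hs_T_per hs hp _ x k]) (fun x => by simp) (CL + 1)
    (fun x => by
      have := (abs_le.1 (hCL x)).2
      simp only [add_zero]; linarith)
  -- Laplacian of φ above the interface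
  obtain ⟨d2, d20, h2⟩ := hs_first_order (n := n) (fun x s => - lapE n φ (x, h t0 x + s))
    (fun x s => - pdE n (lapE n φ) (eY n) (x, h t0 x + s))
    (fun x s => (HasDerivAt.comp_const_add (h t0 x) s
      (hs_hasDerivAt_vert dlap x (h t0 x + s))).neg)
    (((hs_pdE_continuous (slap.of_le (by simp)) (eY n)).comp
      (by fun_prop : Continuous fun p : ℝ × (Fin n → ℝ) => (p.2, h t0 p.2 + p.1))).neg)
    (fun z x k => by simp only [hp t0 x k, hs_periodicE_pd (plap _ hφ.periodic) _ x _ k])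
    (fun x => by simp only [add_zero, z0 (x, h t0 x) le_rfl, neg_zero]) (1 / (2 * (CL + 1)))
    (fun x => by simp only [add_zero, z1, neg_zero]; positivity)
  -- Laplacian of g near the interface
  have t1 := hs_tube (n := n) (X := ℝ) (fun x s => - lapE n g (x, h t0 x + s))
    (((hs_lap_continuous (hs_two hg)).comp
      (by fun_prop : Continuous fun p : ℝ × (Fin n → ℝ) => (p.2, h t0 p.2 + p.1))).neg)
    (fun z x k => by simp only [hp t0 x k, plap _ pg x _ k]) 0 (-(1/2))
    (fun x => by have := hg1 x; simp only [add_zero]; linarith)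
  obtain ⟨d3, d30, h3⟩ := Metric.eventually_nhds_iff.1 t1
  refine ⟨min d1 (min (d2 / (CL + 1)) (d3 / (CL + 1))), by positivity, ?_⟩
  rintro δ hδ hδ' ⟨x, y⟩ hy
  simp only [lt_min_iff] at hδ'
  obtain ⟨b1, b2, b3⟩ := hδ'
  rw [lt_div_iff₀ (by positivity)] at b2 b3
  rw [hs_lap_lin (hs_two hφ.smooth) (hs_two hg)]
  have a1 := h1 δ hδ b1 x
  simp only at a1 hy
  rcases le_total y (h t0 x) with hle | hle
  · rw [z0 (x, y) hle]
    have := mul_nonneg hδ (hg0 (x, y))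
    linarith
  · have s0 : 0 ≤ y - h t0 x := by linarith
    have s1 : y - h t0 x ≤ (CL + 1) * δ := by linarith
    have a2 := h2 (y - h t0 x) s0 (by nlinarith) x
    have a3 := @h3 (y - h t0 x) (by
      rw [Real.dist_eq, sub_zero, abs_of_nonneg s0]; nlinarith) x
    simp only [add_sub_cancel] at a2 a3
    have a4 : 1 / (2 * (CL + 1)) * (y - h t0 x) ≤ δ / 2 := by
      calc _ ≤ 1 / (2 * (CL + 1)) * ((CL + 1) * δ) := by gcongr
        _ = δ / 2 := by field_simp
    nlinarith



/-! ## The first variation is controlled by the dissipation -/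

lemma hs_variation {n : ℕ} (hn : 1 ≤ n) {h : ℝ → (Fin n → ℝ) → ℝ}
    (hs : ContDiff ℝ (⊤ : ℕ∞) (Function.uncurry h)) (hp : ∀ t, ZPeriodic n (h t)) (t0 : ℝ)
    {φ g : (Fin n → ℝ) × ℝ → ℝ} (hφ : IsHarmonicExt n (h t0) (h t0) φ)
    (heq : ∀ x, hsT n h t0 x = - hsN n (h t0) φ x)
    (hg : ContDiff ℝ (⊤ : ℕ∞) g) (pg : ZPeriodicE n g) (ε : ℝ)
    (hgb : ∀ x, g (x, h t0 x) = gradSqE n φ (x, h t0 x) - ε)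
    (hgε : ∀ p, -(2 * ε) ≤ g p) (hgi : IntegrableOn (gradSqE n g) (fluidCell n (h t0)))
    {P : ℝ → ℝ} (hP : ContDiff ℝ 2 P) (hP2 : ∀ s, 0 ≤ deriv (deriv P) s) (M M' : ℝ)
    (hM : ∀ p ∈ fluidCell n (h t0), |φ p| ≤ M) (hM' : ∀ p ∈ fluidCell n (h t0), |g p| ≤ M') :
    (∫ p in fluidCell n (h t0), (deriv (deriv P) (φ p) * g p * gradSqE n φ p
          + deriv P (φ p) * (2 * hsDot n φ g p)))
      + (∫ x in cell n, (hsT n h t0 x - 1) *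
          (deriv P (φ (x, h t0 x)) * gradSqE n φ (x, h t0 x))) ≤
    - (∫ x in cell n, deriv P (h t0 x) * (1 - pdE n φ (eY n) (x, h t0 x)) *
        ((hsT n h t0 x) ^ 2 + ∑ i, (pdX n (h t0) i x) ^ 2))
    + 2 * ε * ((∫ x in cell n, deriv P (h t0 x) * hsT n h t0 x)
        + ∫ p in fluidCell n (h t0), deriv (deriv P) (φ p) * gradSqE n φ p) := by
  have hh := hs_smooth_t hs t0
  have hhc := hh.continuous
  have hm := hs_fluid_meas hhc
  have hP1d : ContDiff ℝ 1 (deriv P) :=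
    ((contDiff_succ_iff_deriv (n := 1) (f := P)).1 (by simpa [one_add_one_eq_two] using hP)).2.2
  have hP1c : Continuous (deriv P) := hP1d.continuous
  have hP2c : Continuous (deriv (deriv P)) := hP1d.continuous_deriv le_rfl
  have hφ1 : ContDiff ℝ 1 φ := (hs_two hφ.smooth).of_le (by norm_num)
  have hg1 : ContDiff ℝ 1 g := (hs_two hg).of_le (by norm_num)
  have dφ : Differentiable ℝ φ := hφ1.differentiable (by simp)
  have dg : Differentiable ℝ g := hg1.differentiable (by simp)
  obtain ⟨C1, C10, hC1⟩ := hs_bdd_real hP1c M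
  obtain ⟨C2, C20, hC2⟩ := hs_bdd_real hP2c M
  have hP2φ : Continuous fun p => deriv (deriv P) (φ p) := hP2c.comp hφ.smooth.continuous
  have hP1φ : Continuous fun p => deriv P (φ p) := hP1c.comp hφ.smooth.continuous
  have I2 : IntegrableOn (fun p => deriv (deriv P) (φ p) * gradSqE n φ p) (fluidCell n (h t0)) :=
    hs_bdd_mul hhc hP2φ C2 (fun p hp => hC2 _ (hM p hp)) hφ.gradL2
  have I1 : IntegrableOn (fun p => g p * (deriv (deriv P) (φ p) * gradSqE n φ p))
      (fluidCell n (h t0)) := hs_bdd_mul hhc hg.continuous M' hM' I2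
  have I3 : IntegrableOn (fun p => deriv P (φ p) * hsDot n g φ p) (fluidCell n (h t0)) :=
    hs_bdd_mul hhc hP1φ C1 (fun p hp => hC1 _ (hM p hp))
      (hs_dot_integrable hhc hg1 hφ1 hgi hφ.gradL2)
  have hα : ContDiff ℝ 1 (fun p => deriv P (φ p) * g p) := (hP1d.comp hφ1).mul hg1
  have dP1 : Differentiable ℝ (fun p => deriv P (φ p)) :=
    (hP1d.comp hφ1).differentiable (by simp)
  have edot : hsDot n (fun p => deriv P (φ p) * g p) φ = fun p =>
      deriv P (φ p) * hsDot n g φ p + g p * (deriv (deriv P) (φ p) * gradSqE n φ p) := by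
    funext p
    rw [hs_dot_mul dP1 dg, hs_dot_comp (hP1d.differentiable (by simp)) dφ, hs_dot_self]
  have green := hs_green_harm hn (hh.of_le (by simp)) (hp t0) hα (hs_two hφ.smooth)
    (fun x y k => by simp only [hφ.periodic x y k, pg x y k]) hφ.periodic hφ.harmonic (C1 * M')
    (fun p hp => by
      rw [abs_mul]
      exact mul_le_mul (hC1 _ (hM p hp)) (hM' p hp) (abs_nonneg _) C10) hφ.gradL2
    (by rw [edot]; exact I3.add I1)
  rw [edot, integral_add I3 I1] at green
  have eA : (∫ p in fluidCell n (h t0), (deriv (deriv P) (φ p) * g p * gradSqE n φ p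
          + deriv P (φ p) * (2 * hsDot n φ g p))) =
      (∫ p in fluidCell n (h t0), g p * (deriv (deriv P) (φ p) * gradSqE n φ p)) +
      2 * ∫ p in fluidCell n (h t0), deriv P (φ p) * hsDot n g φ p := by
    rw [← integral_const_mul, ← integral_add I1 (I3.const_mul 2)]
    congr 1
    funext p
    rw [hs_dot_comm φ g]; ring
  have low : -(2 * ε) * (∫ p in fluidCell n (h t0), deriv (deriv P) (φ p) * gradSqE n φ p) ≤
      ∫ p in fluidCell n (h t0), g p * (deriv (deriv P) (φ p) * gradSqE n φ p) := by
    rw [← integral_const_mul]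
    exact integral_mono (I2.const_mul _) I1 fun p =>
      mul_le_mul_of_nonneg_right (hgε p) (mul_nonneg (hP2 _) (hs_grad_nonneg _ _))
  -- boundary integrals
  have cG : Continuous fun x => (x, h t0 x) := by fun_prop
  have cT : Continuous fun x => hsT n h t0 x :=
    (hs_T_cont hs).comp (by fun_prop : Continuous fun x : (Fin n → ℝ) => (t0, x))
  have cm : Continuous fun x => gradSqE n φ (x, h t0 x) := (hs_grad_continuous hφ1).comp cG
  have cB : Continuous fun x => pdE n φ (eY n) (x, h t0 x) := (hs_pdE_continuous hφ1 _).comp cG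
  have cX : ∀ i, Continuous fun x => pdX n (h t0) i x := fun i =>
    hs_pdX_continuous (hh.of_le (by simp)) i
  have cP : Continuous fun x => deriv P (h t0 x) := hP1c.comp hhc
  have cS : Continuous fun x => ∑ i, (pdX n (h t0) i x) ^ 2 :=
    continuous_finsetSum _ fun i _ => (cX i).pow 2
  have eb : (∫ x in cell n, (hsT n h t0 x - 1) *
          (deriv P (φ (x, h t0 x)) * gradSqE n φ (x, h t0 x))) =
      - (∫ x in cell n, deriv P (h t0 x) * (1 - pdE n φ (eY n) (x, h t0 x)) *
        ((hsT n h t0 x) ^ 2 + ∑ i, (pdX n (h t0) i x) ^ 2))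
      + 2 * ε * (∫ x in cell n, deriv P (h t0 x) * hsT n h t0 x)
      - 2 * (∫ x in cell n, deriv P (φ (x, h t0 x)) * g (x, h t0 x) * hsN n (h t0) φ x) := by
    rw [← integral_neg, ← integral_const_mul, ← integral_const_mul, ← integral_add, ← integral_sub]
    · congr 1
      funext x
      have e1 := heq x
      rw [hs_bdry_N hh hφ] at e1
      rw [hφ.boundary, hgb, hs_bdry_N hh hφ, hs_bdry_m hh hφ, e1]
      ring
    · refine hs_integrableOn_cell ?_
      fun_prop
    · refine hs_integrableOn_cell ?_
      simp only [hφ.boundary]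
      have := hs_N_continuous (hh.of_le (by simp)) hφ1
      have := hg.continuous.comp cG
      simp only [Function.comp_def] at this
      fun_prop
    · refine hs_integrableOn_cell ?_
      fun_prop
    · refine hs_integrableOn_cell ?_
      fun_prop
  rw [eA, eb]
  linarith



/-! ## One time step -/

/-- the Lyapunov functional -/
def hsI (n : ℕ) (h : ℝ → (Fin n → ℝ) → ℝ) (P : ℝ → ℝ) (t : ℝ) : ℝ :=
  - ∫ x in cell n, P (h t x) * hsT n h t x

/-- the dissipation -/
def hsD (n : ℕ) (h : ℝ → (Fin n → ℝ) → ℝ) (P : ℝ → ℝ) (t : ℝ) : ℝ :=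
  ∫ x in cell n, deriv P (h t x) * ((1 + hsT n h t x) / (1 + ∑ i, (pdX n (h t) i x) ^ 2)) *
    ((hsT n h t x) ^ 2 + ∑ i, (pdX n (h t) i x) ^ 2)

lemma hs_a_eq {n : ℕ} {h : ℝ → (Fin n → ℝ) → ℝ}
    (hs : ContDiff ℝ (⊤ : ℕ∞) (Function.uncurry h)) (t0 : ℝ)
    {φ : (Fin n → ℝ) × ℝ → ℝ} (hφ : IsHarmonicExt n (h t0) (h t0) φ)
    (heq : ∀ x, hsT n h t0 x = - hsN n (h t0) φ x) (x) :
    1 - pdE n φ (eY n) (x, h t0 x) =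
      (1 + hsT n h t0 x) / (1 + ∑ i, (pdX n (h t0) i x) ^ 2) := by
  have : 0 ≤ ∑ i, (pdX n (h t0) i x) ^ 2 := by positivity
  rw [heq, hs_bdry_N (hs_smooth_t hs t0) hφ]
  field_simp
  ring

lemma hs_psi_integrable {n : ℕ} {h : (Fin n → ℝ) → ℝ} (hh : Continuous h)
    {φ g : (Fin n → ℝ) × ℝ → ℝ} (hφ : ContDiff ℝ 1 φ) (hg : ContDiff ℝ 1 g)
    (hφi : IntegrableOn (gradSqE n φ) (fluidCell n h))
    (hgi : IntegrableOn (gradSqE n g) (fluidCell n h)) (δ : ℝ) :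
    IntegrableOn (gradSqE n (fun q => 1 * φ q + δ * g q)) (fluidCell n h) := by
  have dφ : Differentiable ℝ φ := hφ.differentiable (by simp)
  have dg : Differentiable ℝ g := hg.differentiable (by simp)
  have hdi := hs_dot_integrable hh hφ hg hφi hgi
  have e : gradSqE n (fun q => 1 * φ q + δ * g q) = fun p =>
      1 ^ 2 * gradSqE n φ p + 2 * 1 * δ * hsDot n φ g p + δ ^ 2 * gradSqE n g p :=
    funext fun p => hs_grad_lin dφ dg 1 δ p
  rw [e]
  exact ((hφi.const_mul _).add (hdi.const_mul _)).add (hgi.const_mul _)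

lemma hs_N_psi_tube {n : ℕ} {h : ℝ → (Fin n → ℝ) → ℝ}
    (hs : ContDiff ℝ (⊤ : ℕ∞) (Function.uncurry h)) (hp : ∀ t, ZPeriodic n (h t)) (t0 : ℝ)
    {φ g : (Fin n → ℝ) × ℝ → ℝ} (hφ : ContDiff ℝ 1 φ) (pφ : ZPeriodicE n φ)
    (hg : ContDiff ℝ 1 g) (pg : ZPeriodicE n g) (c : ℝ)
    (hc : ∀ x, |hsN n (h t0) φ x| < c) :
    ∀ᶠ δ in nhds (0:ℝ), ∀ x,
      |hsN n (fun x => h (t0 + δ) x - δ) (fun q => 1 * φ q + δ * g q) x| < c := by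
  have dφ : Differentiable ℝ φ := hφ.differentiable (by simp)
  have dg : Differentiable ℝ g := hg.differentiable (by simp)
  have e : ∀ (δ : ℝ) x, hsN n (fun x => h (t0 + δ) x - δ) (fun q => 1 * φ q + δ * g q) x =
      (1 * pdE n φ (eY n) (x, h (t0 + δ) x - δ) + δ * pdE n g (eY n) (x, h (t0 + δ) x - δ)) -
      ∑ i, pdX n (h (t0 + δ)) i x * (1 * pdE n φ (eX n i) (x, h (t0 + δ) x - δ) +
        δ * pdE n g (eX n i) (x, h (t0 + δ) x - δ)) := by
    intro δ x
    have : ∀ i, pdX n (fun x => h (t0 + δ) x - δ) i x = pdX n (h (t0 + δ)) i x := fun i => by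
      unfold pdX; rw [fderiv_sub_const]
    simp only [hsN, this, hs_pdE_lin dφ dg]
  have cH : Continuous fun p : ℝ × (Fin n → ℝ) => (p.2, h (t0 + p.1) p.2 - p.1) := by
    have := hs.continuous.comp (by fun_prop : Continuous fun p : ℝ × (Fin n → ℝ) => (t0 + p.1, p.2))
    simp only [Function.comp_def, Function.uncurry_apply_pair] at this
    fun_prop
  have q1 : ∀ v, Continuous fun p : ℝ × (Fin n → ℝ) => pdE n φ v (p.2, h (t0 + p.1) p.2 - p.1) :=
    fun v => (hs_pdE_continuous hφ v).comp cH
  have q2 : ∀ v, Continuous fun p : ℝ × (Fin n → ℝ) => pdE n g v (p.2, h (t0 + p.1) p.2 - p.1) :=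
    fun v => (hs_pdE_continuous hg v).comp cH
  have q3 : ∀ i, Continuous fun p : ℝ × (Fin n → ℝ) => pdX n (h (t0 + p.1)) i p.2 :=
    fun i => (hs_pdXt_cont hs i).comp
      (by fun_prop : Continuous fun p : ℝ × (Fin n → ℝ) => (t0 + p.1, p.2))
  simp only [e]
  refine hs_tube (n := n) (X := ℝ) _ ?_ ?_ 0 c ?_
  · refine Continuous.abs (Continuous.sub ?_ (continuous_finsetSum _ fun i _ => ?_))
    · exact (continuous_const.mul (q1 _)).add (continuous_fst.mul (q2 _))
    · exact (q3 i).mul ((continuous_const.mul (q1 _)).add (continuous_fst.mul (q2 _)))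
  · intro z x k
    simp only [hp _ x k, hs_periodicE_pd pφ _ x _ k, hs_periodicE_pd pg _ x _ k,
      hs_periodic_pdX (hp _) _ x k]
  · intro x
    have := hc x
    simpa [hsN] using this

lemma hs_onestep {n : ℕ} (hn : 1 ≤ n) {h : ℝ → (Fin n → ℝ) → ℝ}
    (hs : ContDiff ℝ (⊤ : ℕ∞) (Function.uncurry h)) (hp : ∀ t, ZPeriodic n (h t)) (t0 t1 : ℝ)
    (ht : t0 < t1)
    (ext : ∀ t, t0 ≤ t → t < t1 → ∃ φ, IsHarmonicExt n (h t) (h t) φ ∧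
      ∀ x, hsT n h t x = - hsN n (h t) φ x)
    {P : ℝ → ℝ} (hP : ContDiff ℝ 2 P) (hP1 : ∀ s, 0 ≤ deriv P s)
    (hP2 : ∀ s, 0 ≤ deriv (deriv P) s) (r : ℝ) (hr : - hsD n h P t0 < r) :
    ∀ᶠ δ in nhdsWithin (0:ℝ) (Set.Ioi 0), hsI n h P (t0 + δ) ≤ hsI n h P t0 + δ * r := by
  obtain ⟨φ, hφ, heq⟩ := ext t0 le_rfl ht
  have hh := hs_smooth_t hs t0
  have hhc := hh.continuous
  have hh1 : ContDiff ℝ 1 (h t0) := hh.of_le (by simp)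
  have hφ1 : ContDiff ℝ 1 φ := (hs_two hφ.smooth).of_le (by norm_num)
  have hP1c : Continuous (deriv P) := hP.continuous_deriv (by norm_num)
  have cT0 : Continuous (hsT n h t0) :=
    (hs_T_cont hs).comp (by fun_prop : Continuous fun x : (Fin n → ℝ) => (t0, x))
  have cT : Continuous fun p : ℝ × (Fin n → ℝ) => hsT n h (t0 + p.1) p.2 :=
    (hs_T_cont hs).comp (by fun_prop : Continuous fun p : ℝ × (Fin n → ℝ) => (t0 + p.1, p.2))
  have ch : Continuous fun p : ℝ × (Fin n → ℝ) => h (t0 + p.1) p.2 :=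
    hs.continuous.comp (by fun_prop : Continuous fun p : ℝ × (Fin n → ℝ) => (t0 + p.1, p.2))
  -- constants independent of ε
  obtain ⟨M0, M00, hM0⟩ := hs_bdd hhc (hp t0)
  have hφM0 := hs_ext_bound hn hh1 (hp t0) hφ M0 hM0
  obtain ⟨C, C0, hC⟩ := hs_bdd_strip hφ.smooth.continuous hφ.periodic (-M0) (M0 + 1)
  have hφM : ∀ p : (Fin n → ℝ) × ℝ, p.2 ≤ h t0 p.1 + 1 → |φ p| ≤ M0 + C := by
    rintro ⟨x, y⟩ hy
    simp only at hy
    have := abs_le.1 (hM0 x)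
    rcases le_total y (h t0 x) with hle | hle
    · exact (hφM0 (x, y) hle).trans (by linarith)
    · exact (hC x y (by linarith) (by linarith)).trans (by linarith)
  obtain ⟨CT, CT0, hCT⟩ := hs_bdd cT0 (hs_T_per hs hp t0)
  obtain ⟨c2, c20, hc2⟩ := hs_bdd_real hP1c (M0 + C + 1)
  set K := |(∫ x in cell n, deriv P (h t0 x) * hsT n h t0 x)
        + ∫ p in fluidCell n (h t0), deriv (deriv P) (φ p) * gradSqE n φ p| +
        c2 * ((CT + 1) + (CT + 1)) with hK
  have hK0 : 0 ≤ K := by positivity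
  set ρ := r + hsD n h P t0 with hρ
  have hρ0 : 0 < ρ := by linarith
  set ε := ρ / (4 * (K + 1)) with hεd
  have hε : 0 < ε := by positivity
  have hεK : 2 * ε * K ≤ ρ / 2 := by
    have : 2 * ε * (K + 1) = ρ / 2 := by rw [hεd]; field_simp; norm_num
    nlinarith
  -- the corrector
  have cG : ContDiff ℝ (⊤ : ℕ∞) fun x => (x, h t0 x) := contDiff_id.prodMk hh
  have sm : ContDiff ℝ (⊤ : ℕ∞) fun x => gradSqE n φ (x, h t0 x) := by
    have : ContDiff ℝ (⊤ : ℕ∞) (gradSqE n φ) := by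
      unfold gradSqE
      exact (ContDiff.sum fun i _ => (hs_pdE_contDiff hφ.smooth _).pow 2).add
        ((hs_pdE_contDiff hφ.smooth _).pow 2)
    exact this.comp cG
  obtain ⟨g, hg, pg, gl0, gl1, ⟨Cg, hCg⟩, gε, gb, gi⟩ := hs_exists_g sm hh
    (fun x k => by
      simp only [hp t0 x k, gradSqE, hs_periodicE_pd hφ.periodic _ x _ k]) (hp t0)
    (fun x => hs_grad_nonneg _ _) ε hε
  have hg1 : ContDiff ℝ 1 g := (hs_two hg).of_le (by norm_num)
  have Cg0 : 0 ≤ Cg := (abs_nonneg _).trans (hCg (0, h t0 0) (by simp))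
  -- smallness conditions
  obtain ⟨d1, d10, hd1⟩ := hs_bdry_step hs hp t0 hφ heq hg pg ε hε gb
  obtain ⟨d2, d20, hd2⟩ := hs_lap_step hs hp t0 hφ hg pg gl0 gl1
  have v1 := hs_tube (n := n) (X := ℝ) (fun x δ => |h (t0 + δ) x|) ch.abs
    (fun z x k => by simp only [hp _ x k]) 0 (M0 + 1) (fun x => by
      have := hM0 x; simp only [add_zero]; linarith)
  have v2 := hs_tube (n := n) (X := ℝ) (fun x δ => h (t0 + δ) x - δ - h t0 x)
    ((ch.sub continuous_fst).sub (hhc.comp continuous_snd))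
    (fun z x k => by simp only [hp _ x k]) 0 1 (fun x => by simp)
  have v3 := hs_tube (n := n) (X := ℝ) (fun x δ => |hsT n h (t0 + δ) x|) cT.abs
    (fun z x k => by simp only [hs_T_per hs hp _ x k]) 0 (CT + 1) (fun x => by
      have := hCT x; simp only [add_zero]; linarith)
  have v4 := hs_N_psi_tube hs hp t0 hφ1 hφ.periodic hg1 pg (CT + 1) (fun x => by
    have := hCT x
    rw [heq, abs_neg] at this; linarith)
  have v5 : ∀ᶠ δ in nhds (0:ℝ), δ < min (min d1 d2) (min (1 / (Cg + 1)) (t1 - t0)) :=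
    Iio_mem_nhds (lt_min (lt_min d10 d20) (lt_min (by positivity) (by linarith)))
  have M1 : ∀ p ∈ fluidCell n (h t0), |φ p| ≤ M0 := fun p hp => hφM0 p hp.2.le
  have M2 : ∀ p ∈ fluidCell n (h t0), |g p| ≤ Cg := fun p hp => hCg p (by have := hp.2; linarith)
  have vR := hs_R_deriv hhc (hp t0) hφ1 hg1 hφ.periodic pg hP M0 Cg M1 M2 hφ.gradL2 gi
    (fun δ x => h (t0 + δ) x - δ) (fun δ x => hsT n h (t0 + δ) x - 1)
    (fun x s => by
      have e1 : HasDerivAt (fun δ => h (t0 + δ) x) (hsT n h (t0 + s) x) s :=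
        HasDerivAt.comp_const_add t0 s (hs_T_deriv hs (t0 + s) x)
      exact e1.sub (hasDerivAt_id s))
    (fun s => (hs_smooth_t hs (t0 + s)).continuous.sub continuous_const)
    (cT.sub continuous_const) (fun s x k => by simp only [hs_T_per hs hp _ x k])
    (fun x => by simp) (ρ / 2) (by positivity)
  have var := hs_variation hn hs hp t0 hφ heq hg pg ε gb gε gi hP hP2 M0 Cg M1 M2
  have en := (hs_energy hn hh1 (hp t0) hφ hP (hs_two hφ.smooth) hφ.periodic M0 hφM0 hφ.gradL2).2
  simp only [hs_dot_self] at en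
  filter_upwards [vR, self_mem_nhdsWithin, mem_nhdsWithin_of_mem_nhds v1,
    mem_nhdsWithin_of_mem_nhds v2, mem_nhdsWithin_of_mem_nhds v3, mem_nhdsWithin_of_mem_nhds v4,
    mem_nhdsWithin_of_mem_nhds v5] with δ wR hδ w1 w2 w3 w4 w5
  have hδ : 0 < δ := hδ
  simp only [lt_min_iff] at w5
  obtain ⟨⟨w51, w52⟩, w53, w54⟩ := w5
  rw [lt_div_iff₀ (by positivity)] at w53
  obtain ⟨φδ, hφδ, heqδ⟩ := ext (t0 + δ) (by linarith) (by linarith)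
  have hhδ := hs_smooth_t hs (t0 + δ)
  have step := hs_step hn (h := fun x => h (t0 + δ) x - δ) (b := h (t0 + δ))
    ((hhδ.of_le (by simp)).sub contDiff_const) (fun x k => by simp only [hp _ x k])
    hhδ.continuous (hs_shift hφδ δ) hP hP1 hP2
    (ψ := fun q => 1 * φ q + δ * g q)
    ((contDiff_const.mul (hs_two hφ.smooth)).add (contDiff_const.mul (hs_two hg)))
    (fun x y k => by simp only [hφ.periodic x y k, pg x y k]) (M0 + C + 1)
    (fun p hpp => by
      have u1 := w2 p.1
      have u2 : p.2 ≤ h t0 p.1 + 1 := by linarith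
      have u3 : |δ * g p| ≤ 1 := by
        rw [abs_mul, abs_of_pos hδ]
        have := hCg p u2
        nlinarith
      calc |1 * φ p + δ * g p| ≤ |1 * φ p| + |δ * g p| := abs_add_le _ _
        _ ≤ M0 + C + 1 := by
          rw [one_mul]; have := hφM p u2; linarith)
    (fun x => by have := w1 x; linarith)
    (hs_fluid_integrable_change hhc (hhδ.continuous.sub continuous_const)
      (hs_grad_continuous ((contDiff_const.mul hφ1).add (contDiff_const.mul hg1)))
      (hs_psi_integrable hhc hφ1 hg1 hφ.gradL2 gi δ))
    (hd2 δ hδ.le w52) (2 * ε * δ) (fun x => (hd1 δ hδ.le w51 x).1)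
    (fun x => (hd1 δ hδ.le w51 x).2) (CT + 1) c2 (CT + 1)
    (fun x => by
      rw [hs_N_shift]
      have := (w3 x).le
      rwa [heqδ, abs_neg] at this) hc2 (fun x => (w4 x).le)
  have eI : hsI n h P (t0 + δ) = ∫ x in cell n, P (h (t0 + δ) x) *
      hsN n (fun x => h (t0 + δ) x - δ) (fun q => φδ (q.1, q.2 + δ)) x := by
    unfold hsI
    rw [← integral_neg]
    congr 1
    funext x
    rw [hs_N_shift, heqδ]; ring
  have eI0 : hsI n h P t0 = ∫ p in fluidCell n (h t0), deriv P (φ p) * gradSqE n φ p := by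
    rw [en]
    unfold hsI
    rw [← integral_neg]
    congr 1
    funext x
    rw [hφ.boundary, heq]; ring
  have eD : hsD n h P t0 = ∫ x in cell n, deriv P (h t0 x) * (1 - pdE n φ (eY n) (x, h t0 x)) *
        ((hsT n h t0 x) ^ 2 + ∑ i, (pdX n (h t0) i x) ^ 2) := by
    unfold hsD
    congr 1
    funext x
    rw [hs_a_eq hs t0 hφ heq]
  rw [← eI] at step
  rw [← eI0] at wR
  simp only [add_zero] at wR
  rw [← eD] at var
  have fin : 2 * ε * ((∫ x in cell n, deriv P (h t0 x) * hsT n h t0 x)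
        + ∫ p in fluidCell n (h t0), deriv (deriv P) (φ p) * gradSqE n φ p) +
        2 * ε * (c2 * ((CT + 1) + (CT + 1))) ≤ ρ / 2 := by
    refine le_trans ?_ hεK
    rw [hK, ← mul_add]
    gcongr
    exact le_abs_self _
  set A1 := (∫ p in fluidCell n (h t0), (deriv (deriv P) (φ p) * g p * gradSqE n φ p
          + deriv P (φ p) * (2 * hsDot n φ g p)))
      + (∫ x in cell n, (hsT n h t0 x - 1) *
          (deriv P (φ (x, h t0 x)) * gradSqE n φ (x, h t0 x)))
  have tot : A1 + ρ / 2 + 2 * ε * (c2 * ((CT + 1) + (CT + 1))) ≤ r := by linarith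
  have := mul_le_mul_of_nonneg_left tot hδ.le
  nlinarith


/-! ## Conclusion -/

lemma hs_conv_second {f : ℝ → ℝ} (hf : Differentiable ℝ f) (hc : ConvexOn ℝ Set.univ f) (s : ℝ) :
    0 ≤ deriv (deriv f) s := by
  have h1 := hc.monotoneOn_deriv (fun x _ => hf x)
  exact (monotoneOn_univ.1 h1).deriv_nonneg

lemma hs_I_cont {n : ℕ} {h : ℝ → (Fin n → ℝ) → ℝ}
    (hs : ContDiff ℝ (⊤ : ℕ∞) (Function.uncurry h)) {P : ℝ → ℝ} (hP : Continuous P) :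
    Continuous (hsI n h P) := by
  unfold hsI
  simp only [setIntegral_congr_set (hs_cell_ae (n := n))]
  refine Continuous.neg ?_
  refine continuous_parametric_integral_of_continuous
    (f := fun t x => P (h t x) * hsT n h t x) ?_ isCompact_Icc
  exact (hP.comp hs.continuous).mul (hs_T_cont hs)

lemma hs_D_cont {n : ℕ} {h : ℝ → (Fin n → ℝ) → ℝ}
    (hs : ContDiff ℝ (⊤ : ℕ∞) (Function.uncurry h)) {P : ℝ → ℝ} (hP : Continuous (deriv P)) :
    Continuous (hsD n h P) := by
  unfold hsD
  simp only [setIntegral_congr_set (hs_cell_ae (n := n))]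
  refine continuous_parametric_integral_of_continuous
    (f := fun t x => deriv P (h t x) * ((1 + hsT n h t x) / (1 + ∑ i, (pdX n (h t) i x) ^ 2)) *
      ((hsT n h t x) ^ 2 + ∑ i, (pdX n (h t) i x) ^ 2)) ?_ isCompact_Icc
  have hsum : Continuous fun p : ℝ × (Fin n → ℝ) => ∑ i, (pdX n (h p.1) i p.2) ^ 2 :=
    continuous_finsetSum _ fun i _ => (hs_pdXt_cont hs i).pow 2
  have hT := hs_T_cont hs
  refine ((hP.comp hs.continuous).mul ?_).mul ((hT.pow 2).add hsum)
  refine (continuous_const.add hT).div (continuous_const.add hsum) fun p => ?_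
  have : 0 ≤ ∑ i, (pdX n (h p.1) i p.2) ^ 2 := by positivity
  positivity

lemma hs_main_ineq {n : ℕ} (hn : 1 ≤ n) {h : ℝ → (Fin n → ℝ) → ℝ}
    (hs : ContDiff ℝ (⊤ : ℕ∞) (Function.uncurry h)) (hp : ∀ t, ZPeriodic n (h t)) (s t : ℝ)
    (hst : s ≤ t)
    (ext : ∀ τ, s ≤ τ → τ ≤ t → ∃ φ, IsHarmonicExt n (h τ) (h τ) φ ∧
      ∀ x, hsT n h τ x = - hsN n (h τ) φ x)
    {P : ℝ → ℝ} (hP : ContDiff ℝ 2 P) (hP1 : ∀ s, 0 ≤ deriv P s)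
    (hP2 : ∀ s, 0 ≤ deriv (deriv P) s) :
    hsI n h P t + ∫ τ in s..t, hsD n h P τ ≤ hsI n h P s := by
  have hI := hs_I_cont hs hP.continuous
  have hD := hs_D_cont hs (hP.continuous_deriv (by norm_num))
  have hder : ∀ x, HasDerivAt (fun t => hsI n h P s - ∫ τ in s..t, hsD n h P τ)
      (- hsD n h P x) x := by
    intro x
    have := (intervalIntegral.integral_hasDerivAt_right (hD.intervalIntegrable s x)
      hD.stronglyMeasurable.stronglyMeasurableAtFilter hD.continuousAt).const_sub (hsI n h P s)
    exact this
  have key := image_le_of_liminf_slope_right_le_deriv_boundary (f := hsI n h P) (a := s) (b := t)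
    hI.continuousOn (B := fun t => hsI n h P s - ∫ τ in s..t, hsD n h P τ)
    (B' := fun t => - hsD n h P t) (by simp)
    (fun x _ => (hder x).continuousAt.continuousWithinAt)
    (fun x _ => (hder x).hasDerivWithinAt) ?_ (Set.right_mem_Icc.2 hst)
  · linarith
  intro x hx r hr
  obtain ⟨r', h1, h2⟩ := exists_between hr
  have hone := hs_onestep hn hs hp x t hx.2
    (fun τ ha hb => ext τ (hx.1.trans ha) hb.le) hP hP1 hP2 r' h1
  have htend : Filter.Tendsto (fun z : ℝ => z - x) (nhdsWithin x (Set.Ioi x))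
      (nhdsWithin 0 (Set.Ioi 0)) := by
    refine tendsto_nhdsWithin_iff.2 ⟨?_, ?_⟩
    · have : Filter.Tendsto (fun z : ℝ => z - x) (nhds x) (nhds (x - x)) :=
        (continuous_id.sub continuous_const).tendsto x
      rw [sub_self] at this
      exact this.mono_left nhdsWithin_le_nhds
    · filter_upwards [self_mem_nhdsWithin] with z hz
      exact Set.mem_Ioi.2 (sub_pos.2 (Set.mem_Ioi.1 hz))
  refine Filter.Eventually.frequently ?_
  filter_upwards [htend.eventually hone, self_mem_nhdsWithin] with z hz hzx
  have hzx' : 0 < z - x := sub_pos.2 hzx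
  rw [add_sub_cancel] at hz
  rw [slope_def_field, div_lt_iff₀ hzx']
  nlinarith

lemma hs_sol_ext {n : ℕ} {T : ℝ} {h : ℝ → (Fin n → ℝ) → ℝ} (hsol : IsHeleShawSol n T h)
    (t : ℝ) (ht : t ∈ Set.Icc 0 T) :
    ∃ φ, IsHarmonicExt n (h t) (h t) φ ∧ (∀ x, hsT n h t x = - hsN n (h t) φ x) ∧
      (∀ x, DtN n (h t) (h t) x = - hsT n h t x) ∧
      (∀ x, HSa n h t x = 1 - pdE n φ (eY n) (x, h t x)) := by
  have H := hsol.extension t ht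
  have hD : ∀ x, DtN n (h t) (h t) x = - hsT n h t x := by
    intro x
    have := hsol.equation t ht x
    rw [(hs_T_deriv hsol.smooth t x).deriv] at this
    linarith
  refine ⟨H.choose, H.choose_spec, ?_, hD, ?_⟩
  · intro x
    have h1 := hD x
    have h2 : DtN n (h t) (h t) x = hsN n (h t) H.choose x := by
      unfold DtN
      rw [dif_pos H]
      rfl
    linarith
  · intro x
    unfold HSa HSB Bop
    rw [dif_pos H]

/-- for a C³ convex nonnegative Φ with Φ' convex, for every 0 ≤ T' ≤ T,
∫ Φ'(h(T'))G(h(T'))h(T') dx + ∫₀^{T'}∫ Φ''(h) a ((∂ₜh)² + |∇ₓh|²) dx dt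
  ≤ ∫ Φ'(h(0))G(h(0))h(0) dx;
in particular t ↦ ∫ Φ'(h(t))G(h(t))h(t) dx is non-increasing on [0,T]. -/
theorem heleShaw_coercive_lyapunov (n : ℕ) (hn : 1 ≤ n) (T : ℝ) (hT : 0 ≤ T)
    (h : ℝ → (Fin n → ℝ) → ℝ) (hsol : IsHeleShawSol n T h)
    (Φ : ℝ → ℝ) (hΦpos : ∀ s, 0 ≤ Φ s) (hΦC3 : ContDiff ℝ 3 Φ)
    (hΦconv : ConvexOn ℝ Set.univ Φ) (hΦ'conv : ConvexOn ℝ Set.univ (deriv Φ)) :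
    (∀ T', 0 ≤ T' → T' ≤ T →
      (∫ x in cell n, deriv Φ (h T' x) * DtN n (h T') (h T') x)
      + (∫ t in (0:ℝ)..T', ∫ x in cell n,
            deriv (deriv Φ) (h t x) * HSa n h t x *
              ((deriv (fun s => h s x) t)^2 + ∑ i, (pdX n (h t) i x)^2))
      ≤ ∫ x in cell n, deriv Φ (h 0 x) * DtN n (h 0) (h 0) x) ∧
    AntitoneOn (fun t => ∫ x in cell n, deriv Φ (h t x) * DtN n (h t) (h t) x)
      (Set.Icc 0 T) := by

  have hs := hsol.smooth
  have hp := hsol.periodic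
  have hP : ContDiff ℝ 2 (deriv Φ) := by
    have h3 : ContDiff ℝ (2 + 1) Φ := by
      have : (2 + 1 : WithTop ℕ∞) = 3 := by norm_num
      rw [this]
      exact hΦC3
    exact (contDiff_succ_iff_deriv.1 h3).2.2
  have hP1 : ∀ s, 0 ≤ deriv (deriv Φ) s :=
    hs_conv_second (hΦC3.differentiable (by norm_num)) hΦconv
  have hP2 : ∀ s, 0 ≤ deriv (deriv (deriv Φ)) s :=
    hs_conv_second (hP.differentiable (by norm_num)) hΦ'conv
  have hIeq : ∀ t ∈ Set.Icc 0 T, (∫ x in cell n, deriv Φ (h t x) * DtN n (h t) (h t) x)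
      = hsI n h (deriv Φ) t := by
    intro t ht
    obtain ⟨φ, hφ, heq, hD, ha⟩ := hs_sol_ext hsol t ht
    unfold hsI
    rw [← integral_neg]
    congr 1
    funext x
    rw [hD]
    ring
  have hDeq : ∀ t ∈ Set.Icc 0 T, (∫ x in cell n,
            deriv (deriv Φ) (h t x) * HSa n h t x *
              ((deriv (fun s => h s x) t)^2 + ∑ i, (pdX n (h t) i x)^2))
      = hsD n h (deriv Φ) t := by
    intro t ht
    obtain ⟨φ, hφ, heq, hD, ha⟩ := hs_sol_ext hsol t ht
    unfold hsD
    congr 1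
    funext x
    rw [ha, hs_a_eq hs t hφ heq, (hs_T_deriv hs t x).deriv]
  have hDpos : ∀ t ∈ Set.Icc 0 T, 0 ≤ hsD n h (deriv Φ) t := by
    intro t ht
    obtain ⟨φ, hφ, heq, hD, ha⟩ := hs_sol_ext hsol t ht
    unfold hsD
    refine integral_nonneg fun x => ?_
    have h1 := hs_B_le_one hn ((hs_smooth_t hs t).of_le (by simp)) (hp t) hφ x
    have h2 := hs_a_eq hs t hφ heq x
    refine mul_nonneg (mul_nonneg (hP1 _) ?_) (by positivity)
    rw [← h2]
    linarith
  have hmain : ∀ s t, 0 ≤ s → s ≤ t → t ≤ T →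
      hsI n h (deriv Φ) t + ∫ τ in s..t, hsD n h (deriv Φ) τ ≤ hsI n h (deriv Φ) s := by
    intro s t h0 hst htT
    refine hs_main_ineq hn hs hp s t hst ?_ hP hP1 hP2
    intro τ ha hb
    obtain ⟨φ, hφ, heq, -⟩ := hs_sol_ext hsol τ ⟨h0.trans ha, hb.trans htT⟩
    exact ⟨φ, hφ, heq⟩
  refine ⟨?_, ?_⟩
  · intro T' h0 h1
    rw [hIeq T' ⟨h0, h1⟩, hIeq 0 ⟨le_rfl, hT⟩, intervalIntegral.integral_congr
      (g := fun t => hsD n h (deriv Φ) t)]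
    · exact hmain 0 T' le_rfl h0 h1
    · intro t ht
      rw [Set.uIcc_of_le h0] at ht
      exact hDeq t ⟨ht.1, ht.2.trans h1⟩
  · intro s hsm t htm hst
    simp only
    rw [hIeq s hsm, hIeq t htm]
    have h1 := hmain s t hsm.1 hst htm.2
    have h2 : 0 ≤ ∫ τ in s..t, hsD n h (deriv Φ) τ :=
      intervalIntegral.integral_nonneg hst fun τ hτ =>
        hDpos τ ⟨hsm.1.trans hτ.1, hτ.2.trans htm.2⟩
    linarith

end
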